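/- arXiv:0705.2287 — 3 statements merged into one kernel-verified Lean document; each statement's English description precedes it below -/
import Mathlib

section
/- Uniqueness under the uniform exterior ball condition: Let p > 1 and f(t) = t₊^p := (max(t,0))^p. Assume Ω ⊂ ℝⁿ (n ≥ 2) is a bounded domain satisfying the uniform exterior ball condition with some constants δ₁ ∈ (0,1) and r₁ > 0. Then there exists at most one function u ∈ C²(Ω) satisfying Lu(x) = (u(x))₊^p for all x ∈ Ω and u(x) → +∞ as d(x) → 0. -/
open Metric Set Filter Real Bornology

/-- First-order partial derivative `D_i u (x)`. -/
noncomputable def pd {n : ℕ} (u : EuclideanSpace ℝ (Fin n) → ℝ) (i : Fin n)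
    (x : EuclideanSpace ℝ (Fin n)) : ℝ :=
  fderiv ℝ u x (EuclideanSpace.single i 1)

/-- Second-order partial derivative `D_{ij} u (x)`. -/
noncomputable def pd2 {n : ℕ} (u : EuclideanSpace ℝ (Fin n) → ℝ) (i j : Fin n)
    (x : EuclideanSpace ℝ (Fin n)) : ℝ :=
  fderiv ℝ (fun y => fderiv ℝ u y (EuclideanSpace.single j 1)) x (EuclideanSpace.single i 1)

/-- The operator `L u = a^{ij} D_{ij} u + b^i D_i u - c u`. -/
noncomputable def Lop {n : ℕ} (a : EuclideanSpace ℝ (Fin n) → Fin n → Fin n → ℝ)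
    (b : EuclideanSpace ℝ (Fin n) → Fin n → ℝ) (c : EuclideanSpace ℝ (Fin n) → ℝ)
    (u : EuclideanSpace ℝ (Fin n) → ℝ) (x : EuclideanSpace ℝ (Fin n)) : ℝ :=
  (∑ i, ∑ j, a x i j * pd2 u i j x) + (∑ i, b x i * pd u i x) - c x * u x

/-- The standing assumptions on the coefficients of `L`: measurability, symmetry,
`Σ (b^i)² ≤ K`, `0 ≤ c ≤ K`, `K > 0`, and uniform ellipticity `λ|ξ|² ≤ aᵢⱼξᵢξⱼ ≤ Λ|ξ|²`
with `0 < λ ≤ Λ`. -/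
def CoeffsOK {n : ℕ} (a : EuclideanSpace ℝ (Fin n) → Fin n → Fin n → ℝ)
    (b : EuclideanSpace ℝ (Fin n) → Fin n → ℝ) (c : EuclideanSpace ℝ (Fin n) → ℝ)
    (K lam Lam : ℝ) : Prop :=
  (∀ i j, Measurable fun x => a x i j) ∧ (∀ i, Measurable fun x => b x i) ∧
  Measurable c ∧ (∀ x i j, a x i j = a x j i) ∧
  (∀ x, ∑ i, (b x i) ^ 2 ≤ K) ∧ (∀ x, 0 ≤ c x ∧ c x ≤ K) ∧
  0 < K ∧ 0 < lam ∧ lam ≤ Lam ∧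
  (∀ x (ξ : EuclideanSpace ℝ (Fin n)),
    lam * ‖ξ‖ ^ 2 ≤ ∑ i, ∑ j, a x i j * ξ i * ξ j ∧
    ∑ i, ∑ j, a x i j * ξ i * ξ j ≤ Lam * ‖ξ‖ ^ 2)

/-- `u(x) → +∞` as `d(x) := dist(x, ∂Ω) → 0`. -/
def BlowsUp {n : ℕ} (Ω : Set (EuclideanSpace ℝ (Fin n)))
    (u : EuclideanSpace ℝ (Fin n) → ℝ) : Prop :=
  ∀ M : ℝ, ∃ δ > 0, ∀ x ∈ Ω, infDist x (frontier Ω) < δ → M ≤ u x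

abbrev EE (n : ℕ) := EuclideanSpace ℝ (Fin n)

lemma cda_fderiv_diff {n : ℕ} {f : EE n → ℝ} {x : EE n} (hf : ContDiffAt ℝ 2 f x) :
    DifferentiableAt ℝ (fderiv ℝ f) x :=
  (hf.fderiv_right (m := 1) (by norm_num)).differentiableAt (by norm_num)

lemma pd2_eq {n : ℕ} {f : EE n → ℝ} {x : EE n} (hf : ContDiffAt ℝ 2 f x) (i j : Fin n) :
    pd2 f i j x = (fderiv ℝ (fderiv ℝ f) x (EuclideanSpace.single i 1))
      (EuclideanSpace.single j 1) := by
  unfold pd2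
  rw [fderiv_clm_apply (cda_fderiv_diff hf) (differentiableAt_const _)]
  simp

lemma hess_nonpos {n : ℕ} {f : EE n → ℝ} {x : EE n} (hf : ContDiffAt ℝ 2 f x)
    (hm : IsLocalMax f x) (ξ : EE n) : (fderiv ℝ (fderiv ℝ f) x ξ) ξ ≤ 0 := by
  by_contra! hpos
  set l : ℝ → EE n := fun t => x + t • ξ with hl
  have hld : ∀ t, HasDerivAt l ξ t := fun t => by
    have h := ((hasDerivAt_id t).smul_const ξ).const_add x
    rw [one_smul] at h
    exact h
  have hl0 : l 0 = x := by simp [hl]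
  have hlc : Tendsto l (nhds 0) (nhds x) := by
    have := (hld 0).continuousAt.tendsto
    rwa [hl0] at this
  have hev : ∀ᶠ y in nhds x, DifferentiableAt ℝ f y := by
    have := hf.eventually (by norm_num)
    filter_upwards [this] with y hy using hy.differentiableAt (by norm_num)
  have hd : ∀ᶠ t in nhds (0:ℝ), deriv (f ∘ l) t = fderiv ℝ f (l t) ξ := by
    filter_upwards [hlc.eventually hev] with t ht
    exact (ht.hasFDerivAt.comp_hasDerivAt t (hld t)).deriv
  have hdd : deriv (deriv (f ∘ l)) 0 = (fderiv ℝ (fderiv ℝ f) x ξ) ξ := by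
    rw [Filter.EventuallyEq.deriv_eq hd]
    have h1 : HasFDerivAt (fderiv ℝ f) (fderiv ℝ (fderiv ℝ f) x) (l 0) := by
      rw [hl0]; exact (cda_fderiv_diff hf).hasFDerivAt
    have h2 := (h1.comp_hasDerivAt 0 (hld 0)).clm_apply (hasDerivAt_const 0 ξ)
    simpa using h2.deriv
  have hd0 : deriv (f ∘ l) 0 = 0 := by
    rw [hd.self_of_nhds, hl0, hm.fderiv_eq_zero]; simp
  have hc : ContinuousAt (f ∘ l) 0 := by
    apply ContinuousAt.comp
    · rw [hl0]; exact hf.continuousAt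
    · exact (hld 0).continuousAt
  have hmin := isLocalMin_of_deriv_deriv_pos (by rw [hdd]; exact hpos) hd0 hc
  have hconst : f ∘ l =ᶠ[nhds 0] fun _ => f x := by
    filter_upwards [hmin, hlc.eventually hm] with t h1 h2
    simp only [Function.comp, hl0] at h1 h2 ⊢
    linarith
  have hz : deriv (f ∘ l) =ᶠ[nhds 0] fun _ => 0 := by
    filter_upwards [hconst.eventuallyEq_nhds] with t ht
    rw [ht.deriv_eq]; simp
  rw [hz.deriv_eq] at hdd
  simp at hdd
  linarith

lemma Lop_localMax {n : ℕ} {a : EE n → Fin n → Fin n → ℝ} {b : EE n → Fin n → ℝ} {c : EE n → ℝ}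
    {K lam Lam : ℝ} (hco : CoeffsOK a b c K lam Lam) {f : EE n → ℝ} {x : EE n}
    (hf : ContDiffAt ℝ 2 f x) (hm : IsLocalMax f x) : Lop a b c f x ≤ - c x * f x := by
  obtain ⟨-, -, -, hsym, -, -, -, hlam, -, hell⟩ := hco
  have h1 : ∑ i, b x i * pd f i x = 0 := by
    apply Finset.sum_eq_zero; intro i _
    simp [pd, hm.fderiv_eq_zero]
  have h2 : ∑ i, ∑ j, a x i j * pd2 f i j x ≤ 0 := by
    have hps : (Matrix.of (a x)).PosSemidef := by
      apply Matrix.PosSemidef.of_dotProduct_mulVec_nonneg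
      · ext i j; simp [hsym x i j]
      · intro v
        have := (hell x (WithLp.toLp 2 v)).1
        have h0 : (0:ℝ) ≤ lam * ‖WithLp.toLp 2 v‖^2 := by positivity
        refine (h0.trans this).trans (le_of_eq ?_)
        simp only [dotProduct, Matrix.mulVec, Matrix.of_apply, Finset.mul_sum]
        refine Finset.sum_congr rfl fun i _ => Finset.sum_congr rfl fun j _ => ?_
        simp; ring
    obtain ⟨m, B, hB⟩ := Matrix.posSemidef_iff_eq_sum_vecMulVec.1 hps
    have hB' : ∀ i j, a x i j = ∑ k, B k i * B k j := by
      intro i j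
      have := congrFun (congrFun hB i) j
      simpa [Matrix.sum_apply, Matrix.vecMulVec_apply] using this
    have key : ∑ i, ∑ j, a x i j * pd2 f i j x =
        ∑ k, (fderiv ℝ (fderiv ℝ f) x (WithLp.toLp 2 (B k))) (WithLp.toLp 2 (B k)) := by
      have hexp : ∀ k, (WithLp.toLp 2 (B k) : EE n) =
          ∑ i, B k i • (EuclideanSpace.single i (1:ℝ)) := by
        intro k; ext j; simp [Finset.sum_apply, Pi.single_apply]
      simp only [hexp, map_sum, map_smul, sum_apply,
        smul_apply, smul_eq_mul, hB', Finset.sum_mul, pd2_eq hf]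
      simp only [Finset.mul_sum]
      rw [Finset.sum_comm_cycle]
      refine Finset.sum_congr rfl fun k _ => ?_
      rw [Finset.sum_comm]
      refine Finset.sum_congr rfl fun j _ => Finset.sum_congr rfl fun i _ => by ring
    rw [key]
    exact Finset.sum_nonpos fun k _ => hess_nonpos hf hm _
  unfold Lop
  linarith

lemma Lop_lin {n : ℕ} (a : EE n → Fin n → Fin n → ℝ) (b : EE n → Fin n → ℝ) (c : EE n → ℝ)
    {f g : EE n → ℝ} {x : EE n} (k : ℝ)
    (hf : ContDiffAt ℝ 2 f x) (hg : ContDiffAt ℝ 2 g x) :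
    Lop a b c (fun y => f y - k * g y) x = Lop a b c f x - k * Lop a b c g x := by
  have hfg : ContDiffAt ℝ 2 (fun y => f y - k * g y) x := hf.sub (contDiffAt_const.mul hg)
  have ev : ∀ {h : EE n → ℝ}, ContDiffAt ℝ 2 h x → ∀ᶠ y in nhds x, DifferentiableAt ℝ h y := by
    intro h hh
    have := hh.eventually (by norm_num)
    filter_upwards [this] with y hy using hy.differentiableAt (by norm_num)
  have h1 : fderiv ℝ (fun y => f y - k * g y) =ᶠ[nhds x]
      fun y => fderiv ℝ f y - k • fderiv ℝ g y := by
    filter_upwards [ev hf, ev hg] with y hfy hgy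
    rw [fderiv_fun_sub hfy (hgy.const_mul k), fderiv_const_mul hgy]
  have h2 : fderiv ℝ (fderiv ℝ (fun y => f y - k * g y)) x =
      fderiv ℝ (fderiv ℝ f) x - k • fderiv ℝ (fderiv ℝ g) x := by
    rw [h1.fderiv_eq, fderiv_fun_sub (cda_fderiv_diff hf) ((cda_fderiv_diff hg).fun_const_smul k),
      fderiv_fun_const_smul (cda_fderiv_diff hg)]
  unfold Lop
  simp only [pd2_eq hf, pd2_eq hg, pd2_eq hfg, h2, pd, h1.self_of_nhds,
    sub_apply, smul_apply, smul_eq_mul, mul_sub,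
    Finset.sum_sub_distrib, Finset.mul_sum, mul_add]
  simp only [mul_left_comm _ k, ← Finset.mul_sum]
  ring

/-- `L` applied to a radial function. -/
lemma Lop_radial {n : ℕ} (a : EE n → Fin n → Fin n → ℝ) (b : EE n → Fin n → ℝ) (c : EE n → ℝ)
    {ψ ψ' : ℝ → ℝ} {ψ'' : ℝ} (y x : EE n)
    (h1 : ∀ᶠ s in nhds (‖x - y‖ ^ 2), HasDerivAt ψ (ψ' s) s)
    (h2 : HasDerivAt ψ' ψ'' (‖x - y‖ ^ 2)) :
    Lop a b c (fun z => ψ (‖z - y‖ ^ 2)) x =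
      4 * ψ'' * (∑ i, ∑ j, a x i j * (x - y) i * (x - y) j) + 2 * ψ' (‖x - y‖ ^ 2) * ∑ i, a x i i
      + 2 * ψ' (‖x - y‖ ^ 2) * (∑ i, b x i * (x - y) i) - c x * ψ (‖x - y‖ ^ 2) := by
  have hN : ∀ z : EE n, HasFDerivAt (fun z => ‖z - y‖ ^ 2) (2 • innerSL ℝ (z - y)) z := by
    intro z
    simpa using ((hasFDerivAt_id z).sub_const y).norm_sq
  have hF : ∀ᶠ z in nhds x, fderiv ℝ (fun z => ψ (‖z - y‖ ^ 2)) z =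
      ψ' (‖z - y‖ ^ 2) • (2 • innerSL ℝ (z - y)) := by
    have ht : Tendsto (fun z : EE n => ‖z - y‖ ^ 2) (nhds x) (nhds (‖x - y‖ ^ 2)) :=
      (hN x).continuousAt
    filter_upwards [ht.eventually h1] with z hz
    exact (hz.comp_hasFDerivAt z (hN z)).fderiv
  have hpd : ∀ i, pd (fun z => ψ (‖z - y‖ ^ 2)) i x = 2 * ψ' (‖x - y‖ ^ 2) * (x - y) i := by
    intro i
    rw [pd, hF.self_of_nhds]
    simp [EuclideanSpace.inner_single_right]; ring
  have hpd2 : ∀ i j, pd2 (fun z => ψ (‖z - y‖ ^ 2)) i j x =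
      4 * ψ'' * ((x - y) i * (x - y) j) + 2 * ψ' (‖x - y‖ ^ 2) * (if i = j then 1 else 0) := by
    intro i j
    have hev : (fun z => fderiv ℝ (fun z => ψ (‖z - y‖ ^ 2)) z (EuclideanSpace.single j 1)) =ᶠ[nhds x]
        fun z => ψ' (‖z - y‖ ^ 2) * (2 * (EuclideanSpace.proj (𝕜 := ℝ) j (z - y))) := by
      filter_upwards [hF] with z hz
      rw [hz]
      simp [EuclideanSpace.inner_single_right]
    rw [pd2, hev.fderiv_eq]
    have hA := h2.comp_hasFDerivAt x (hN x)
    have hB : HasFDerivAt (fun z => 2 * (EuclideanSpace.proj (𝕜 := ℝ) j (z - y)))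
      ((2:ℝ) • (EuclideanSpace.proj j : EE n →L[ℝ] ℝ)) x := by
      have := ((EuclideanSpace.proj j : EE n →L[ℝ] ℝ).hasFDerivAt.comp x
        ((hasFDerivAt_id x).sub_const y)).const_mul 2
      simpa using this
    have := (hA.mul hB).fderiv
    simp only [Function.comp_def, Pi.mul_def] at this
    rw [this]
    simp [EuclideanSpace.inner_single_right, Pi.single_apply, eq_comm]
    ring
  unfold Lop
  simp only [hpd, hpd2, mul_add, Finset.sum_add_distrib, mul_ite, mul_one, mul_zero,
    Finset.sum_ite_eq, Finset.mem_univ, if_true]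
  simp only [Finset.mul_sum]
  congr 2
  · congr 1
    · refine Finset.sum_congr rfl fun i _ => Finset.sum_congr rfl fun j _ => by ring
    · refine Finset.sum_congr rfl fun i _ => by ring
  · refine Finset.sum_congr rfl fun i _ => by ring

lemma trace_bd {n : ℕ} {a : EE n → Fin n → Fin n → ℝ} {b : EE n → Fin n → ℝ} {c : EE n → ℝ}
    {K lam Lam : ℝ} (hco : CoeffsOK a b c K lam Lam) (x : EE n) :
    0 ≤ ∑ i, a x i i ∧ ∑ i, a x i i ≤ n * Lam := by
  obtain ⟨-, -, -, -, -, -, -, hlam, -, hell⟩ := hco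
  have h : ∀ i, lam ≤ a x i i ∧ a x i i ≤ Lam := by
    intro i
    have := hell x (EuclideanSpace.single i 1)
    simpa [Pi.single_apply] using this
  constructor
  · exact Finset.sum_nonneg fun i _ => hlam.le.trans (h i).1
  · calc ∑ i, a x i i ≤ ∑ _i : Fin n, Lam := Finset.sum_le_sum fun i _ => (h i).2
      _ = n * Lam := by simp

lemma drift_bd {n : ℕ} {a : EE n → Fin n → Fin n → ℝ} {b : EE n → Fin n → ℝ} {c : EE n → ℝ}
    {K lam Lam : ℝ} (hco : CoeffsOK a b c K lam Lam) (x ξ : EE n) :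
    |∑ i, b x i * ξ i| ≤ √K * ‖ξ‖ := by
  obtain ⟨-, -, -, -, hb, -⟩ := hco
  apply abs_le_of_sq_le_sq _ (by positivity)
  have hK : 0 ≤ K := le_trans (Finset.sum_nonneg fun i _ => sq_nonneg _) (hb x)
  rw [mul_pow, Real.sq_sqrt hK, EuclideanSpace.norm_sq_eq]
  simp only [Real.norm_eq_abs, sq_abs]
  exact (Finset.sum_mul_sq_le_sq_mul_sq _ _ _).trans
    (mul_le_mul_of_nonneg_right (hb x) (Finset.sum_nonneg fun i _ => sq_nonneg _))

lemma exists_localMax {n : ℕ} {U C : Set (EE n)} (hU : IsOpen U) (hC : IsCompact C) (hCU : C ⊆ U)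
    {f : EE n → ℝ} (hf : ContinuousOn f U) {x0 : EE n} (hx0 : x0 ∈ U) (hpos : 0 < f x0)
    (hout : ∀ x ∈ U, x ∉ C → f x ≤ 0) : ∃ x1 ∈ U, IsLocalMax f x1 ∧ 0 < f x1 := by
  have h0C : x0 ∈ C := by
    by_contra h
    exact absurd (hout x0 hx0 h) (not_le.2 hpos)
  obtain ⟨x1, hx1, hmax⟩ := hC.exists_isMaxOn ⟨x0, h0C⟩ (hf.mono hCU)
  have h01 : 0 < f x1 := hpos.trans_le (hmax h0C)
  refine ⟨x1, hCU hx1, ?_, h01⟩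
  filter_upwards [hU.mem_nhds (hCU hx1)] with y hy
  by_cases hyC : y ∈ C
  · exact hmax hyC
  · exact (hout y hy hyC).trans h01.le

lemma smooth_normsq {n : ℕ} (y x : EE n) : ContDiffAt ℝ 2 (fun z => ‖z - y‖ ^ 2) x :=
  ((contDiff_id.sub contDiff_const).norm_sq ℝ).contDiffAt

/-- lower barrier -/
lemma lower_barrier {n : ℕ} {a : EE n → Fin n → Fin n → ℝ} {b : EE n → Fin n → ℝ} {c : EE n → ℝ}
    {K lam Lam : ℝ} (hco : CoeffsOK a b c K lam Lam) (x y : EE n) {q R A B : ℝ}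
    (hq : 1 ≤ q) (hA : 0 ≤ A) (hB : 0 ≤ B) (hs : 0 < ‖x - y‖) (hR : ‖x - y‖ ≤ R)
    (hqq : 2 * n * Lam + 2 * √K * R + K * R ^ 2 + 1 ≤ 4 * (q + 1) * lam) :
    A * (‖x - y‖ ^ 2) ^ (-q - 1) ≤ Lop a b c (fun z => A * ((‖z - y‖ ^ 2) ^ (-q) - B)) x := by
  have htr := trace_bd hco x
  have hdr := abs_le.1 (drift_bd hco x (x - y))
  obtain ⟨-, -, -, -, -, hc, hK, hlam, hlL, hell⟩ := hco
  have hell := (hell x (x - y)).1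
  obtain ⟨hc0, hcK⟩ := hc x
  have hs2 : 0 < ‖x - y‖ ^ 2 := by positivity
  have hrad := Lop_radial a b c (ψ := fun s => A * (s ^ (-q) - B))
    (ψ' := fun s => A * ((-q) * s ^ (-q - 1))) (ψ'' := A * ((-q) * ((-q - 1) * (‖x - y‖ ^ 2) ^ (-q - 1 - 1)))) y x
    (by
      filter_upwards [lt_mem_nhds hs2] with s hs
      exact ((Real.hasDerivAt_rpow_const (Or.inl hs.ne')).sub_const B).const_mul A)
    (((Real.hasDerivAt_rpow_const (Or.inl hs2.ne')).const_mul (-q)).const_mul A)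
  simp only at hrad
  rw [hrad]
  generalize ∑ i, ∑ j, a x i j * (x - y) i * (x - y) j = T at *
  generalize ∑ i, b x i * (x - y) i = Q at *
  generalize ∑ i, a x i i = τ at *
  generalize ‖x - y‖ = t at *
  have e1 : (t ^ 2) ^ (-q) = (t ^ 2) ^ (-q - 1) * t ^ 2 := by
    rw [Real.rpow_sub_one hs2.ne']; field_simp
  have e2 : (t ^ 2) ^ (-q - 1 - 1) * t ^ 2 = (t ^ 2) ^ (-q - 1) := by
    rw [Real.rpow_sub_one hs2.ne' (-q - 1)]; field_simp
  have hG2 : 0 < (t ^ 2) ^ (-q - 1 - 1) := by positivity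
  rw [e1, ← e2]
  generalize (t ^ 2) ^ (-q - 1 - 1) = G at *
  have hsK : 0 ≤ √K := Real.sqrt_nonneg K
  have hQ : Q ≤ √K * R := hdr.2.trans (by gcongr)
  have hAG : 0 ≤ A * G := by positivity
  have ht2 : t ^ 2 ≤ R ^ 2 := by gcongr
  have m1 : c x * t ^ 2 ≤ K * R ^ 2 := by gcongr
  have hR0 : 0 ≤ R := hs.le.trans hR
  -- the bracket
  have key : t ^ 2 ≤ 4 * (q * (q + 1)) * T - 2 * q * t ^ 2 * (τ + Q) - c x * t ^ 2 * t ^ 2 := by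
    have k1 : 4 * (q * (q + 1)) * (lam * t ^ 2) ≤ 4 * (q * (q + 1)) * T := by gcongr
    have k2 : 2 * q * t ^ 2 * (τ + Q) ≤ 2 * q * t ^ 2 * (n * Lam + √K * R) := by
      gcongr; exact htr.2
    have k3 : c x * t ^ 2 * t ^ 2 ≤ K * R ^ 2 * t ^ 2 := by gcongr
    have k4 : q * t ^ 2 * (2 * n * Lam + 2 * √K * R + K * R ^ 2 + 1) ≤ q * t ^ 2 * (4 * (q + 1) * lam) := by
      gcongr
    have k5 : t ^ 2 * (K * R ^ 2 + 1) ≤ q * (t ^ 2 * (K * R ^ 2 + 1)) :=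
      le_mul_of_one_le_left (by positivity) hq
    nlinarith
  have key2 := mul_le_mul_of_nonneg_left key hAG
  have hcB : 0 ≤ c x * (A * B) := by positivity
  nlinarith

/-- the lower barrier is a subsolution -/
lemma lower_pow {p q s ρ A B : ℝ} (hp : 1 < p) (hρ : 0 < ρ) (hs : ρ ^ 2 ≤ s) (hB : 0 ≤ B)
    (hBs : B ≤ s ^ (-q)) (hA : A = (ρ ^ 2) ^ (q - 1 / (p - 1))) (hq : 1 / (p - 1) ≤ q) :
    (A * (s ^ (-q) - B)) ^ p ≤ A * s ^ (-q - 1) := by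
  have hp1 : 0 < p - 1 := by linarith
  have hr2 : 0 < ρ ^ 2 := by positivity
  have hs0 : 0 < s := hr2.trans_le hs
  have hA0 : 0 < A := by rw [hA]; positivity
  have h1 : (A * (s ^ (-q) - B)) ^ p ≤ (A * s ^ (-q)) ^ p := by
    apply Real.rpow_le_rpow
    · exact mul_nonneg hA0.le (by linarith)
    · gcongr; linarith
    · linarith
  refine h1.trans ?_
  have hA' : A ≤ s ^ (q - 1 / (p - 1)) := by
    rw [hA]; exact Real.rpow_le_rpow hr2.le hs (by linarith)
  have e : (A * s ^ (-q)) ^ p = (A * s ^ (-q)) * (A * s ^ (-q)) ^ (p - 1) := by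
    rw [Real.rpow_sub_one (by positivity)]; field_simp
  have h2 : (A * s ^ (-q)) ^ (p - 1) ≤ s ^ (-1 : ℝ) := by
    calc (A * s ^ (-q)) ^ (p - 1) ≤ (s ^ (q - 1 / (p - 1)) * s ^ (-q)) ^ (p - 1) := by gcongr
      _ = s ^ (-1 : ℝ) := by
        rw [← Real.rpow_add hs0, ← Real.rpow_mul hs0.le]
        congr 1; field_simp; ring
  rw [e]
  calc A * s ^ (-q) * (A * s ^ (-q)) ^ (p - 1) ≤ A * s ^ (-q) * s ^ (-1 : ℝ) := by gcongr
    _ = A * s ^ (-q - 1) := by rw [mul_assoc, ← Real.rpow_add hs0]; rfl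

/-- upper barrier -/
lemma upper_barrier {n : ℕ} {a : EE n → Fin n → Fin n → ℝ} {b : EE n → Fin n → ℝ} {c : EE n → ℝ}
    {K lam Lam : ℝ} (hco : CoeffsOK a b c K lam Lam) (x y : EE n) {α σ D A : ℝ}
    (hα : 0 < α) (hA : 0 ≤ A) (hs : ‖x - y‖ < σ) (hσ : σ ≤ D) :
    Lop a b c (fun z => A * (σ ^ 2 - ‖z - y‖ ^ 2) ^ (-α)) x ≤
      A * (σ ^ 2 - ‖x - y‖ ^ 2) ^ (-α - 2) *
        ((4 * α * (α + 1) * Lam + 2 * α * n * Lam + 2 * α * √K * D) * σ ^ 2) := by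
  have htr := trace_bd hco x
  have hdr := abs_le.1 (drift_bd hco x (x - y))
  obtain ⟨-, -, -, -, -, hc, hK, hlam, hlL, hell⟩ := hco
  have hell := (hell x (x - y)).2
  obtain ⟨hc0, hcK⟩ := hc x
  have ht0 : 0 ≤ ‖x - y‖ := norm_nonneg _
  have hs2 : ‖x - y‖ ^ 2 < σ ^ 2 := by gcongr
  have hder : ∀ s, s < σ ^ 2 → ∀ r : ℝ, HasDerivAt (fun s => (σ ^ 2 - s) ^ r) (-(r * (σ ^ 2 - s) ^ (r - 1))) s := by
    intro s hs r
    have := ((hasDerivAt_id s).const_sub (σ ^ 2)).rpow_const (p := r) (Or.inl (by simp; linarith))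
    simpa [mul_comm, mul_left_comm] using this
  have hrad := Lop_radial a b c (ψ := fun s => A * (σ ^ 2 - s) ^ (-α))
    (ψ' := fun s => A * (α * (σ ^ 2 - s) ^ (-α - 1)))
    (ψ'' := A * (α * ((α + 1) * (σ ^ 2 - ‖x - y‖ ^ 2) ^ (-α - 2)))) y x
    (by
      filter_upwards [gt_mem_nhds hs2] with s hs
      exact ((hder s hs (-α)).const_mul A).congr_deriv (by ring))
    (by
      refine (((hder _ hs2 (-α - 1)).const_mul α).const_mul A).congr_deriv ?_
      rw [show -α - 1 - 1 = -α - 2 by ring]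
      ring)
  simp only at hrad
  rw [hrad]
  generalize ∑ i, ∑ j, a x i j * (x - y) i * (x - y) j = T at *
  generalize ∑ i, b x i * (x - y) i = Q at *
  generalize ∑ i, a x i i = τ at *
  generalize ‖x - y‖ = t at *
  have hg : 0 < σ ^ 2 - t ^ 2 := by linarith
  have e1 : (σ ^ 2 - t ^ 2) ^ (-α - 1) = (σ ^ 2 - t ^ 2) ^ (-α - 2) * (σ ^ 2 - t ^ 2) := by
    rw [show -α - 2 = -α - 1 - 1 by ring, Real.rpow_sub_one hg.ne' (-α - 1)]; field_simp
  have hG2 : 0 < (σ ^ 2 - t ^ 2) ^ (-α - 2) := by positivity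
  have hlast : 0 ≤ c x * (A * (σ ^ 2 - t ^ 2) ^ (-α)) := by positivity
  rw [e1]
  generalize (σ ^ 2 - t ^ 2) ^ (-α - 2) = G at *
  have hL : 0 < Lam := hlam.trans_le hlL
  have hsK : 0 ≤ √K := Real.sqrt_nonneg K
  have hQ : Q ≤ √K * D := hdr.2.trans (by gcongr; linarith)
  have hD : 0 ≤ D := by linarith
  have k1 : 4 * α * (α + 1) * T ≤ 4 * α * (α + 1) * (Lam * σ ^ 2) := by
    gcongr; exact hell.trans (by gcongr)
  have k2 : 2 * α * ((σ ^ 2 - t ^ 2) * (τ + Q)) ≤ 2 * α * (σ ^ 2 * (n * Lam + √K * D)) := by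
    gcongr 2 * α * ?_
    calc (σ ^ 2 - t ^ 2) * (τ + Q) ≤ (σ ^ 2 - t ^ 2) * (n * Lam + √K * D) := by
          gcongr; exact htr.2
      _ ≤ σ ^ 2 * (n * Lam + √K * D) := by
          gcongr; nlinarith
  have := mul_le_mul_of_nonneg_left (add_le_add k1 k2) (show 0 ≤ A * G by positivity)
  nlinarith

/-- the upper barrier is a supersolution -/
lemma upper_pow {p A S C g : ℝ} (hp : 1 < p) (hS : 0 < S) (hC : 0 < C) (hg : 0 < g)
    (hA : A = (C * S) ^ (1 / (p - 1))) :
    (A * g ^ (-(2 / (p - 1)))) ^ p = A * g ^ (-(2 / (p - 1)) - 2) * (C * S) := by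
  have hp1 : 0 < p - 1 := by linarith
  have hA0 : 0 < A := by rw [hA]; positivity
  have hAp : A ^ p = A * (C * S) := by
    have : A ^ (p - 1) = C * S := by
      rw [hA, ← Real.rpow_mul (by positivity), one_div, inv_mul_cancel₀ hp1.ne', Real.rpow_one]
    rw [← this, Real.rpow_sub_one hA0.ne']; field_simp
  rw [Real.mul_rpow hA0.le (by positivity), hAp, ← Real.rpow_mul hg.le,
    show -(2 / (p - 1)) * p = -(2 / (p - 1)) - 2 by field_simp; ring]
  ring

lemma compl_nonempty {n : ℕ} (hn : 2 ≤ n) {Ω : Set (EE n)} (hΩb : IsBounded Ω) : Ωᶜ.Nonempty := by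
  by_contra h
  rw [not_nonempty_iff_eq_empty, compl_empty_iff] at h
  rw [h] at hΩb
  have : Nonempty (Fin n) := ⟨⟨0, by omega⟩⟩
  have : Nontrivial (EE n) := inferInstance
  exact NormedSpace.unbounded_univ ℝ (EE n) hΩb

lemma bdist_pos {n : ℕ} {Ω : Set (EE n)} (hΩo : IsOpen Ω) (hne : Ωᶜ.Nonempty) {x : EE n}
    (hx : x ∈ Ω) : 0 < infDist x Ωᶜ :=
  (hΩo.isClosed_compl.notMem_iff_infDist_pos hne).1 (by simpa using hx)

lemma exists_nearest {n : ℕ} {Ω : Set (EE n)} (hΩo : IsOpen Ω) (hne : Ωᶜ.Nonempty) {x : EE n}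
    (hx : x ∈ Ω) : ∃ z ∈ frontier Ω, dist x z = infDist x Ωᶜ := by
  obtain ⟨z, hz, hzd⟩ := hΩo.isClosed_compl.exists_infDist_eq_dist hne x
  refine ⟨z, ?_, hzd.symm⟩
  have hd := bdist_pos hΩo hne hx
  rw [frontier, hΩo.interior_eq]
  refine ⟨?_, hz⟩
  have h1 : closure (ball x (infDist x Ωᶜ)) ⊆ closure Ω := closure_mono ball_infDist_compl_subset
  rw [closure_ball x hd.ne'] at h1
  apply h1
  rw [mem_closedBall, dist_comm, hzd]

lemma compact_core {n : ℕ} {Ω : Set (EE n)} (hΩb : IsBounded Ω) {δ : ℝ} (hδ : 0 < δ) :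
    IsCompact {x | δ ≤ infDist x Ωᶜ} ∧ {x | δ ≤ infDist x Ωᶜ} ⊆ Ω := by
  have hsub : {x | δ ≤ infDist x Ωᶜ} ⊆ Ω := by
    intro x hx
    by_contra h
    have : infDist x Ωᶜ = 0 := infDist_zero_of_mem h
    simp only [mem_ofPred_eq, this] at hx
    linarith
  refine ⟨isCompact_of_isClosed_isBounded ?_ (hΩb.subset hsub), hsub⟩
  exact isClosed_le continuous_const (continuous_infDist_pt _)

set_option maxHeartbeats 2000000 in
lemma lower_bound {n : ℕ} (hn : 2 ≤ n) {Ω : Set (EE n)}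
    (hΩo : IsOpen Ω) (hΩc : Ω.Nonempty) (hΩb : IsBounded Ω)
    {a : EE n → Fin n → Fin n → ℝ} {b : EE n → Fin n → ℝ} {c : EE n → ℝ}
    {K lam Lam : ℝ} (hco : CoeffsOK a b c K lam Lam)
    {δ₁ r₁ : ℝ} (hδ₁ : δ₁ ∈ Ioo (0 : ℝ) 1) (hr₁ : 0 < r₁)
    (hball : ∀ x ∈ frontier Ω, ∀ r : ℝ, 0 < r → r < r₁ →
      ∃ y, ball y (δ₁ * r) ⊆ ball x r \ closure Ω)
    {p : ℝ} (hp : 1 < p) {v : EE n → ℝ} (hv : ContDiffOn ℝ 2 v Ω)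
    (heqv : ∀ x ∈ Ω, Lop a b c v x = (max (v x) 0) ^ p) (hbv : BlowsUp Ω v) :
    ∃ c0 > 0, ∀ x ∈ Ω, c0 * (infDist x Ωᶜ ^ 2) ^ (-(1 / (p - 1))) ≤ v x := by
  have hne := compl_nonempty hn hΩb
  have hco' := hco
  obtain ⟨-, -, -, -, -, hcc, hK, hlam, hlL, -⟩ := hco'
  have hp1 : 0 < p - 1 := by linarith
  obtain ⟨hδ0, hδ1⟩ := hδ₁
  set β := 1 / (p - 1) with hβ
  have hβ0 : 0 < β := by positivity
  set D := diam Ω with hD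
  have hdiam : ∀ x ∈ closure Ω, ∀ z ∈ closure Ω, dist x z ≤ D := by
    intro x hx z hz
    rw [hD, ← diam_closure]
    exact dist_le_diam_of_mem hΩb.closure hx hz
  have hdD : ∀ x ∈ Ω, infDist x Ωᶜ ≤ D := by
    intro x hx
    obtain ⟨z, hz, hzd⟩ := exists_nearest hΩo hne hx
    rw [← hzd]
    exact hdiam x (subset_closure hx) z hz.1
  have hD0 : 0 < D := by
    obtain ⟨x, hx⟩ := hΩc
    exact (bdist_pos hΩo hne hx).trans_le (hdD x hx)
  obtain ⟨q, hq1, hqβ, hqq⟩ : ∃ q : ℝ, 1 ≤ q ∧ β ≤ q ∧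
      2 * n * Lam + 2 * √K * (2 * D) + K * (2 * D) ^ 2 + 1 ≤ 4 * (q + 1) * lam := by
    set X := 2 * n * Lam + 2 * √K * (2 * D) + K * (2 * D) ^ 2 + 1
    refine ⟨max 1 (max β (X / (4 * lam))), le_max_left _ _,
      (le_max_left _ _).trans (le_max_right _ _), ?_⟩
    have : X / (4 * lam) ≤ max 1 (max β (X / (4 * lam))) :=
      (le_max_right _ _).trans (le_max_right _ _)
    rw [div_le_iff₀ (by positivity)] at this
    linarith
  set κ := min 1 (r₁ / (2 * D)) with hκ
  have hκ0 : 0 < κ := lt_min one_pos (by positivity)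
  have hκ1 : κ ≤ 1 := min_le_left _ _
  refine ⟨((δ₁ * κ) ^ 2) ^ (q - β) * (4 : ℝ) ^ (-q) / 2, by positivity, ?_⟩
  intro x0 hx0
  have hd := bdist_pos hΩo hne hx0
  have hdle := hdD x0 hx0
  obtain ⟨z, hz, hzd⟩ := exists_nearest hΩo hne hx0
  set d := infDist x0 Ωᶜ with hddef
  have hr0 : 0 < κ * d := by positivity
  have hrd : κ * d ≤ d := by nlinarith
  have hr1 : κ * d < r₁ := by
    have h1 : κ * d ≤ r₁ / (2 * D) * D :=
      mul_le_mul (min_le_right _ _) hdle hd.le (by positivity)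
    have h2 : r₁ / (2 * D) * D = r₁ / 2 := by field_simp
    linarith
  obtain ⟨y, hy⟩ := hball z hz (κ * d) hr0 hr1
  set ρ := δ₁ * (κ * d) with hρ
  have hρ0 : 0 < ρ := by positivity
  have hyz : dist y z < κ * d := (hy (mem_ball_self hρ0)).1
  have hlow : ∀ x ∈ Ω, ρ ≤ ‖x - y‖ := by
    intro x hx
    by_contra! h
    rw [← dist_eq_norm] at h
    exact (hy (mem_ball.2 h)).2 (subset_closure hx)
  have hup : ∀ x ∈ Ω, ‖x - y‖ ≤ 2 * D := by
    intro x hx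
    rw [← dist_eq_norm]
    have h1 := dist_triangle x z y
    have h2 := hdiam x (subset_closure hx) z hz.1
    rw [dist_comm z y] at h1
    linarith
  have hx0y : ‖x0 - y‖ ≤ 2 * d := by
    rw [← dist_eq_norm]
    have h1 := dist_triangle x0 z y
    rw [dist_comm z y] at h1
    linarith
  set A := (ρ ^ 2) ^ (q - β) with hA
  have hA0 : 0 < A := by positivity
  set B := (16 * D ^ 2) ^ (-q) with hB
  have hB0 : 0 < B := by positivity
  set w : EE n → ℝ := fun x => A * ((‖x - y‖ ^ 2) ^ (-q) - B) with hw
  have hs0 : ∀ x ∈ Ω, 0 < ‖x - y‖ := fun x hx => hρ0.trans_le (hlow x hx)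
  have hBs : ∀ x ∈ Ω, B < (‖x - y‖ ^ 2) ^ (-q) := by
    intro x hx
    have := hs0 x hx
    apply Real.rpow_lt_rpow_of_neg (by positivity) _ (by linarith)
    have := hup x hx
    nlinarith
  have hwpos : ∀ x ∈ Ω, 0 < w x := fun x hx => mul_pos hA0 (sub_pos.2 (hBs x hx))
  have hwC : ∀ x ∈ Ω, ContDiffAt ℝ 2 w x := by
    intro x hx
    have := hs0 x hx
    exact contDiffAt_const.mul (((smooth_normsq y x).rpow_const_of_ne
      (by positivity)).sub contDiffAt_const)
  have hvC : ∀ x ∈ Ω, ContDiffAt ℝ 2 v x := fun x hx => hv.contDiffAt (hΩo.mem_nhds hx)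
  have hwv : ∀ x ∈ Ω, w x ≤ v x := by
    by_contra! hcon
    obtain ⟨x2, hx2, hlt⟩ := hcon
    obtain ⟨δ, hδ, hbl⟩ := hbv (A * (ρ ^ 2) ^ (-q))
    obtain ⟨hcomp, hcsub⟩ := compact_core hΩb hδ
    obtain ⟨x1, hx1, hmax, hpos⟩ := exists_localMax (f := fun x => w x - 1 * v x) hΩo hcomp hcsub
      (fun x hx => ((hwC x hx).sub (contDiffAt_const.mul (hvC x hx))).continuousAt.continuousWithinAt)
      hx2 (by linarith) (by
        intro x hx hxn
        simp only [mem_ofPred_eq, not_le] at hxn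
        obtain ⟨z', hz', hzd'⟩ := exists_nearest hΩo hne hx
        have h1 := hbl x hx (((infDist_le_dist_of_mem hz').trans hzd'.le).trans_lt hxn)
        have h2 : (‖x - y‖ ^ 2) ^ (-q) ≤ (ρ ^ 2) ^ (-q) := by
          apply Real.rpow_le_rpow_of_nonpos (by positivity) _ (by linarith)
          have := hlow x hx
          gcongr
        have h3 : w x ≤ A * (ρ ^ 2) ^ (-q) := by
          simp only [hw]
          gcongr
          linarith
        linarith)
    have hL := Lop_localMax hco ((hwC x1 hx1).sub (contDiffAt_const.mul (hvC x1 hx1))) hmax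
    rw [Lop_lin a b c 1 (hwC x1 hx1) (hvC x1 hx1), heqv x1 hx1] at hL
    have h1 := lower_barrier hco x1 y hq1 hA0.le hB0.le (hs0 x1 hx1) (hup x1 hx1) hqq
    have h2 := lower_pow (s := ‖x1 - y‖ ^ 2) hp hρ0 (by have := hlow x1 hx1; gcongr) hB0.le
      (hBs x1 hx1).le hA hqβ
    have h3 : (max (v x1) 0) ^ p < (w x1) ^ p := by
      apply Real.rpow_lt_rpow (le_max_right _ _) _ (by linarith)
      exact max_lt (by linarith) (hwpos x1 hx1)
    have h4 : 0 ≤ c x1 * (w x1 - 1 * v x1) := mul_nonneg (hcc x1).1 hpos.le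
    simp only [hw] at h3 hL h4
    linarith
  refine le_trans ?_ (hwv x0 hx0)
  have e1 : (4 * d ^ 2) ^ (-q) ≤ (‖x0 - y‖ ^ 2) ^ (-q) := by
    have := hs0 x0 hx0
    apply Real.rpow_le_rpow_of_nonpos (by positivity) _ (by linarith)
    nlinarith
  have e2 : B ≤ (4 * d ^ 2) ^ (-q) / 2 := by
    have h1 : B ≤ (4 * (4 * d ^ 2)) ^ (-q) := by
      apply Real.rpow_le_rpow_of_nonpos (by positivity) _ (by linarith)
      nlinarith
    rw [Real.mul_rpow (by norm_num) (by positivity)] at h1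
    have h2 : (4 : ℝ) ^ (-q) ≤ (4 : ℝ) ^ (-1 : ℝ) :=
      Real.rpow_le_rpow_of_exponent_le (by norm_num) (by linarith)
    have h3 : (4 : ℝ) ^ (-1 : ℝ) = 1 / 4 := by rw [Real.rpow_neg_one]; norm_num
    have h4 : 0 < (4 * d ^ 2) ^ (-q) := by positivity
    rw [h3] at h2
    have h5 := mul_le_mul_of_nonneg_right h2 h4.le
    linarith
  have e3 : ((δ₁ * κ) ^ 2) ^ (q - β) * (4 : ℝ) ^ (-q) / 2 * (d ^ 2) ^ (-β) =
      A * ((4 * d ^ 2) ^ (-q) / 2) := by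
    have h1 : A = ((δ₁ * κ) ^ 2) ^ (q - β) * (d ^ 2) ^ (q - β) := by
      rw [hA, hρ, ← Real.mul_rpow (by positivity) (by positivity)]
      congr 1; ring
    have h2 : (d ^ 2) ^ (-β) = (d ^ 2) ^ (q - β) * (d ^ 2) ^ (-q) := by
      rw [← Real.rpow_add (by positivity)]; congr 1; ring
    rw [h1, h2, Real.mul_rpow (by norm_num) (by positivity)]
    ring
  rw [e3]
  simp only [hw]
  gcongr
  linarith

set_option maxHeartbeats 2000000 in
lemma upper_bound {n : ℕ} (hn : 2 ≤ n) {Ω : Set (EE n)}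
    (hΩo : IsOpen Ω) (hΩb : IsBounded Ω)
    {a : EE n → Fin n → Fin n → ℝ} {b : EE n → Fin n → ℝ} {c : EE n → ℝ}
    {K lam Lam : ℝ} (hco : CoeffsOK a b c K lam Lam)
    {p : ℝ} (hp : 1 < p) {v : EE n → ℝ} (hv : ContDiffOn ℝ 2 v Ω)
    (heqv : ∀ x ∈ Ω, Lop a b c v x = (max (v x) 0) ^ p) :
    ∃ C0 > 0, ∀ x ∈ Ω, v x ≤ C0 * (infDist x Ωᶜ ^ 2) ^ (-(1 / (p - 1))) := by
  have hne := compl_nonempty hn hΩb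
  have hco' := hco
  obtain ⟨-, -, -, -, -, hcc, hK, hlam, hlL, -⟩ := hco'
  have hL0 : 0 < Lam := hlam.trans_le hlL
  have hp1 : 0 < p - 1 := by linarith
  set D := diam Ω with hD
  have hD0 : 0 ≤ D := diam_nonneg
  have hdD : ∀ x ∈ Ω, infDist x Ωᶜ ≤ D := by
    intro x hx
    obtain ⟨z, hz, hzd⟩ := exists_nearest hΩo hne hx
    rw [← hzd, hD, ← diam_closure]
    exact dist_le_diam_of_mem hΩb.closure (subset_closure hx) hz.1
  set α := 2 / (p - 1) with hα
  have hα0 : 0 < α := by positivity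
  set C := 4 * α * (α + 1) * Lam + 2 * α * n * Lam + 2 * α * √K * D with hC
  have hC0 : 0 < C := by positivity
  refine ⟨C ^ (1 / (p - 1)) * (1 / 4 : ℝ) ^ (-(1 / (p - 1))), by positivity, ?_⟩
  intro x0 hx0
  have hd := bdist_pos hΩo hne hx0
  have hdle := hdD x0 hx0
  have hbsub : ball x0 (infDist x0 Ωᶜ) ⊆ Ω := ball_infDist_compl_subset
  set d := infDist x0 Ωᶜ with hddef
  set σ := d / 2 with hσ
  have hσ0 : 0 < σ := by positivity
  have hcbsub : closedBall x0 σ ⊆ Ω := (closedBall_subset_ball (by linarith)).trans hbsub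
  set A := (C * σ ^ 2) ^ (1 / (p - 1)) with hA
  have hA0 : 0 < A := by positivity
  set w : EE n → ℝ := fun x => A * (σ ^ 2 - ‖x - x0‖ ^ 2) ^ (-α) with hw
  have hlt : ∀ x ∈ ball x0 σ, ‖x - x0‖ < σ := fun x hx => by
    rw [← dist_eq_norm]; exact hx
  have hg : ∀ x ∈ ball x0 σ, 0 < σ ^ 2 - ‖x - x0‖ ^ 2 := fun x hx => by
    have := hlt x hx
    have h0 := norm_nonneg (x - x0)
    nlinarith
  have hwpos : ∀ x ∈ ball x0 σ, 0 < w x := fun x hx => by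
    have := hg x hx
    positivity
  have hwC : ∀ x ∈ ball x0 σ, ContDiffAt ℝ 2 w x := by
    intro x hx
    exact contDiffAt_const.mul ((contDiffAt_const.sub (smooth_normsq x0 x)).rpow_const_of_ne
      (hg x hx).ne')
  have hvC : ∀ x ∈ Ω, ContDiffAt ℝ 2 v x := fun x hx => hv.contDiffAt (hΩo.mem_nhds hx)
  have hbO : ball x0 σ ⊆ Ω := ball_subset_closedBall.trans hcbsub
  have hx00 : x0 ∈ ball x0 σ := mem_ball_self hσ0
  have hvw : v x0 ≤ w x0 := by
    by_contra! hcon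
    obtain ⟨M, hM⟩ := (isCompact_closedBall x0 σ).bddAbove_image (hv.continuousOn.mono hcbsub)
    have hMv : ∀ x ∈ ball x0 σ, v x ≤ M := fun x hx => hM ⟨x, ball_subset_closedBall hx, rfl⟩
    have hM0 : 0 < M := by
      have := hMv x0 hx00
      have := hwpos x0 hx00
      linarith
    set γ := (M / A) ^ (-α⁻¹) with hγ
    have hγ0 : 0 < γ := by positivity
    have hγα : A * γ ^ (-α) = M := by
      rw [hγ, ← Real.rpow_mul (by positivity), neg_mul_neg, inv_mul_cancel₀ hα0.ne', Real.rpow_one]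
      field_simp
    obtain ⟨x1, hx1, hmax, hpos⟩ := exists_localMax (f := fun x => v x - 1 * w x)
      (C := {x | ‖x - x0‖ ^ 2 ≤ σ ^ 2 - γ} ∩ closedBall x0 σ) isOpen_ball
      (((isCompact_closedBall x0 σ).inter_left
        (isClosed_le (by fun_prop) continuous_const)))
      (by
        rintro x ⟨h1, h2⟩
        simp only [mem_ofPred_eq] at h1
        rw [mem_ball, dist_eq_norm]
        have h0 := norm_nonneg (x - x0)
        nlinarith)
      (fun x hx => ((hvC x (hbO hx)).sub
        (contDiffAt_const.mul (hwC x hx))).continuousAt.continuousWithinAt)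
      hx00 (by linarith) (by
        intro x hx hxn
        have h1 : σ ^ 2 - γ < ‖x - x0‖ ^ 2 := by
          by_contra! h
          exact hxn ⟨h, ball_subset_closedBall hx⟩
        have h2 : γ ^ (-α) ≤ (σ ^ 2 - ‖x - x0‖ ^ 2) ^ (-α) :=
          Real.rpow_le_rpow_of_nonpos (hg x hx) (by linarith) (by linarith)
        have h3 : M ≤ w x := by
          rw [← hγα]
          simp only [hw]
          gcongr
        have := hMv x hx
        linarith)
    have hx1O := hbO hx1
    have hL := Lop_localMax hco ((hvC x1 hx1O).sub (contDiffAt_const.mul (hwC x1 hx1))) hmax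
    rw [Lop_lin a b c 1 (hvC x1 hx1O) (hwC x1 hx1), heqv x1 hx1O] at hL
    have h1 := upper_barrier hco x1 x0 hα0 hA0.le (hlt x1 hx1) (show σ ≤ D by linarith)
    have h2 := upper_pow hp (show 0 < σ ^ 2 by positivity) hC0 (hg x1 hx1) hA
    have h3 : (w x1) ^ p < (max (v x1) 0) ^ p := by
      apply Real.rpow_lt_rpow (hwpos x1 hx1).le _ (by linarith)
      exact lt_max_of_lt_left (by linarith)
    have h4 : 0 ≤ c x1 * (v x1 - 1 * w x1) := mul_nonneg (hcc x1).1 hpos.le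
    simp only [hw] at h3 hL h4
    rw [← hα, ← hC] at *
    linarith
  refine hvw.trans (le_of_eq ?_)
  simp only [hw, sub_self, norm_zero]
  have e1 : A = C ^ (1 / (p - 1)) * (σ ^ 2) ^ (1 / (p - 1)) := by
    rw [hA, Real.mul_rpow hC0.le (by positivity)]
  have e2 : (σ ^ 2) ^ (1 / (p - 1)) * (σ ^ 2 - 0 ^ 2) ^ (-α) = (σ ^ 2) ^ (-(1 / (p - 1))) := by
    rw [zero_pow two_ne_zero, sub_zero, ← Real.rpow_add (by positivity)]
    congr 1; rw [hα]; ring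
  rw [e1, mul_assoc, e2, mul_assoc, ← Real.mul_rpow (by norm_num) (by positivity)]
  congr 2; rw [hσ]; ring

lemma quad_barrier {n : ℕ} {a : EE n → Fin n → Fin n → ℝ} {b : EE n → Fin n → ℝ} {c : EE n → ℝ}
    {K lam Lam : ℝ} (hco : CoeffsOK a b c K lam Lam) (x y : EE n) {D : ℝ} (hD : ‖x - y‖ ≤ D) :
    Lop a b c (fun z => ‖z - y‖ ^ 2) x ≤ 2 * n * Lam + 2 * √K * D := by
  have htr := trace_bd hco x
  have hdr := abs_le.1 (drift_bd hco x (x - y))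
  obtain ⟨-, -, -, -, -, hc, hK, hlam, hlL, hell⟩ := hco
  have hrad := Lop_radial a b c (ψ := fun s => s) (ψ' := fun _ => 1) (ψ'' := 0) y x
    (Filter.Eventually.of_forall fun s => hasDerivAt_id s) (hasDerivAt_const _ _)
  simp only at hrad
  rw [hrad]
  have h1 : 0 ≤ c x * ‖x - y‖ ^ 2 := mul_nonneg (hc x).1 (by positivity)
  have h2 : √K * ‖x - y‖ ≤ √K * D := by gcongr
  linarith [htr.2, hdr.2]

set_option maxHeartbeats 2000000 in
lemma one_sided {n : ℕ} (hn : 2 ≤ n) {Ω : Set (EE n)}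
    (hΩo : IsOpen Ω) (hΩb : IsBounded Ω)
    {a : EE n → Fin n → Fin n → ℝ} {b : EE n → Fin n → ℝ} {c : EE n → ℝ}
    {K lam Lam : ℝ} (hco : CoeffsOK a b c K lam Lam)
    {p : ℝ} (hp : 1 < p) {u v : EE n → ℝ}
    (hu : ContDiffOn ℝ 2 u Ω) (hv : ContDiffOn ℝ 2 v Ω)
    (hequ : ∀ x ∈ Ω, Lop a b c u x = (max (u x) 0) ^ p)
    (heqv : ∀ x ∈ Ω, Lop a b c v x = (max (v x) 0) ^ p)
    {c0 Cu Cv : ℝ} (hc0 : 0 < c0) (hCu : 0 < Cu) (hCv : 0 < Cv)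
    (hlv : ∀ x ∈ Ω, c0 * (infDist x Ωᶜ ^ 2) ^ (-(1 / (p - 1))) ≤ v x)
    (huv : ∀ x ∈ Ω, v x ≤ Cv * (infDist x Ωᶜ ^ 2) ^ (-(1 / (p - 1))))
    (huu : ∀ x ∈ Ω, u x ≤ Cu * (infDist x Ωᶜ ^ 2) ^ (-(1 / (p - 1)))) :
    ∀ x ∈ Ω, u x ≤ v x := by
  by_contra! hcon
  obtain ⟨x2, hx2, hlt⟩ := hcon
  have hne := compl_nonempty hn hΩb
  have hco' := hco
  obtain ⟨-, -, -, -, -, hcc, hK, hlam, hlL, -⟩ := hco'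
  have hL0 : 0 < Lam := hlam.trans_le hlL
  have hp1 : 0 < p - 1 := by linarith
  set β := 1 / (p - 1) with hβ
  have hβ0 : 0 < β := by positivity
  have hβp : β * p = β + 1 := by rw [hβ]; field_simp; ring
  set D := diam Ω with hD
  have hD0 : 0 ≤ D := diam_nonneg
  have hdD : ∀ x ∈ Ω, infDist x Ωᶜ ≤ D := by
    intro x hx
    obtain ⟨z, hz, hzd⟩ := exists_nearest hΩo hne hx
    rw [← hzd, hD, ← diam_closure]
    exact dist_le_diam_of_mem hΩb.closure (subset_closure hx) hz.1
  have hdp : ∀ x ∈ Ω, 0 < (infDist x Ωᶜ ^ 2) ^ (-β) := fun x hx => by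
    have := bdist_pos hΩo hne hx
    positivity
  have hvpos : ∀ x ∈ Ω, 0 < v x := fun x hx => (mul_pos hc0 (hdp x hx)).trans_le (hlv x hx)
  have huC : ∀ x ∈ Ω, ContDiffAt ℝ 2 u x := fun x hx => hu.contDiffAt (hΩo.mem_nhds hx)
  have hvC : ∀ x ∈ Ω, ContDiffAt ℝ 2 v x := fun x hx => hv.contDiffAt (hΩo.mem_nhds hx)
  -- supremum of the ratio
  set T := (fun x => u x / v x) '' Ω with hT
  have hTb : BddAbove T := by
    refine ⟨Cu / c0, ?_⟩
    rintro _ ⟨x, hx, rfl⟩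
    simp only
    rw [div_le_div_iff₀ (hvpos x hx) hc0]
    have h1 := huu x hx
    have h2 := hlv x hx
    calc u x * c0 ≤ Cu * (infDist x Ωᶜ ^ 2) ^ (-β) * c0 := by gcongr
      _ = Cu * (c0 * (infDist x Ωᶜ ^ 2) ^ (-β)) := by ring
      _ ≤ Cu * v x := by gcongr
  set S := sSup T with hS
  have hle : ∀ x ∈ Ω, u x ≤ S * v x := fun x hx => by
    rw [← div_le_iff₀ (hvpos x hx)]
    exact le_csSup hTb ⟨x, hx, rfl⟩
  have hS1 : 1 < S := by
    have h1 := hle x2 hx2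
    have h2 := hvpos x2 hx2
    by_contra! h
    nlinarith
  set k0 := (1 + S) / 2 with hk0
  have hk01 : 1 < k0 := by linarith
  set m0 := k0 ^ (p - 1) - 1 with hm0
  have hm00 : 0 < m0 := sub_pos.2 (Real.one_lt_rpow hk01 hp1)
  have hn0 : (0:ℝ) < n := by exact_mod_cast (by omega : 0 < n)
  set C2 := 2 * n * Lam + 2 * √K * D with hC2
  have hC20 : 0 < C2 := by positivity
  set η := m0 * c0 ^ p * (9 : ℝ) ^ (-(β + 1)) / (2 * C2) with hη
  have hη0 : 0 < η := by positivity
  obtain ⟨k, hk0k, hkη, hkS⟩ : ∃ k, k0 ≤ k ∧ S ≤ k + η / Cv ∧ k < S :=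
    ⟨max k0 (S - η / Cv), le_max_left _ _, by linarith [le_max_right k0 (S - η / Cv)],
      max_lt (by linarith) (by linarith [show 0 < η / Cv by positivity])⟩
  have hk1 : 1 < k := hk01.trans_le hk0k
  obtain ⟨_, ⟨x0, hx0, rfl⟩, hx0k⟩ := exists_lt_of_lt_csSup (s := T) ⟨_, ⟨x2, hx2, rfl⟩⟩ hkS
  simp only at hx0k
  rw [lt_div_iff₀ (hvpos x0 hx0)] at hx0k
  have hd := bdist_pos hΩo hne hx0
  have hdle := hdD x0 hx0
  have hbsub : ball x0 (infDist x0 Ωᶜ) ⊆ Ω := ball_infDist_compl_subset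
  have hLip : ∀ x, infDist x Ωᶜ ≤ infDist x0 Ωᶜ + dist x x0 ∧ infDist x0 Ωᶜ ≤ infDist x Ωᶜ + dist x x0 :=
    fun x => ⟨infDist_le_infDist_add_dist, by
      rw [dist_comm]; exact infDist_le_infDist_add_dist⟩
  set r := infDist x0 Ωᶜ / 2 with hr
  have hr0 : 0 < r := by positivity
  have hcbsub : closedBall x0 r ⊆ Ω := (closedBall_subset_ball (by linarith)).trans hbsub
  set ε := η * (r ^ 2) ^ (-(β + 1)) with hε
  have hε0 : 0 < ε := by positivity
  have hφC : ∀ x ∈ Ω, ContDiffAt ℝ 2 (fun x => u x - k * v x) x := fun x hx =>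
    (huC x hx).sub (contDiffAt_const.mul (hvC x hx))
  have hΦC : ∀ x ∈ Ω, ContDiffAt ℝ 2 (fun x => (u x - k * v x) - ε * ‖x - x0‖ ^ 2) x := fun x hx =>
    (hφC x hx).sub (contDiffAt_const.mul (smooth_normsq x0 x))
  obtain ⟨x1, hx1, hmax⟩ := (isCompact_closedBall x0 r).exists_isMaxOn
    ⟨x0, mem_closedBall_self hr0.le⟩
    (f := fun x => (u x - k * v x) - ε * ‖x - x0‖ ^ 2)
    (fun x hx => (hΦC x (hcbsub hx)).continuousAt.continuousWithinAt)
  have hx1O := hcbsub hx1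
  have hpos : 0 < (u x1 - k * v x1) - ε * ‖x1 - x0‖ ^ 2 := by
    have h := hmax (mem_closedBall_self hr0.le)
    simp only [mem_ofPred_eq, sub_self, norm_zero] at h
    linarith
  have hx1r : dist x1 x0 ≤ r := hx1
  have hvx1 := hvpos x1 hx1O
  rcases lt_or_eq_of_le hx1r with hin | hbd
  · -- interior maximum is impossible
    have hloc : IsLocalMax (fun x => (u x - k * v x) - ε * ‖x - x0‖ ^ 2) x1 :=
      hmax.isLocalMax (Filter.mem_of_superset (isOpen_ball.mem_nhds (mem_ball.2 hin))
        ball_subset_closedBall)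
    have hL := Lop_localMax hco (hΦC x1 hx1O) hloc
    rw [Lop_lin a b c ε (hφC x1 hx1O) (smooth_normsq x0 x1),
      Lop_lin a b c k (huC x1 hx1O) (hvC x1 hx1O), hequ x1 hx1O, heqv x1 hx1O,
      max_eq_left hvx1.le] at hL
    have h4 := mul_nonneg (hcc x1).1 hpos.le
    have h5 : ε * Lop a b c (fun z => ‖z - x0‖ ^ 2) x1 ≤ ε * C2 := by
      gcongr
      apply quad_barrier hco
      rw [← dist_eq_norm]; linarith
    have hεn : 0 ≤ ε * ‖x1 - x0‖ ^ 2 := by positivity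
    have h6 : (k * v x1) ^ p ≤ (max (u x1) 0) ^ p := by
      apply Real.rpow_le_rpow (by positivity) _ (by linarith)
      exact le_max_of_le_left (by linarith)
    have h7 : (k * v x1) ^ p = k * k ^ (p - 1) * (v x1) ^ p := by
      rw [Real.mul_rpow (by linarith) hvx1.le, Real.rpow_sub_one (by linarith)]
      field_simp
    have h8 : m0 ≤ k ^ (p - 1) - 1 := by
      rw [hm0]; gcongr
    have hvp : 0 < (v x1) ^ p := by positivity
    have h9 : m0 * (v x1) ^ p ≤ k * k ^ (p - 1) * (v x1) ^ p - k * (v x1) ^ p := by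
      have : m0 ≤ k * (k ^ (p - 1) - 1) := by nlinarith
      have := mul_le_mul_of_nonneg_right this hvp.le
      linarith
    have h10 : c0 ^ p * ((9 : ℝ) ^ (-(β + 1)) * (r ^ 2) ^ (-(β + 1))) ≤ (v x1) ^ p := by
      have hd1 := bdist_pos hΩo hne hx1O
      have g1 : (9 * r ^ 2) ^ (-β) ≤ (infDist x1 Ωᶜ ^ 2) ^ (-β) := by
        apply Real.rpow_le_rpow_of_nonpos (by positivity) _ (by linarith)
        have := (hLip x1).1
        have : infDist x1 Ωᶜ ≤ 3 * r := by linarith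
        nlinarith
      have g2 : c0 * (9 * r ^ 2) ^ (-β) ≤ v x1 := le_trans (by gcongr) (hlv x1 hx1O)
      have g3 := Real.rpow_le_rpow (by positivity) g2 (by linarith : 0 ≤ p)
      rw [Real.mul_rpow hc0.le (by positivity), ← Real.rpow_mul (by positivity),
        show -β * p = -(β + 1) by linarith, Real.mul_rpow (by norm_num) (by positivity)] at g3
      exact g3
    have h11 : 2 * (ε * C2) ≤ m0 * (v x1) ^ p := by
      have : 2 * (ε * C2) = m0 * (c0 ^ p * ((9 : ℝ) ^ (-(β + 1)) * (r ^ 2) ^ (-(β + 1)))) := by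
        rw [hε, hη]; field_simp
      rw [this]; gcongr
    have h12 : 0 < ε * C2 := by positivity
    linarith
  · -- boundary maximum gives a larger ratio
    rw [dist_eq_norm] at hbd
    rw [hbd] at hpos
    have g0 : ε * r ^ 2 = η * (r ^ 2) ^ (-β) := by
      rw [hε, neg_add, ← sub_eq_add_neg, Real.rpow_sub_one (by positivity)]
      field_simp
    have g1 : (infDist x1 Ωᶜ ^ 2) ^ (-β) ≤ (r ^ 2) ^ (-β) := by
      apply Real.rpow_le_rpow_of_nonpos (by positivity) _ (by linarith)
      have := (hLip x1).2
      have : r ≤ infDist x1 Ωᶜ := by linarith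
      gcongr
    have g2 : v x1 ≤ Cv * (r ^ 2) ^ (-β) := (huv x1 hx1O).trans (by gcongr)
    have g3 : η / Cv * v x1 ≤ η * (r ^ 2) ^ (-β) := by
      calc η / Cv * v x1 ≤ η / Cv * (Cv * (r ^ 2) ^ (-β)) := by gcongr
        _ = η * (r ^ 2) ^ (-β) := by field_simp
    have g4 := hle x1 hx1O
    have g5 : S * v x1 ≤ (k + η / Cv) * v x1 := by gcongr
    linarith

/-- Theorem 3.1 of the paper. If `Ω` is a bounded domain satisfying
the uniform exterior ball condition, then the boundary blow-up problem
`Lu = u₊^p`, `u → +∞` at `∂Ω`, with `p > 1`, has at most one `C²(Ω)` solution. -/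
theorem uniqueness_exterior_ball {n : ℕ} (hn : 2 ≤ n)
    (Ω : Set (EuclideanSpace ℝ (Fin n)))
    (hΩo : IsOpen Ω) (hΩc : IsConnected Ω) (hΩb : IsBounded Ω)
    (a : EuclideanSpace ℝ (Fin n) → Fin n → Fin n → ℝ)
    (b : EuclideanSpace ℝ (Fin n) → Fin n → ℝ)
    (c : EuclideanSpace ℝ (Fin n) → ℝ)
    (K lam Lam : ℝ) (hco : CoeffsOK a b c K lam Lam)
    (δ₁ r₁ : ℝ) (hδ₁ : δ₁ ∈ Ioo (0 : ℝ) 1) (hr₁ : 0 < r₁)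
    (hball : ∀ x ∈ frontier Ω, ∀ r : ℝ, 0 < r → r < r₁ →
      ∃ y, ball y (δ₁ * r) ⊆ ball x r \ closure Ω)
    (p : ℝ) (hp : 1 < p)
    (u v : EuclideanSpace ℝ (Fin n) → ℝ)
    (hu : ContDiffOn ℝ 2 u Ω) (hv : ContDiffOn ℝ 2 v Ω)
    (hequ : ∀ x ∈ Ω, Lop a b c u x = (max (u x) 0) ^ p)
    (heqv : ∀ x ∈ Ω, Lop a b c v x = (max (v x) 0) ^ p)
    (hbu : BlowsUp Ω u) (hbv : BlowsUp Ω v) :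
    EqOn u v Ω := by
  obtain ⟨cu, hcu, hlu⟩ := lower_bound hn hΩo hΩc.nonempty hΩb hco hδ₁ hr₁ hball hp hu hequ hbu
  obtain ⟨cv, hcv, hlv⟩ := lower_bound hn hΩo hΩc.nonempty hΩb hco hδ₁ hr₁ hball hp hv heqv hbv
  obtain ⟨Cu, hCu, hUu⟩ := upper_bound hn hΩo hΩb hco hp hu hequ
  obtain ⟨Cv, hCv, hUv⟩ := upper_bound hn hΩo hΩb hco hp hv heqv
  intro x hx
  exact le_antisymm
    (one_sided hn hΩo hΩb hco hp hu hv hequ heqv hcv hCu hCv hlv hUv hUu x hx)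
    (one_sided hn hΩo hΩb hco hp hv hu heqv hequ hcu hCv hCu hlu hUu hUv x hx)
end

section
/- Uniqueness for the exponential nonlinearity on convex domains: Let a > 0 and f(t) = e^{a t}. Assume Ω ⊂ ℝⁿ (n ≥ 2) is a bounded convex domain. Then there exists at most one function u ∈ C²(Ω) satisfying Lu(x) = e^{a u(x)} for all x ∈ Ω and u(x) → +∞ as d(x) → 0. -/
open Metric Set Filter Real Bornology

theorem pd2_eq_aux {n : ℕ} {u : EuclideanSpace ℝ (Fin n) → ℝ} {x : EuclideanSpace ℝ (Fin n)}
    (hu : ContDiffAt ℝ 2 u x) (i j : Fin n) :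
    pd2 u i j x = fderiv ℝ (fderiv ℝ u) x (EuclideanSpace.single i 1)
      (EuclideanSpace.single j 1) := by
  have h : DifferentiableAt ℝ (fderiv ℝ u) x :=
    (hu.fderiv_right (m := 1) (by norm_num)).differentiableAt (by norm_num)
  unfold pd2
  rw [fderiv_clm_apply h (by fun_prop)]
  simp

theorem ev_diff_aux {n : ℕ} {u : EuclideanSpace ℝ (Fin n) → ℝ} {x : EuclideanSpace ℝ (Fin n)}
    (hu : ContDiffAt ℝ 2 u x) : ∀ᶠ y in nhds x, DifferentiableAt ℝ u y := by
  filter_upwards [hu.eventually (by simp)] with y hy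
  exact hy.differentiableAt (by norm_num)

theorem pd2_sub_aux {n : ℕ} {u v : EuclideanSpace ℝ (Fin n) → ℝ} {x : EuclideanSpace ℝ (Fin n)}
    (hu : ContDiffAt ℝ 2 u x) (hv : ContDiffAt ℝ 2 v x) (i j : Fin n) :
    pd2 (fun y => u y - v y) i j x = pd2 u i j x - pd2 v i j x := by
  have h1 : DifferentiableAt ℝ (fderiv ℝ u) x :=
    (hu.fderiv_right (m := 1) (by norm_num)).differentiableAt (by norm_num)
  have h2 : DifferentiableAt ℝ (fderiv ℝ v) x :=
    (hv.fderiv_right (m := 1) (by norm_num)).differentiableAt (by norm_num)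
  rw [pd2_eq_aux (hu.sub hv), pd2_eq_aux hu, pd2_eq_aux hv]
  have : fderiv ℝ (fun y => u y - v y) =ᶠ[nhds x] fun y => fderiv ℝ u y - fderiv ℝ v y := by
    filter_upwards [ev_diff_aux hu, ev_diff_aux hv] with y h1 h2
    exact fderiv_fun_sub h1 h2
  rw [this.fderiv_eq, fderiv_fun_sub h1 h2]
  simp

theorem pd_sub_aux {n : ℕ} {u v : EuclideanSpace ℝ (Fin n) → ℝ} {x : EuclideanSpace ℝ (Fin n)}
    (hu : ContDiffAt ℝ 2 u x) (hv : ContDiffAt ℝ 2 v x) (i : Fin n) :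
    pd (fun y => u y - v y) i x = pd u i x - pd v i x := by
  unfold pd
  rw [fderiv_fun_sub (hu.differentiableAt (by norm_num)) (hv.differentiableAt (by norm_num))]
  simp

/-- Second derivative is nonpositive at a local max. -/
theorem hess_nonpos_aux {n : ℕ} {g : EuclideanSpace ℝ (Fin n) → ℝ}
    {p : EuclideanSpace ℝ (Fin n)} (hg : ContDiffAt ℝ 2 g p) (hm : IsLocalMax g p)
    (ξ : EuclideanSpace ℝ (Fin n)) : fderiv ℝ (fderiv ℝ g) p ξ ξ ≤ 0 := by
  by_contra! hpos
  have hd2 : DifferentiableAt ℝ (fderiv ℝ g) p :=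
    (hg.fderiv_right (m := 1) (by norm_num)).differentiableAt (by norm_num)
  set γ : ℝ → EuclideanSpace ℝ (Fin n) := fun t => p + t • ξ with hγ
  have hγd : ∀ t, HasDerivAt γ ξ t := fun t => by
    have := ((hasDerivAt_id t).smul_const ξ).const_add p
    rw [one_smul] at this
    exact this
  have hγ0 : γ 0 = p := by simp [hγ]
  have hγc : Tendsto γ (nhds 0) (nhds p) := by
    have := (hγd 0).continuousAt.tendsto
    rwa [hγ0] at this
  set φ : ℝ → ℝ := fun t => g (γ t) with hφ
  have hφd : ∀ᶠ t in nhds (0 : ℝ), HasDerivAt φ (fderiv ℝ g (γ t) ξ) t := by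
    filter_upwards [hγc.eventually (ev_diff_aux hg)] with t ht
    exact ht.hasFDerivAt.comp_hasDerivAt t (hγd t)
  have hdφ : deriv φ =ᶠ[nhds 0] fun t => fderiv ℝ g (γ t) ξ := by
    filter_upwards [hφd] with t ht using ht.deriv
  have h2 : HasDerivAt (fun t => fderiv ℝ g (γ t) ξ) (fderiv ℝ (fderiv ℝ g) p ξ ξ) 0 := by
    have h3 : HasFDerivAt (fderiv ℝ g) (fderiv ℝ (fderiv ℝ g) p) (γ 0) := by
      rw [hγ0]; exact hd2.hasFDerivAt
    have h4 := h3.comp_hasDerivAt (0:ℝ) (hγd 0)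
    simpa using h4.clm_apply (hasDerivAt_const (0:ℝ) ξ)
  have hdd : deriv (deriv φ) 0 = fderiv ℝ (fderiv ℝ g) p ξ ξ := by
    rw [hdφ.deriv_eq, h2.deriv]
  have hmax : IsLocalMax φ 0 := by
    have : ∀ᶠ t in nhds (0:ℝ), g (γ t) ≤ g p := hγc.eventually hm
    filter_upwards [this] with t ht
    simpa [hφ, hγ0] using ht
  have hmin : IsLocalMin φ 0 := by
    apply isLocalMin_of_deriv_deriv_pos (by rw [hdd]; exact hpos) hmax.deriv_eq_zero
    exact hφd.self_of_nhds.continuousAt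
  have hc : φ =ᶠ[nhds 0] fun _ => φ 0 := by
    filter_upwards [hmax, hmin] with t h1 h2 using le_antisymm h1 h2
  have : deriv (deriv φ) 0 = 0 := by
    rw [hc.deriv.deriv_eq]
    simp
  rw [hdd] at this
  linarith

open scoped MatrixOrder in
theorem trace_nonpos_aux {n : ℕ} (A : Fin n → Fin n → ℝ) (hs : ∀ i j, A i j = A j i)
    (hA : ∀ ξ : EuclideanSpace ℝ (Fin n), 0 ≤ ∑ i, ∑ j, A i j * ξ i * ξ j)
    (H : EuclideanSpace ℝ (Fin n) →L[ℝ] EuclideanSpace ℝ (Fin n) →L[ℝ] ℝ)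
    (hH : ∀ ξ, H ξ ξ ≤ 0) :
    ∑ i, ∑ j, A i j * H (EuclideanSpace.single i 1) (EuclideanSpace.single j 1) ≤ 0 := by
  have hP : (Matrix.of A).PosSemidef := by
    refine Matrix.PosSemidef.of_dotProduct_mulVec_nonneg ?_ ?_
    · ext i j; simp [hs i j]
    · intro x
      have := hA (WithLp.toLp 2 x)
      simp only [dotProduct, Matrix.mulVec, Finset.mul_sum]
      refine this.trans_eq (Finset.sum_congr rfl fun i _ => Finset.sum_congr rfl fun j _ => ?_)
      simp only [Pi.star_apply, star_trivial, Matrix.of_apply]; ring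
  obtain ⟨B, hB⟩ := CStarAlgebra.nonneg_iff_eq_star_mul_self.mp hP.nonneg
  have hAij : ∀ i j, A i j = ∑ k, B k i * B k j := fun i j => by
    have := congrFun (congrFun hB i) j
    simpa [Matrix.mul_apply, Matrix.star_apply] using this
  have key : ∑ i, ∑ j, A i j * H (EuclideanSpace.single i 1) (EuclideanSpace.single j 1)
      = ∑ k, H (∑ i, B k i • EuclideanSpace.single i 1) (∑ i, B k i • EuclideanSpace.single i 1) := by
    simp only [map_sum, map_smul, _root_.sum_apply, _root_.smul_apply,
      smul_eq_mul, hAij, Finset.sum_mul, Finset.mul_sum]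
    rw [Finset.sum_comm]
    rw [Finset.sum_congr rfl fun j _ => Finset.sum_comm]
    rw [Finset.sum_comm]
    refine Finset.sum_congr rfl fun k _ => Finset.sum_congr rfl fun i _ =>
      Finset.sum_congr rfl fun j _ => ?_
    ring
  rw [key]
  exact Finset.sum_nonpos fun k _ => hH _

theorem mp_aux {n : ℕ} {a : EuclideanSpace ℝ (Fin n) → Fin n → Fin n → ℝ}
    {b : EuclideanSpace ℝ (Fin n) → Fin n → ℝ} {c : EuclideanSpace ℝ (Fin n) → ℝ}
    {K lam Lam : ℝ} (hco : CoeffsOK a b c K lam Lam)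
    {u v : EuclideanSpace ℝ (Fin n) → ℝ} {p : EuclideanSpace ℝ (Fin n)}
    (hu : ContDiffAt ℝ 2 u p) (hv : ContDiffAt ℝ 2 v p)
    (hm : IsLocalMax (fun x => u x - v x) p) (hp : v p ≤ u p) :
    Lop a b c u p ≤ Lop a b c v p := by
  obtain ⟨-, -, -, hs, -, hc, -, hl, -, hell⟩ := hco
  have hg : ContDiffAt ℝ 2 (fun x => u x - v x) p := hu.sub hv
  have h1 := trace_nonpos_aux (a p) (hs p)
    (fun ξ => le_trans (by positivity) (hell p ξ).1) _ (hess_nonpos_aux hg hm)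
  have h0 : ∀ i, pd u i p = pd v i p := fun i => by
    have := pd_sub_aux hu hv i
    rw [pd, hm.fderiv_eq_zero] at this
    simp at this
    linarith
  simp only [← pd2_eq_aux hg, pd2_sub_aux hu hv, mul_sub, Finset.sum_sub_distrib] at h1
  unfold Lop
  simp only [h0]
  have := mul_le_mul_of_nonneg_left hp (hc p).1
  linarith

theorem lop_affine_aux {n : ℕ} (a : EuclideanSpace ℝ (Fin n) → Fin n → Fin n → ℝ)
    (b : EuclideanSpace ℝ (Fin n) → Fin n → ℝ) (c : EuclideanSpace ℝ (Fin n) → ℝ)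
    {v : EuclideanSpace ℝ (Fin n) → ℝ} {p : EuclideanSpace ℝ (Fin n)}
    (hv : ContDiffAt ℝ 2 v p) (k m : ℝ) :
    Lop a b c (fun x => k * v x + m) p = k * Lop a b c v p - c p * m := by
  have hd : DifferentiableAt ℝ (fderiv ℝ v) p :=
    (hv.fderiv_right (m := 1) (by norm_num)).differentiableAt (by norm_num)
  have hkv : ContDiffAt ℝ 2 (fun x => k * v x + m) p := (contDiffAt_const.mul hv).add contDiffAt_const
  have hev : fderiv ℝ (fun x => k * v x + m) =ᶠ[nhds p] fun y => k • fderiv ℝ v y := by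
    filter_upwards [ev_diff_aux hv] with y h1
    rw [fderiv_add_const, fderiv_const_mul h1]
  have h1 : ∀ i, pd (fun x => k * v x + m) i p = k * pd v i p := fun i => by
    unfold pd; rw [hev.self_of_nhds]; simp
  have h2 : ∀ i j, pd2 (fun x => k * v x + m) i j p = k * pd2 v i j p := fun i j => by
    rw [pd2_eq_aux hkv, pd2_eq_aux hv, hev.fderiv_eq, fderiv_fun_const_smul hd]; simp
  unfold Lop
  simp only [h1, h2, mul_sub, mul_add, Finset.mul_sum]
  have e1 : ∀ i j, k * (a p i j * pd2 v i j p) = a p i j * (k * pd2 v i j p) := by intros; ring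
  have e2 : ∀ i, k * (b p i * pd v i p) = b p i * (k * pd v i p) := by intros; ring
  simp only [e1, e2]
  ring

theorem lop_log_aux {n : ℕ} (a : EuclideanSpace ℝ (Fin n) → Fin n → Fin n → ℝ)
    (b : EuclideanSpace ℝ (Fin n) → Fin n → ℝ) (c : EuclideanSpace ℝ (Fin n) → ℝ)
    {q : EuclideanSpace ℝ (Fin n) → ℝ} {p : EuclideanSpace ℝ (Fin n)}
    (hq : ContDiffAt ℝ 2 q p) (hp : 0 < q p) :
    Lop a b c (fun x => Real.log (q x)) p =
      (∑ i, ∑ j, a p i j * pd2 q i j p) / q p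
      - (∑ i, ∑ j, a p i j * pd q i p * pd q j p) / (q p) ^ 2
      + (∑ i, b p i * pd q i p) / q p - c p * Real.log (q p) := by
  have hd : DifferentiableAt ℝ (fderiv ℝ q) p :=
    (hq.fderiv_right (m := 1) (by norm_num)).differentiableAt (by norm_num)
  have hlq : ContDiffAt ℝ 2 (fun x => Real.log (q x)) p := hq.log hp.ne'
  have hev : fderiv ℝ (fun x => Real.log (q x)) =ᶠ[nhds p] fun y => (q y)⁻¹ • fderiv ℝ q y := by
    filter_upwards [ev_diff_aux hq, hq.continuousAt.eventually (lt_mem_nhds hp)] with y h1 h2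
    exact (h1.hasFDerivAt.log h2.ne').fderiv
  have h1 : ∀ i, pd (fun x => Real.log (q x)) i p = pd q i p / q p := fun i => by
    unfold pd; rw [hev.self_of_nhds]; simp; ring
  have h2 : ∀ i j, pd2 (fun x => Real.log (q x)) i j p =
      pd2 q i j p / q p - pd q i p * pd q j p / (q p) ^ 2 := fun i j => by
    have hqd := (hq.differentiableAt (by norm_num))
    have hinv : HasFDerivAt (fun y => (q y)⁻¹) (-((q p) ^ 2)⁻¹ • fderiv ℝ q p) p := by
      exact (hasDerivAt_inv hp.ne').comp_hasFDerivAt p hqd.hasFDerivAt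
    rw [pd2_eq_aux hlq, pd2_eq_aux hq, hev.fderiv_eq, (hinv.fun_smul hd.hasFDerivAt).fderiv]
    simp [pd]; ring
  unfold Lop
  simp only [h1, h2, mul_sub, Finset.sum_sub_distrib, Finset.sum_div]
  simp only [mul_div_assoc, mul_assoc]

theorem cmp_aux {n : ℕ} {a : EuclideanSpace ℝ (Fin n) → Fin n → Fin n → ℝ}
    {b : EuclideanSpace ℝ (Fin n) → Fin n → ℝ} {c : EuclideanSpace ℝ (Fin n) → ℝ}
    {K lam Lam : ℝ} (hco : CoeffsOK a b c K lam Lam)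
    {Ω : Set (EuclideanSpace ℝ (Fin n))} (hΩo : IsOpen Ω) (hΩb : IsBounded Ω)
    {u v : EuclideanSpace ℝ (Fin n) → ℝ}
    (hu : ContDiffOn ℝ 2 u Ω) (hv : ContDiffOn ℝ 2 v Ω)
    (hL : ∀ x ∈ Ω, v x < u x → Lop a b c v x < Lop a b c u x)
    (δ : ℝ) (hδ : 0 < δ) (hbd : ∀ x ∈ Ω, infDist x (frontier Ω) < δ → u x ≤ v x) :
    ∀ x ∈ Ω, u x ≤ v x := by
  by_contra! hcon
  obtain ⟨x, hx, hlt⟩ := hcon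
  set S : Set (EuclideanSpace ℝ (Fin n)) := closure Ω ∩ {y | δ ≤ infDist y (frontier Ω)} with hS
  have hSc : IsCompact S :=
    hΩb.isCompact_closure.inter_right (isClosed_le continuous_const (continuous_infDist_pt _))
  have hSΩ : S ⊆ Ω := by
    rintro y ⟨hy1, hy2⟩
    by_contra hy
    have : y ∈ frontier Ω := by rw [hΩo.frontier_eq]; exact ⟨hy1, hy⟩
    have h0 := infDist_zero_of_mem this
    have hy3 : δ ≤ infDist y (frontier Ω) := hy2
    linarith
  have hin : ∀ y ∈ Ω, v y < u y → y ∈ S := fun y hy hlt => by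
    refine ⟨subset_closure hy, ?_⟩
    by_contra h
    exact absurd (hbd y hy (not_le.1 h)) (not_le.2 hlt)
  have hcont : ContinuousOn (fun y => u y - v y) S :=
    (hu.continuousOn.sub hv.continuousOn).mono hSΩ
  obtain ⟨p, hpS, hpm⟩ := hSc.exists_isMaxOn ⟨x, hin x hx hlt⟩ hcont
  have hpx : u x - v x ≤ u p - v p := hpm (hin x hx hlt)
  have hpΩ := hSΩ hpS
  have hnh := hΩo.mem_nhds hpΩ
  have hm : IsLocalMax (fun y => u y - v y) p := by
    filter_upwards [hnh] with y hy
    by_cases h : v y < u y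
    · exact hpm (hin y hy h)
    · linarith
  have := mp_aux hco (hu.contDiffAt hnh) (hv.contDiffAt hnh) hm (by linarith)
  linarith [hL p hpΩ (by linarith)]

theorem exp_barrier_aux {α s m : ℝ} (hα : 0 < α) (hs : 0 < s) :
    Real.exp (α * (-(2 / α) * Real.log s + m)) = Real.exp (α * m) / s ^ 2 := by
  have : α * (-(2 / α) * Real.log s + m) = α * m - Real.log (s ^ 2) := by
    rw [Real.log_pow]; field_simp; push_cast; ring
  rw [this, Real.exp_sub, Real.exp_log (by positivity)]

theorem b_bound_aux {n : ℕ} {K : ℝ} {b : Fin n → ℝ} (hb : ∑ i, (b i) ^ 2 ≤ K)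
    (z : EuclideanSpace ℝ (Fin n)) : |∑ i, b i * z i| ≤ Real.sqrt K * ‖z‖ := by
  have h1 := Finset.sum_mul_sq_le_sq_mul_sq Finset.univ b (fun i => z i)
  have h2 : ∑ i, (z i) ^ 2 = ‖z‖ ^ 2 := (EuclideanSpace.real_norm_sq_eq z).symm
  rw [h2] at h1
  have hK : 0 ≤ K := le_trans (Finset.sum_nonneg fun i _ => sq_nonneg _) hb
  apply abs_le_of_sq_le_sq _ (by positivity)
  rw [mul_pow, Real.sq_sqrt hK]
  exact h1.trans (mul_le_mul_of_nonneg_right hb (by positivity))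

theorem lin_deriv_aux {n : ℕ} (e : EuclideanSpace ℝ (Fin n)) (k : ℝ)
    (x : EuclideanSpace ℝ (Fin n)) :
    fderiv ℝ (fun y => k - inner ℝ e y) x = - innerSL ℝ e := by
  have : HasFDerivAt (fun y : EuclideanSpace ℝ (Fin n) => k - innerSL ℝ e y) (- innerSL ℝ e) x :=
    (innerSL ℝ e).hasFDerivAt.const_sub k
  exact this.fderiv

theorem quad_deriv_aux {n : ℕ} (x0 : EuclideanSpace ℝ (Fin n)) (k : ℝ)
    (x : EuclideanSpace ℝ (Fin n)) :
    fderiv ℝ (fun y => k - ‖y - x0‖ ^ 2) x = - (2 • innerSL ℝ (x - x0)) := by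
  have h := ((hasFDerivAt_id x).sub_const x0).norm_sq.const_sub k
  exact h.fderiv

theorem pd_lin_aux {n : ℕ} (e : EuclideanSpace ℝ (Fin n)) (k : ℝ)
    (x : EuclideanSpace ℝ (Fin n)) (i : Fin n) : pd (fun y => k - inner ℝ e y) i x = - e i := by
  unfold pd
  rw [lin_deriv_aux]
  simp [EuclideanSpace.inner_single_right]

theorem pd2_lin_aux {n : ℕ} (e : EuclideanSpace ℝ (Fin n)) (k : ℝ)
    (x : EuclideanSpace ℝ (Fin n)) (i j : Fin n) :
    pd2 (fun y => k - inner ℝ e y) i j x = 0 := by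
  unfold pd2
  simp [lin_deriv_aux]

theorem pd_quad_aux {n : ℕ} (x0 : EuclideanSpace ℝ (Fin n)) (k : ℝ)
    (x : EuclideanSpace ℝ (Fin n)) (i : Fin n) :
    pd (fun y => k - ‖y - x0‖ ^ 2) i x = - 2 * (x - x0) i := by
  unfold pd
  rw [quad_deriv_aux]
  simp [EuclideanSpace.inner_single_right]

theorem pd2_quad_aux {n : ℕ} (x0 : EuclideanSpace ℝ (Fin n)) (k : ℝ)
    (x : EuclideanSpace ℝ (Fin n)) (i j : Fin n) :
    pd2 (fun y => k - ‖y - x0‖ ^ 2) i j x = if i = j then - 2 else 0 := by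
  have h : pd2 (fun y => k - ‖y - x0‖ ^ 2) i j x =
    fderiv ℝ (fun y => pd (fun y => k - ‖y - x0‖ ^ 2) j y) x (EuclideanSpace.single i 1) := rfl
  rw [h]
  simp only [pd_quad_aux]
  have h2 : HasFDerivAt (fun y : EuclideanSpace ℝ (Fin n) => -2 * (y - x0) j)
      ((-2 : ℝ) • (EuclideanSpace.proj j : EuclideanSpace ℝ (Fin n) →L[ℝ] ℝ)) x := by
    have := (((EuclideanSpace.proj j : EuclideanSpace ℝ (Fin n) →L[ℝ] ℝ).hasFDerivAt
      (x := x)).sub_const (x0 j)).const_mul (-2)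
    exact this
  rw [h2.fderiv]
  by_cases hij : i = j
  · subst hij; simp
  · simp [hij, Ne.symm hij]

theorem lower_aux {n : ℕ} {a : EuclideanSpace ℝ (Fin n) → Fin n → Fin n → ℝ}
    {b : EuclideanSpace ℝ (Fin n) → Fin n → ℝ} {c : EuclideanSpace ℝ (Fin n) → ℝ}
    {K lam Lam : ℝ} (hco : CoeffsOK a b c K lam Lam)
    {Ω : Set (EuclideanSpace ℝ (Fin n))} (hΩo : IsOpen Ω) (hΩb : IsBounded Ω)
    {α : ℝ} (hα : 0 < α)
    {v : EuclideanSpace ℝ (Fin n) → ℝ} (hv : ContDiffOn ℝ 2 v Ω)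
    (heqv : ∀ x ∈ Ω, Lop a b c v x = Real.exp (α * v x)) (hbv : BlowsUp Ω v)
    (m : ℝ) (hm : ∀ x ∈ Ω, m ≤ v x) :
    ∃ C : ℝ, ∀ e : EuclideanSpace ℝ (Fin n), ‖e‖ = 1 → ∀ k : ℝ,
      (∀ x ∈ Ω, inner ℝ e x < k) → ∀ ε > 0, ∀ x ∈ Ω,
      -(2 / α) * Real.log (k + ε - inner ℝ e x) + C ≤ v x := by
  have hco' := hco
  obtain ⟨-, -, -, -, hb, hc, hK, hl, -, hell⟩ := hco'
  have hsK : 0 < Real.sqrt K := Real.sqrt_pos.2 hK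
  obtain ⟨C, hC1, hC2⟩ : ∃ C : ℝ, Real.exp (α * C) < lam / (K + α) ∧
      Real.exp (α / 2 * (C - m)) < lam / (2 * Real.sqrt K) := by
    have t1 : Tendsto (fun C : ℝ => Real.exp (α * C)) atBot (nhds 0) :=
      Real.tendsto_exp_atBot.comp (tendsto_id.const_mul_atBot hα)
    have t2 : Tendsto (fun C : ℝ => Real.exp (α / 2 * (C - m))) atBot (nhds 0) :=
      Real.tendsto_exp_atBot.comp
        ((tendsto_atBot_add_const_right _ (-m) tendsto_id).const_mul_atBot (by positivity))
    exact ((t1.eventually (gt_mem_nhds (by positivity))).and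
      (t2.eventually (gt_mem_nhds (by positivity)))).exists
  refine ⟨C, fun e he k hk ε hε => ?_⟩
  have hqpos : ∀ x ∈ Ω, ε < k + ε - inner ℝ e x := fun x hx => by linarith [hk x hx]
  have hqC : ContDiff ℝ 2 (fun x : EuclideanSpace ℝ (Fin n) => k + ε - inner ℝ e x) :=
    contDiff_const.sub (contDiff_const.inner ℝ contDiff_id)
  have hlogC : ∀ x ∈ Ω, ContDiffAt ℝ 2 (fun x => Real.log (k + ε - inner ℝ e x)) x :=
    fun x hx => hqC.contDiffAt.log (by linarith [hqpos x hx])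
  obtain ⟨δ, hδ, hbd⟩ := hbv (-(2 / α) * Real.log ε + C)
  refine cmp_aux hco hΩo hΩb
    (u := fun x => -(2 / α) * Real.log (k + ε - inner ℝ e x) + C)
    (fun x hx => ((contDiffAt_const.mul (hlogC x hx)).add contDiffAt_const).contDiffWithinAt)
    hv ?_ δ hδ ?_
  · intro p hp hlt
    have hs : 0 < k + ε - inner ℝ e p := by linarith [hqpos p hp]
    rw [heqv p hp, lop_affine_aux a b c (hlogC p hp), lop_log_aux a b c hqC.contDiffAt hs]
    simp only [pd_lin_aux, pd2_lin_aux]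
    have hexp : Real.exp (α * v p) < Real.exp (α * C) / (k + ε - inner ℝ e p) ^ 2 := by
      rw [← exp_barrier_aux hα hs]
      exact Real.exp_lt_exp.2 (mul_lt_mul_of_pos_left hlt hα)
    have hvm := hm p hp
    generalize k + ε - inner ℝ e p = s at *
    have hA : lam ≤ ∑ i, ∑ j, a p i j * -e i * -e j := by
      have := (hell p e).1
      rw [he] at this
      simpa using this
    have hB := b_bound_aux (hb p) e
    rw [he, mul_one] at hB
    have hB' : |∑ i, b p i * -e i| ≤ Real.sqrt K := by
      simpa [Finset.sum_neg_distrib] using hB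
    generalize ∑ i, ∑ j, a p i j * -e i * -e j = A at *
    generalize ∑ i, b p i * -e i = B at *
    have hB2 := (abs_le.1 hB').2
    simp only [mul_zero, Finset.sum_const_zero, zero_div, zero_sub]
    -- `s` is small
    have hss : s < lam / (2 * Real.sqrt K) := by
      refine lt_trans ?_ hC2
      rw [← Real.log_lt_iff_lt_exp hs]
      have h1 : 2 / α * Real.log s < C - m := by linarith
      have h2 : α / 2 * (2 / α * Real.log s) < α / 2 * (C - m) :=
        mul_lt_mul_of_pos_left h1 (by positivity)
      have h3 : α / 2 * (2 / α * Real.log s) = Real.log s := by field_simp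
      linarith
    rw [lt_div_iff₀ (by positivity)] at hss hC1
    -- bound of the zero order term
    have hW : α * (-(2 / α) * Real.log s + C) ≤ Real.exp (α * C) / s ^ 2 := by
      rw [← exp_barrier_aux hα hs]
      linarith [Real.add_one_le_exp (α * (-(2 / α) * Real.log s + C))]
    set E := Real.exp (α * C) with hE
    have hEpos : 0 < E := Real.exp_pos _
    set W := -(2 / α) * Real.log s + C with hWdef
    have hcW : c p * W ≤ K * (E / s ^ 2) / α := by
      have h1 : W ≤ E / s ^ 2 / α := by rw [le_div_iff₀ hα]; linarith
      have h0 : 0 ≤ E / s ^ 2 / α := by positivity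
      calc c p * W ≤ c p * (E / s ^ 2 / α) := mul_le_mul_of_nonneg_left h1 (hc p).1
        _ ≤ K * (E / s ^ 2 / α) := mul_le_mul_of_nonneg_right (hc p).2 h0
        _ = _ := by ring
    refine lt_trans hexp ?_
    have hgoal : -(2 / α) * (-(A / s ^ 2) + B / s - c p * Real.log s) - c p * C
        = (2 * A - 2 * B * s) / (α * s ^ 2) - c p * W := by
      rw [hWdef]; field_simp; ring
    rw [hgoal]
    have hmain : E / s ^ 2 + K * (E / s ^ 2) / α < (2 * A - 2 * B * s) / (α * s ^ 2) := by
      have : E / s ^ 2 + K * (E / s ^ 2) / α = (E * (K + α)) / (α * s ^ 2) := by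
        field_simp; ring
      rw [this]
      apply div_lt_div_of_pos_right _ (by positivity)
      have : B * s ≤ Real.sqrt K * s := mul_le_mul_of_nonneg_right hB2 hs.le
      nlinarith
    linarith
  · intro x hx hd
    have h1 := hbd x hx hd
    have h2 := Real.log_le_log hε (hqpos x hx).le
    have h3 : 2 / α * Real.log ε ≤ 2 / α * Real.log (k + ε - inner ℝ e x) :=
      mul_le_mul_of_nonneg_left h2 (by positivity)
    linarith

set_option maxHeartbeats 1000000 in
theorem upper_aux {n : ℕ} {a : EuclideanSpace ℝ (Fin n) → Fin n → Fin n → ℝ}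
    {b : EuclideanSpace ℝ (Fin n) → Fin n → ℝ} {c : EuclideanSpace ℝ (Fin n) → ℝ}
    {K lam Lam : ℝ} (hco : CoeffsOK a b c K lam Lam)
    {Ω : Set (EuclideanSpace ℝ (Fin n))} (hΩo : IsOpen Ω)
    {α : ℝ} (hα : 0 < α)
    {u : EuclideanSpace ℝ (Fin n) → ℝ} (hu : ContDiffOn ℝ 2 u Ω)
    (hequ : ∀ x ∈ Ω, Lop a b c u x = Real.exp (α * u x)) (R0 : ℝ) (hR0 : 0 < R0) :
    ∃ C > 0, ∀ x0 R, 0 < R → R ≤ R0 → closedBall x0 R ⊆ Ω →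
      Real.exp (α * u x0) * R ^ 2 ≤ C := by
  have hco' := hco
  obtain ⟨-, -, -, -, hb, hc, hK, hl, hlL, hell⟩ := hco'
  have hLpos : 0 < Lam := lt_of_lt_of_le hl hlL
  have hsK : 0 < Real.sqrt K := Real.sqrt_pos.2 hK
  set C := R0 ^ 2 + 4 / α * (n * Lam + 2 * Lam + Real.sqrt K * R0) with hCdef
  have hC : 0 < C := by positivity
  refine ⟨C, hC, fun x0 R hR hRR hball => ?_⟩
  by_contra! hcon
  set q : EuclideanSpace ℝ (Fin n) → ℝ := fun y => R ^ 2 - ‖y - x0‖ ^ 2 with hq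
  have hqC : ContDiff ℝ 2 q :=
    contDiff_const.sub ((contDiff_id.sub contDiff_const).norm_sq ℝ)
  have hcont : ContinuousOn (fun y => q y ^ 2 * Real.exp (α * u y)) (closedBall x0 R) := by
    have h1 := hu.continuousOn.mono hball
    have h2 := hqC.continuous.continuousOn (s := closedBall x0 R)
    exact (h2.pow 2).mul (Real.continuous_exp.comp_continuousOn (continuousOn_const.mul h1))
  have hx0 : x0 ∈ closedBall x0 R := mem_closedBall_self hR.le
  obtain ⟨p, hpB, hpm⟩ := (isCompact_closedBall x0 R).exists_isMaxOn ⟨x0, hx0⟩ hcont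
  have h0 : q x0 ^ 2 * Real.exp (α * u x0) ≤ q p ^ 2 * Real.exp (α * u p) := hpm hx0
  have hq0 : q x0 = R ^ 2 := by simp [hq]
  have hbig : C * R ^ 2 < q p ^ 2 * Real.exp (α * u p) := by
    rw [hq0] at h0
    have : C * R ^ 2 < Real.exp (α * u x0) * R ^ 2 * R ^ 2 :=
      mul_lt_mul_of_pos_right hcon (by positivity)
    nlinarith
  have hpn : ‖p - x0‖ ≤ R := by rwa [mem_closedBall, dist_eq_norm] at hpB
  have hs : 0 < q p := by
    have h1 : 0 ≤ q p := by
      simp only [hq]; nlinarith [norm_nonneg (p - x0)]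
    rcases h1.lt_or_eq with h | h
    · exact h
    · rw [← h] at hbig
      have : 0 < C * R ^ 2 := by positivity
      simp at hbig
      linarith
  have hsR : q p ≤ R ^ 2 := by simp only [hq]; nlinarith [norm_nonneg (p - x0)]
  set m := 1 / α * Real.log (C * R ^ 2) with hm
  have hEm : Real.exp (α * m) = C * R ^ 2 := by
    have : α * m = Real.log (C * R ^ 2) := by rw [hm]; field_simp
    rw [this, Real.exp_log (by positivity)]
  have hlogC : ContDiffAt ℝ 2 (fun x => Real.log (q x)) p := hqC.contDiffAt.log hs.ne'
  have hUC : ContDiffAt ℝ 2 (fun x => -(2 / α) * Real.log (q x) + m) p :=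
    (contDiffAt_const.mul hlogC).add contDiffAt_const
  have hpΩ := hball hpB
  have hexp : Real.exp (α * (-(2 / α) * Real.log (q p) + m)) < Real.exp (α * u p) := by
    rw [exp_barrier_aux hα hs, hEm, div_lt_iff₀ (by positivity)]
    linarith
  have hUu : -(2 / α) * Real.log (q p) + m < u p := by
    have := Real.exp_lt_exp.1 hexp
    exact lt_of_mul_lt_mul_left this hα.le
  have hmax : IsLocalMax (fun x => u x - (-(2 / α) * Real.log (q x) + m)) p := by
    filter_upwards [hqC.continuous.continuousAt.eventually (lt_mem_nhds hs)] with y hy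
    have hyB : y ∈ closedBall x0 R := by
      rw [mem_closedBall, dist_eq_norm]
      simp only [hq] at hy
      exact (abs_le_of_sq_le_sq' (by linarith) hR.le).2
    have h1 : q y ^ 2 * Real.exp (α * u y) ≤ q p ^ 2 * Real.exp (α * u p) := hpm hyB
    have h2 := Real.log_le_log (by positivity) h1
    rw [Real.log_mul (by positivity) (by positivity), Real.log_mul (by positivity) (by positivity),
      Real.log_exp, Real.log_exp, Real.log_pow, Real.log_pow] at h2
    push_cast at h2
    have h3 : ∀ s t : ℝ, s - (-(2 / α) * t + m) = (2 * t + α * s) / α - m := by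
      intro s t; field_simp; ring
    rw [h3, h3]
    have := div_le_div_of_nonneg_right h2 hα.le
    linarith
  have hmp := mp_aux hco (hu.contDiffAt (hΩo.mem_nhds hpΩ)) hUC hmax hUu.le
  rw [hequ p hpΩ, lop_affine_aux a b c hlogC, lop_log_aux a b c hqC.contDiffAt hs] at hmp
  have hfin := lt_of_lt_of_le hexp hmp
  rw [exp_barrier_aux hα hs, hEm] at hfin
  have hU0 : 0 ≤ -(2 / α) * Real.log (q p) + m := by
    have h1 : 1 ≤ Real.exp (α * (-(2 / α) * Real.log (q p) + m)) := by
      rw [exp_barrier_aux hα hs, hEm, le_div_iff₀ (by positivity), one_mul]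
      have h2 : R ^ 2 ≤ C := by
        have : R ^ 2 ≤ R0 ^ 2 := by gcongr
        have : 0 ≤ 4 / α * (n * Lam + 2 * Lam + Real.sqrt K * R0) := by positivity
        linarith
      have : q p ^ 2 ≤ (R ^ 2) ^ 2 := by gcongr
      nlinarith [sq_nonneg R]
    rw [Real.one_le_exp_iff] at h1
    exact nonneg_of_mul_nonneg_right h1 hα
  have hcU := mul_nonneg (hc p).1 hU0
  simp only [hq, pd_quad_aux, pd2_quad_aux] at hfin
  rw [← show q p = R ^ 2 - ‖p - x0‖ ^ 2 from rfl] at hfin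
  have e1 : ∑ i, ∑ j, a p i j * (if i = j then (-2 : ℝ) else 0) = -2 * ∑ i, a p i i := by
    simp [Finset.mul_sum, mul_comm]
  have e2 : ∑ i, ∑ j, a p i j * (-2 * (p - x0) i) * (-2 * (p - x0) j)
      = 4 * ∑ i, ∑ j, a p i j * (p - x0) i * (p - x0) j := by
    simp only [Finset.mul_sum]
    refine Finset.sum_congr rfl fun i _ => Finset.sum_congr rfl fun j _ => ?_
    ring
  have e3 : ∑ i, b p i * (-2 * (p - x0) i) = -2 * ∑ i, b p i * (p - x0) i := by
    simp only [Finset.mul_sum]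
    refine Finset.sum_congr rfl fun i _ => ?_
    ring
  rw [e1, e2, e3] at hfin
  have hT : ∑ i, a p i i ≤ n * Lam := by
    have : ∀ i, a p i i ≤ Lam := fun i => by
      have := (hell p (EuclideanSpace.single i 1)).2
      simpa [Pi.single_apply] using this
    calc ∑ i, a p i i ≤ ∑ _i : Fin n, Lam := Finset.sum_le_sum fun i _ => this i
      _ = _ := by simp
  have hQ : ∑ i, ∑ j, a p i j * (p - x0) i * (p - x0) j ≤ Lam * R ^ 2 :=
    (hell p (p - x0)).2.trans (by gcongr)
  have hB : ∑ i, b p i * (p - x0) i ≤ Real.sqrt K * R0 :=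
    (le_abs_self _).trans ((b_bound_aux (hb p) (p - x0)).trans (by gcongr; linarith))
  generalize ∑ i, a p i i = T at *
  generalize ∑ i, ∑ j, a p i j * (p - x0) i * (p - x0) j = Q at *
  generalize ∑ i, b p i * (p - x0) i = B at *
  generalize q p = s at *
  have hgoal : -(2 / α) * (-2 * T / s - 4 * Q / s ^ 2 + -2 * B / s - c p * Real.log s) - c p * m
      = 4 / α * (T * s + 2 * Q + B * s) / s ^ 2 - c p * (-(2 / α) * Real.log s + m) := by
    field_simp; ring
  rw [hgoal] at hfin
  have h5 : C * R ^ 2 / s ^ 2 < 4 / α * (T * s + 2 * Q + B * s) / s ^ 2 := by linarith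
  rw [div_lt_div_iff_of_pos_right (by positivity)] at h5
  have h6 : T * s + 2 * Q + B * s ≤ (n * Lam + 2 * Lam + Real.sqrt K * R0) * R ^ 2 := by
    have t1 : T * s ≤ n * Lam * R ^ 2 :=
      (mul_le_mul_of_nonneg_right hT hs.le).trans (mul_le_mul_of_nonneg_left hsR (by positivity))
    have t2 : B * s ≤ Real.sqrt K * R0 * R ^ 2 :=
      (mul_le_mul_of_nonneg_right hB hs.le).trans (mul_le_mul_of_nonneg_left hsR (by positivity))
    linarith
  have h7 : 4 / α * (T * s + 2 * Q + B * s) ≤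
      4 / α * ((n * Lam + 2 * Lam + Real.sqrt K * R0) * R ^ 2) :=
    mul_le_mul_of_nonneg_left h6 (by positivity)
  have h8 : 0 ≤ R0 ^ 2 * R ^ 2 := by positivity
  rw [hCdef] at h5
  nlinarith

theorem bddBelow_aux {n : ℕ} {Ω : Set (EuclideanSpace ℝ (Fin n))} (hΩo : IsOpen Ω)
    (hΩb : IsBounded Ω) {v : EuclideanSpace ℝ (Fin n) → ℝ} (hv : ContinuousOn v Ω)
    (hbv : BlowsUp Ω v) : ∃ m, ∀ x ∈ Ω, m ≤ v x := by
  obtain ⟨δ, hδ, hbd⟩ := hbv 0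
  set S : Set (EuclideanSpace ℝ (Fin n)) := closure Ω ∩ {y | δ ≤ infDist y (frontier Ω)} with hS
  have hSc : IsCompact S :=
    hΩb.isCompact_closure.inter_right (isClosed_le continuous_const (continuous_infDist_pt _))
  have hSΩ : S ⊆ Ω := by
    rintro y ⟨hy1, hy2⟩
    by_contra hy
    have : y ∈ frontier Ω := by rw [hΩo.frontier_eq]; exact ⟨hy1, hy⟩
    have h0 := infDist_zero_of_mem this
    have hy3 : δ ≤ infDist y (frontier Ω) := hy2
    linarith
  obtain ⟨m, hm⟩ := (hSc.image_of_continuousOn (hv.mono hSΩ)).bddBelow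
  refine ⟨min m 0, fun x hx => ?_⟩
  by_cases h : infDist x (frontier Ω) < δ
  · exact (min_le_right _ _).trans (hbd x hx h)
  · exact (min_le_left _ _).trans (hm ⟨x, ⟨subset_closure hx, not_lt.1 h⟩, rfl⟩)

theorem le_aux {n : ℕ} (hn : 2 ≤ n)
    (Ω : Set (EuclideanSpace ℝ (Fin n)))
    (hΩo : IsOpen Ω) (hΩb : IsBounded Ω)
    (hconv : Convex ℝ Ω)
    (a : EuclideanSpace ℝ (Fin n) → Fin n → Fin n → ℝ)
    (b : EuclideanSpace ℝ (Fin n) → Fin n → ℝ)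
    (c : EuclideanSpace ℝ (Fin n) → ℝ)
    (K lam Lam : ℝ) (hco : CoeffsOK a b c K lam Lam)
    (α : ℝ) (hα : 0 < α)
    (u v : EuclideanSpace ℝ (Fin n) → ℝ)
    (hu : ContDiffOn ℝ 2 u Ω) (hv : ContDiffOn ℝ 2 v Ω)
    (hequ : ∀ x ∈ Ω, Lop a b c u x = Real.exp (α * u x))
    (heqv : ∀ x ∈ Ω, Lop a b c v x = Real.exp (α * v x))
    (hbv : BlowsUp Ω v) :
    ∀ x ∈ Ω, u x ≤ v x := by
  haveI : Nonempty (Fin n) := ⟨⟨0, by omega⟩⟩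
  obtain ⟨m, hm⟩ := bddBelow_aux hΩo hΩb hv.continuousOn hbv
  obtain ⟨C, hC⟩ := lower_aux hco hΩo hΩb hα hv heqv hbv m hm
  obtain ⟨z, hz⟩ : ∃ z, z ∉ Ω := by
    by_contra! h
    have : Ω = univ := eq_univ_of_forall h
    rw [this] at hΩb
    exact NormedSpace.unbounded_univ ℝ (EuclideanSpace ℝ (Fin n)) hΩb
  obtain ⟨R0, hR0, hΩR⟩ := hΩb.subset_ball_lt 0 z
  obtain ⟨D, hD, hupper⟩ := upper_aux hco hΩo hα hu hequ R0 hR0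
  -- the difference is bounded
  obtain ⟨C1, hC1⟩ : ∃ C1, ∀ x ∈ Ω, u x ≤ v x + C1 := by
    refine ⟨(Real.log D + 4 * Real.log 2) / α - C, fun x hx => ?_⟩
    obtain ⟨y, hy, hdy⟩ := hΩo.isClosed_compl.exists_infDist_eq_dist ⟨z, hz⟩ x
    set d := infDist x Ωᶜ with hd
    have hdpos : 0 < d := by
      rw [hdy, dist_pos]
      rintro rfl
      exact hy hx
    have hdR : d ≤ R0 := by
      have h1 : d ≤ dist x z := infDist_le_dist_of_mem hz
      have h2 : dist x z < R0 := hΩR hx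
      linarith
    have hball : closedBall x (d / 2) ⊆ Ω :=
      (closedBall_subset_ball (by linarith)).trans ball_infDist_compl_subset
    have hup := hupper x (d / 2) (by linarith) (by linarith) hball
    have hup2 := Real.log_le_log (by positivity) hup
    rw [Real.log_mul (by positivity) (by positivity), Real.log_exp, Real.log_pow,
      Real.log_div (by positivity) (by positivity)] at hup2
    push_cast at hup2
    obtain ⟨f, hf⟩ := geometric_hahn_banach_open_point hconv hΩo hy
    set w := (InnerProductSpace.toDual ℝ (EuclideanSpace ℝ (Fin n))).symm f with hw
    have hwf : ∀ t, inner ℝ w t = f t := fun t => InnerProductSpace.toDual_symm_apply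
    have hw0 : w ≠ 0 := by
      intro h0
      have h1 := hf x hx
      rw [← hwf, ← hwf, h0] at h1
      simp at h1
    have hwn : 0 < ‖w‖ := norm_pos_iff.2 hw0
    have he : ‖(‖w‖⁻¹ • w)‖ = 1 := by
      rw [norm_smul, norm_inv, norm_norm]; field_simp
    set e := ‖w‖⁻¹ • w with hedef
    have hsep : ∀ x ∈ Ω, inner ℝ e x < inner ℝ e y := fun x hx => by
      rw [hedef, real_inner_smul_left, real_inner_smul_left, hwf, hwf]
      exact mul_lt_mul_of_pos_left (hf x hx) (by positivity)
    have hlow := hC e he (inner ℝ e y) hsep d hdpos x hx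
    have hin : inner ℝ e y - inner ℝ e x ≤ d := by
      rw [← inner_sub_right, hdy, dist_comm, dist_eq_norm]
      have := real_inner_le_norm e (y - x)
      rwa [he, one_mul] at this
    have hlog : Real.log (inner ℝ e y + d - inner ℝ e x) ≤ Real.log 2 + Real.log d := by
      rw [← Real.log_mul (by norm_num) hdpos.ne']
      exact Real.log_le_log (by linarith [hsep x hx]) (by linarith)
    have hlog2 := mul_le_mul_of_nonneg_left hlog (show 0 ≤ 2 / α by positivity)
    have h1 : u x ≤ (Real.log D - 2 * (Real.log d - Real.log 2)) / α := by
      rw [le_div_iff₀ hα]; linarith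
    have h2 : (Real.log D - 2 * (Real.log d - Real.log 2)) / α + 2 / α * (Real.log 2 + Real.log d)
      = (Real.log D + 4 * Real.log 2) / α := by ring
    linarith
  set M := max 0 (1 / α - m) with hM
  have hM0 : 0 ≤ M := le_max_left _ _
  have hvM : ∀ x ∈ Ω, 1 / α ≤ v x + M := fun x hx => by
    linarith [hm x hx, le_max_right 0 (1 / α - m)]
  have hε : ∀ ε > 0, ∀ x ∈ Ω, u x ≤ (1 + ε) * v x + ε * M := by
    intro ε hε
    obtain ⟨δ, hδ, hbd⟩ := hbv (C1 / ε)
    refine cmp_aux hco hΩo hΩb (v := fun x => (1 + ε) * v x + ε * M) hu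
      ((contDiffOn_const.mul hv).add contDiffOn_const) ?_ δ hδ ?_
    · intro x hx hlt
      rw [lop_affine_aux a b c (hv.contDiffAt (hΩo.mem_nhds hx)), heqv x hx, hequ x hx]
      have h1 : Real.exp (α * ((1 + ε) * v x + ε * M)) < Real.exp (α * u x) :=
        Real.exp_lt_exp.2 (mul_lt_mul_of_pos_left hlt hα)
      have h2 : α * ((1 + ε) * v x + ε * M) = ε * (α * (v x + M)) + α * v x := by ring
      have h3 : 1 ≤ α * (v x + M) := by
        have := hvM x hx
        rw [div_le_iff₀ hα] at this
        linarith
      have h4 : 1 + ε ≤ Real.exp (ε * (α * (v x + M))) := by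
        have := Real.add_one_le_exp (ε * (α * (v x + M)))
        nlinarith
      rw [h2, Real.exp_add] at h1
      have h5 := mul_le_mul_of_nonneg_right h4 (Real.exp_pos (α * v x)).le
      obtain ⟨-, -, -, -, -, hc, -⟩ := hco
      have h6 : 0 ≤ c x * (ε * M) := mul_nonneg (hc x).1 (by positivity)
      linarith
    · intro x hx hlt
      have h1 := hbd x hx hlt
      rw [div_le_iff₀ hε] at h1
      have h2 := hC1 x hx
      have : 0 ≤ ε * M := by positivity
      linarith
  intro x hx
  by_contra! hlt
  have hpos : 0 < v x + M := lt_of_lt_of_le (by positivity) (hvM x hx)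
  have h1 := hε ((u x - v x) / (2 * (v x + M))) (by apply div_pos <;> linarith) x hx
  have h2 : (u x - v x) / (2 * (v x + M)) * (v x + M) = (u x - v x) / 2 := by field_simp
  linarith

/-- Theorem 3.2 of the paper. If `Ω` is a bounded convex domain,
then the problem `Lu = e^{au}` (`a > 0`), `u → +∞` at `∂Ω`, has at most one
`C²(Ω)` solution. -/
theorem uniqueness_exponential_convex {n : ℕ} (hn : 2 ≤ n)
    (Ω : Set (EuclideanSpace ℝ (Fin n)))
    (hΩo : IsOpen Ω) (hΩc : IsConnected Ω) (hΩb : IsBounded Ω)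
    (hconv : Convex ℝ Ω)
    (a : EuclideanSpace ℝ (Fin n) → Fin n → Fin n → ℝ)
    (b : EuclideanSpace ℝ (Fin n) → Fin n → ℝ)
    (c : EuclideanSpace ℝ (Fin n) → ℝ)
    (K lam Lam : ℝ) (hco : CoeffsOK a b c K lam Lam)
    (aexp : ℝ) (haexp : 0 < aexp)
    (u v : EuclideanSpace ℝ (Fin n) → ℝ)
    (hu : ContDiffOn ℝ 2 u Ω) (hv : ContDiffOn ℝ 2 v Ω)
    (hequ : ∀ x ∈ Ω, Lop a b c u x = Real.exp (aexp * u x))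
    (heqv : ∀ x ∈ Ω, Lop a b c v x = Real.exp (aexp * v x))
    (hbu : BlowsUp Ω u) (hbv : BlowsUp Ω v) :
    EqOn u v Ω := by
  exact fun x hx => le_antisymm
    (le_aux hn Ω hΩo hΩb hconv a b c K lam Lam hco aexp haexp u v hu hv hequ heqv hbv x hx)
    (le_aux hn Ω hΩo hΩb hconv a b c K lam Lam hco aexp haexp v u hv hu heqv hequ hbu x hx)
end

section
/- Uniqueness in domains with ∂Ω = ∂(closure Ω): Let μ := Λ/λ ≥ 1 and let p > 1 satisfy (p − 1)(μ(n−1) − 1) < 2 (i.e. p ∈ (1, 1 + 2/(μ(n−1) − 1)), the whole interval (1, ∞) if μ(n−1) = 1). Assume Ω ⊂ ℝⁿ (n ≥ 2) is a bounded domain with ∂Ω = ∂(closure Ω). Then there exists at most one function u ∈ C²(Ω) satisfying Lu(x) = (u(x))₊^p for all x ∈ Ω and u(x) → +∞ as d(x) → 0. -/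
open Metric Set Filter Real Bornology

section helpers

local notation "E" n => EuclideanSpace ℝ (Fin n)

/-- Sum of products of a psd matrix with a nonpositive form is nonpositive. -/
lemma aux_trace {n : ℕ} (a : Fin n → Fin n → ℝ) (hs : ∀ i j, a i j = a j i)
    (ha : ∀ ξ : E n, 0 ≤ ∑ i, ∑ j, a i j * ξ i * ξ j)
    (H : Fin n → Fin n → ℝ) (hH : ∀ ξ : E n, ∑ i, ∑ j, H i j * ξ i * ξ j ≤ 0) :
    ∑ i, ∑ j, a i j * H i j ≤ 0 := by
  classical
  have hP : (Matrix.of a).PosSemidef := by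
    rw [Matrix.posSemidef_iff_dotProduct_mulVec]
    refine ⟨?_, fun x => ?_⟩
    · ext i j
      simp [Matrix.conjTranspose_apply, hs j i]
    · have := ha (WithLp.toLp 2 x)
      simp only [dotProduct, Matrix.mulVec, Matrix.of_apply, Finset.mul_sum]
      refine this.trans_eq ?_
      refine Finset.sum_congr rfl fun i _ => Finset.sum_congr rfl fun j _ => ?_
      simp
      ring
  have h0 : ∃ B : Matrix (Fin n) (Fin n) ℝ, Matrix.of a = star B * B := by
    open scoped MatrixOrder Matrix.Norms.L2Operator in
    exact CStarAlgebra.nonneg_iff_eq_star_mul_self.1 hP.nonneg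
  obtain ⟨B, hB⟩ := h0
  have hab : ∀ i j, a i j = ∑ k, B k i * B k j := by
    intro i j
    have := congrFun (congrFun hB i) j
    simpa [Matrix.mul_apply, Matrix.star_apply] using this
  have : ∑ i, ∑ j, a i j * H i j = ∑ k, ∑ i, ∑ j, H i j * B k i * B k j := by
    symm
    rw [Finset.sum_comm]
    have : ∀ i, ∑ k, ∑ j, H i j * B k i * B k j = ∑ j, a i j * H i j := by
      intro i
      rw [Finset.sum_comm]
      refine Finset.sum_congr rfl fun j _ => ?_
      rw [hab, Finset.sum_mul]
      exact Finset.sum_congr rfl fun k _ => by ring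
    exact Finset.sum_congr rfl fun i _ => this i
  rw [this]
  refine Finset.sum_nonpos fun k _ => ?_
  simpa using hH (WithLp.toLp 2 (B k))

/-- Second order necessary condition in one dimension. -/
lemma aux_1d (f : ℝ → ℝ) (hc : ContinuousAt f 0) (h : IsLocalMax f 0) :
    deriv (deriv f) 0 ≤ 0 := by
  by_contra hh
  push Not at hh
  have hmin := isLocalMin_of_deriv_deriv_pos hh h.deriv_eq_zero hc
  have hcst : f =ᶠ[nhds 0] fun _ => f 0 := by
    filter_upwards [h, hmin] with y h1 h2 using le_antisymm h1 h2
  have h2 : deriv f =ᶠ[nhds 0] deriv fun _ => f 0 := hcst.deriv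
  have := h2.deriv_eq
  simp at this
  linarith

lemma aux_fd {n : ℕ} {w : (E n) → ℝ} {x : E n} (hw : ContDiffAt ℝ 2 w x) :
    DifferentiableAt ℝ (fderiv ℝ w) x :=
  (hw.fderiv_right (m := 1) (by norm_num)).differentiableAt (by norm_num)

lemma aux_ev {n : ℕ} {w : (E n) → ℝ} {x : E n} (hw : ContDiffAt ℝ 2 w x) :
    ∀ᶠ y in nhds x, DifferentiableAt ℝ w y :=
  (hw.eventually (by simp)).mono fun _ h => h.differentiableAt (by norm_num)

lemma aux_pd2 {n : ℕ} {w : (E n) → ℝ} {x : E n} (hw : ContDiffAt ℝ 2 w x) (i j : Fin n) :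
    pd2 w i j x = fderiv ℝ (fderiv ℝ w) x (EuclideanSpace.single i 1)
      (EuclideanSpace.single j 1) := by
  have h := (aux_fd hw).hasFDerivAt
  unfold pd2
  have := (h.clm_apply (hasFDerivAt_const (EuclideanSpace.single j (1:ℝ)) x)).fderiv
  rw [this]
  simp

lemma aux_single {n : ℕ} (ξ : E n) : ξ = ∑ i, ξ i • EuclideanSpace.single i (1:ℝ) := by
  ext k
  simp [Finset.sum_apply, Pi.single_apply]

lemma aux_quad {n : ℕ} {w : (E n) → ℝ} {x : E n} (hw : ContDiffAt ℝ 2 w x) (ξ : E n) :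
    ∑ i, ∑ j, pd2 w i j x * ξ i * ξ j = fderiv ℝ (fderiv ℝ w) x ξ ξ := by
  conv_rhs => rw [aux_single ξ]
  simp only [map_sum, map_smul, _root_.sum_apply, _root_.smul_apply,
    smul_eq_mul, aux_pd2 hw, Finset.mul_sum]
  rw [Finset.sum_comm]
  refine Finset.sum_congr rfl fun i _ => Finset.sum_congr rfl fun j _ => ?_
  ring

lemma aux_hess {n : ℕ} {w : (E n) → ℝ} {x : E n} (hw : ContDiffAt ℝ 2 w x)
    (hm : IsLocalMax w x) (ξ : E n) : fderiv ℝ (fderiv ℝ w) x ξ ξ ≤ 0 := by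
  have hl : ∀ t : ℝ, HasDerivAt (fun t : ℝ => x + t • ξ) ξ t := by
    intro t
    simpa using ((hasDerivAt_id t).smul_const ξ).const_add x
  have hl0 : x + (0:ℝ) • ξ = x := by simp
  have hT : Tendsto (fun t : ℝ => x + t • ξ) (nhds 0) (nhds x) := by
    have := (hl 0).continuousAt.tendsto
    rwa [hl0] at this
  have hg : ContinuousAt (fun t : ℝ => w (x + t • ξ)) 0 := by
    have h1 := hw.continuousAt.tendsto.comp hT
    unfold ContinuousAt
    simp only [hl0]
    exact h1
  have hmax : IsLocalMax (fun t : ℝ => w (x + t • ξ)) 0 := by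
    have := hT.eventually hm
    unfold IsLocalMax IsMaxFilter
    simp only [hl0]
    exact this
  have hd1 : deriv (fun t : ℝ => w (x + t • ξ)) =ᶠ[nhds 0]
      fun t => fderiv ℝ w (x + t • ξ) ξ := by
    filter_upwards [hT.eventually (aux_ev hw)] with t ht
    exact (ht.hasFDerivAt.comp_hasDerivAt t (hl t)).deriv
  have hd2 : HasDerivAt (fun t : ℝ => fderiv ℝ w (x + t • ξ) ξ)
      (fderiv ℝ (fderiv ℝ w) x ξ ξ) 0 := by
    have h := (aux_fd hw).hasFDerivAt
    have h' : HasFDerivAt (fderiv ℝ w) (fderiv ℝ (fderiv ℝ w) x) (x + (0:ℝ) • ξ) := by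
      rwa [hl0]
    have h2 := h'.comp_hasDerivAt (0:ℝ) (hl 0)
    have := h2.clm_apply (hasDerivAt_const (0:ℝ) ξ)
    simpa using this
  have := aux_1d _ hg hmax
  rwa [hd1.deriv_eq, hd2.deriv] at this

/-- Pointwise maximum principle. -/
lemma aux_maxprin {n : ℕ} {a : (E n) → Fin n → Fin n → ℝ} {b : (E n) → Fin n → ℝ}
    {c : (E n) → ℝ} {K lam Lam : ℝ} (hco : CoeffsOK a b c K lam Lam)
    {w : (E n) → ℝ} {x : E n} (hw : ContDiffAt ℝ 2 w x)
    (hm : IsLocalMax w x) (h0 : 0 ≤ w x) : Lop a b c w x ≤ 0 := by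
  obtain ⟨-, -, -, hs, hb, hc, hK, hlam, hle, hell⟩ := hco
  have h1 : ∑ i, ∑ j, a x i j * pd2 w i j x ≤ 0 := by
    refine aux_trace (a x) (hs x) (fun ξ => ?_) _ (fun ξ => ?_)
    · exact le_trans (by positivity) (hell x ξ).1
    · rw [aux_quad hw]
      exact aux_hess hw hm ξ
  have h2 : ∀ i, pd w i x = 0 := by
    intro i
    simp [pd, hm.fderiv_eq_zero]
  have h3 : 0 ≤ c x * w x := mul_nonneg (hc x).1 h0
  simp only [Lop, h2]
  simp only [mul_zero, Finset.sum_const_zero]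
  linarith

lemma aux_lin {n : ℕ} {a : (E n) → Fin n → Fin n → ℝ} {b : (E n) → Fin n → ℝ}
    {c : (E n) → ℝ} {u v : (E n) → ℝ} {x : E n} (hu : ContDiffAt ℝ 2 u x)
    (hv : ContDiffAt ℝ 2 v x) (k : ℝ) :
    Lop a b c (fun y => u y - k * v y) x = Lop a b c u x - k * Lop a b c v x := by
  have hk : ContDiffAt ℝ 2 (fun y => u y - k * v y) x := hu.sub (contDiffAt_const.mul hv)
  have h1 : fderiv ℝ (fun y => u y - k * v y) =ᶠ[nhds x]
      fun y => fderiv ℝ u y - k • fderiv ℝ v y := by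
    filter_upwards [aux_ev hu, aux_ev hv] with y h1 h2
    exact (h1.hasFDerivAt.sub (h2.hasFDerivAt.const_mul k)).fderiv
  have h2 : ∀ i, pd (fun y => u y - k * v y) i x = pd u i x - k * pd v i x := by
    intro i
    simp [pd, h1.self_of_nhds]
  have h3 : ∀ i j, pd2 (fun y => u y - k * v y) i j x = pd2 u i j x - k * pd2 v i j x := by
    intro i j
    rw [aux_pd2 hk, aux_pd2 hu, aux_pd2 hv, h1.fderiv_eq]
    have hh : HasFDerivAt (fun y => fderiv ℝ u y - k • fderiv ℝ v y) _ x :=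
      (aux_fd hu).hasFDerivAt.sub ((aux_fd hv).hasFDerivAt.const_smul k)
    rw [hh.fderiv]
    simp
  simp only [Lop, h2, h3, mul_sub, Finset.sum_sub_distrib, mul_left_comm _ k]
  simp only [← Finset.mul_sum]
  ring

/-- Radial functions. -/
lemma aux_radial {n : ℕ} (a : (E n) → Fin n → Fin n → ℝ) (b : (E n) → Fin n → ℝ)
    (c : (E n) → ℝ) (z x : E n) (f f1 : ℝ → ℝ) (f2 : ℝ)
    (hf : ContDiffAt ℝ 2 f (‖x - z‖ ^ 2))
    (h1 : ∀ᶠ t in nhds (‖x - z‖ ^ 2), HasDerivAt f (f1 t) t)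
    (h2 : HasDerivAt f1 f2 (‖x - z‖ ^ 2)) :
    ContDiffAt ℝ 2 (fun y => f (‖y - z‖ ^ 2)) x ∧
    Lop a b c (fun y => f (‖y - z‖ ^ 2)) x =
      4 * f2 * (∑ i, ∑ j, a x i j * (x - z) i * (x - z) j)
      + 2 * f1 (‖x - z‖ ^ 2) * (∑ i, a x i i)
      + 2 * f1 (‖x - z‖ ^ 2) * (∑ i, b x i * (x - z) i) - c x * f (‖x - z‖ ^ 2) := by
  have hq : ContDiffAt ℝ 2 (fun y : E n => ‖y - z‖ ^ 2) x :=
    (contDiffAt_id.sub contDiffAt_const).norm_sq ℝ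
  have hC : ContDiffAt ℝ 2 (fun y => f (‖y - z‖ ^ 2)) x := hf.comp x hq
  refine ⟨hC, ?_⟩
  have hqd : ∀ y : E n, HasFDerivAt (fun y : E n => ‖y - z‖ ^ 2)
      (2 • (innerSL ℝ (y - z))) y := by
    intro y
    simpa using ((hasFDerivAt_id y).sub_const z).norm_sq
  have e1 : ∀ j, (fun y => fderiv ℝ (fun y => f (‖y - z‖ ^ 2)) y (EuclideanSpace.single j 1))
      =ᶠ[nhds x] fun y => f1 (‖y - z‖ ^ 2) * (2 * (y - z) j) := by
    intro j
    filter_upwards [hq.continuousAt.tendsto.eventually h1] with y hy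
    have hh : HasFDerivAt (fun y => f (‖y - z‖ ^ 2)) _ y := hy.comp_hasFDerivAt y (hqd y)
    rw [hh.fderiv]
    simp [EuclideanSpace.inner_single_right]
  have p1 : ∀ i, pd (fun y => f (‖y - z‖ ^ 2)) i x = f1 (‖x - z‖ ^ 2) * (2 * (x - z) i) :=
    fun i => (e1 i).self_of_nhds
  have p2 : ∀ i j, pd2 (fun y => f (‖y - z‖ ^ 2)) i j x =
      4 * f2 * ((x - z) i * (x - z) j) + if i = j then 2 * f1 (‖x - z‖ ^ 2) else 0 := by
    intro i j
    unfold pd2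
    rw [(e1 j).fderiv_eq]
    have hlin : HasFDerivAt (fun y : E n => 2 * (y - z) j)
        ((2:ℝ) • (EuclideanSpace.proj j : (E n) →L[ℝ] ℝ)) x := by
      have := ((EuclideanSpace.proj (𝕜 := ℝ) j).hasFDerivAt.comp x
        ((hasFDerivAt_id x).sub_const z)).const_mul (2:ℝ)
      simpa using this
    have hh : HasFDerivAt (fun y => f1 (‖y - z‖ ^ 2) * (2 * (y - z) j)) _ x :=
      (h2.comp_hasFDerivAt x (hqd x)).mul hlin
    rw [hh.fderiv]
    simp [EuclideanSpace.inner_single_right, eq_comm]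
    split_ifs <;> ring
  simp only [Lop, p1, p2, mul_add, Finset.sum_add_distrib, mul_ite, mul_zero,
    Finset.sum_ite_eq, Finset.mem_univ, if_true, Finset.mul_sum]
  congr 2
  · congr 1
    · refine Finset.sum_congr rfl fun i _ => Finset.sum_congr rfl fun j _ => ?_
      ring
    · refine Finset.sum_congr rfl fun i _ => ?_
      ring
  · refine Finset.sum_congr rfl fun i _ => ?_
    ring

lemma aux_ball {n : ℕ} {Ω : Set (E n)} (hΩo : IsOpen Ω) {x z : E n} (hx : x ∈ Ω)
    (h : dist z x < infDist x (frontier Ω)) : z ∈ Ω := by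
  have hpre : IsPreconnected (ball x (infDist x (frontier Ω))) :=
    (convex_ball x _).isPreconnected
  have hpos : 0 < infDist x (frontier Ω) := dist_nonneg.trans_lt h
  have := hpre.subset_of_closure_inter_subset hΩo ⟨x, mem_ball_self hpos, hx⟩ ?_
  · exact this h
  · rintro y ⟨hy1, hy2⟩
    by_contra hy
    have hyf : y ∈ frontier Ω := by
      rw [hΩo.frontier_eq]
      exact ⟨hy1, hy⟩
    have := infDist_le_dist_of_mem (x := x) hyf
    rw [mem_ball, dist_comm] at hy2
    linarith

lemma aux_dpos {n : ℕ} {Ω : Set (E n)} (hΩo : IsOpen Ω) (hne : (frontier Ω).Nonempty)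
    {x : E n} (hx : x ∈ Ω) : 0 < infDist x (frontier Ω) := by
  refine (isClosed_frontier.notMem_iff_infDist_pos hne).1 fun h => ?_
  rw [hΩo.frontier_eq] at h
  exact h.2 hx

lemma aux_exmax {n : ℕ} {Ω : Set (E n)} (hΩo : IsOpen Ω) (hΩb : IsBounded Ω)
    {F : Set (E n)} (hF : IsClosed F) {w : (E n) → ℝ}
    (hw : ContinuousOn w Ω) {δ : ℝ} (hδ : 0 < δ)
    (h0 : ∀ x ∈ Ω, x ∈ F → infDist x (frontier Ω) < δ → w x ≤ 0)
    {x0 : E n} (hx0 : x0 ∈ Ω) (hx0F : x0 ∈ F) (hpos : 0 < w x0) :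
    ∃ x ∈ Ω, x ∈ F ∧ 0 < w x ∧ ∀ y ∈ Ω, y ∈ F → w y ≤ w x := by
  set S := closure Ω ∩ F ∩ {x | δ ≤ infDist x (frontier Ω)} with hS
  have hSΩ : S ⊆ Ω := by
    rintro y ⟨⟨hy1, -⟩, hy2⟩
    by_contra hy
    have hyf : y ∈ frontier Ω := by
      rw [hΩo.frontier_eq]
      exact ⟨hy1, hy⟩
    have h3 := infDist_zero_of_mem hyf
    simp only [mem_ofPred_eq] at hy2
    linarith
  have hSc : IsCompact S := by
    refine (hΩb.isCompact_closure.inter_right hF).inter_right ?_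
    exact isClosed_le continuous_const (continuous_infDist_pt _)
  have hmem : ∀ y ∈ Ω, y ∈ F → 0 < w y → y ∈ S := by
    intro y hy hyF hyw
    refine ⟨⟨subset_closure hy, hyF⟩, ?_⟩
    by_contra hlt
    simp only [mem_ofPred_eq, not_le] at hlt
    linarith [h0 y hy hyF hlt]
  obtain ⟨x, hxS, hx⟩ := hSc.exists_isMaxOn ⟨x0, hmem x0 hx0 hx0F hpos⟩ (hw.mono hSΩ)
  have hwx : 0 < w x := hpos.trans_le (hx (hmem x0 hx0 hx0F hpos))
  refine ⟨x, hSΩ hxS, hxS.1.2, hwx, fun y hy hyF => ?_⟩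
  by_cases hyw : 0 < w y
  · exact hx (hmem y hy hyF hyw)
  · linarith

lemma aux_coeff {n : ℕ} {a : (E n) → Fin n → Fin n → ℝ} {b : (E n) → Fin n → ℝ}
    {c : (E n) → ℝ} {K lam Lam : ℝ} (hco : CoeffsOK a b c K lam Lam) (x ξ : E n) :
    (n * lam ≤ ∑ i, a x i i) ∧ (∑ i, a x i i ≤ n * Lam) ∧
    (‖ξ‖ ^ 2 * (∑ i, a x i i) - (∑ i, ∑ j, a x i j * ξ i * ξ j) ≤ (n - 1) * Lam * ‖ξ‖ ^ 2) ∧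
    |∑ i, b x i * ξ i| ≤ √K * ‖ξ‖ := by
  obtain ⟨-, -, -, hs, hb, hc, hK, hlam, hle, hell⟩ := hco
  have hdiag : ∀ i, lam ≤ a x i i ∧ a x i i ≤ Lam := by
    intro i
    have := hell x (EuclideanSpace.single i 1)
    simpa [Pi.single_apply] using this
  have hn2 : ‖ξ‖ ^ 2 = ∑ i, ξ i * ξ i := by
    rw [EuclideanSpace.real_norm_sq_eq]
    exact Finset.sum_congr rfl fun i _ => by ring
  refine ⟨?_, ?_, ?_, ?_⟩
  · have := Finset.sum_le_sum fun i (_ : i ∈ Finset.univ) => (hdiag i).1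
    simpa using this
  · have := Finset.sum_le_sum fun i (_ : i ∈ Finset.univ) => (hdiag i).2
    simpa using this
  · have key := aux_trace (fun i j => Lam * (if i = j then 1 else 0) - a x i j) ?_ ?_
      (fun i j => ξ i * ξ j - ‖ξ‖ ^ 2 * (if i = j then 1 else 0)) ?_
    · have e : ∑ i, ∑ j, (Lam * (if i = j then 1 else 0) - a x i j) *
          (ξ i * ξ j - ‖ξ‖ ^ 2 * (if i = j then 1 else 0)) =
          Lam * (∑ i, ξ i * ξ i) - Lam * ‖ξ‖ ^ 2 * n - (∑ i, ∑ j, a x i j * ξ i * ξ j)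
          + ‖ξ‖ ^ 2 * ∑ i, a x i i := by
        have : ∀ i, ∑ j, (Lam * (if i = j then 1 else 0) - a x i j) *
          (ξ i * ξ j - ‖ξ‖ ^ 2 * (if i = j then 1 else 0)) =
          Lam * (ξ i * ξ i) - Lam * ‖ξ‖ ^ 2 - (∑ j, a x i j * ξ i * ξ j)
          + ‖ξ‖ ^ 2 * a x i i := by
          intro i
          have h1 : ∀ j, (Lam * (if i = j then 1 else 0) - a x i j) *
            (ξ i * ξ j - ‖ξ‖ ^ 2 * (if i = j then 1 else 0)) =
            (if i = j then Lam * (ξ i * ξ j) - Lam * ‖ξ‖ ^ 2 + ‖ξ‖ ^ 2 * a x i j else 0)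
             - a x i j * ξ i * ξ j := by
            intro j
            split_ifs <;> ring
          rw [Finset.sum_congr rfl fun j _ => h1 j, Finset.sum_sub_distrib, Finset.sum_ite_eq]
          simp
          ring
        rw [Finset.sum_congr rfl fun i _ => this i]
        simp only [Finset.sum_add_distrib, Finset.sum_sub_distrib, Finset.mul_sum]
        simp
        ring
      rw [e, ← hn2] at key
      linarith
    · intro i j
      simp only [hs x i j, eq_comm]
    · intro η
      have h1 := (hell x η).2
      have h2 : ‖η‖ ^ 2 = ∑ i, η i * η i := by
        rw [EuclideanSpace.real_norm_sq_eq]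
        exact Finset.sum_congr rfl fun i _ => by ring
      have : ∑ i, ∑ j, (Lam * (if i = j then 1 else 0) - a x i j) * η i * η j =
          Lam * ‖η‖ ^ 2 - ∑ i, ∑ j, a x i j * η i * η j := by
        rw [h2, Finset.mul_sum, ← Finset.sum_sub_distrib]
        refine Finset.sum_congr rfl fun i _ => ?_
        have h1 : ∀ j, (Lam * (if i = j then 1 else 0) - a x i j) * η i * η j =
            (if i = j then Lam * (η i * η j) else 0) - a x i j * η i * η j := by
          intro j
          split_ifs <;> ring
        rw [Finset.sum_congr rfl fun j _ => h1 j, Finset.sum_sub_distrib, Finset.sum_ite_eq]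
        simp
      rw [this]
      linarith
    · intro η
      have h2 : ‖η‖ ^ 2 = ∑ i, η i * η i := by
        rw [EuclideanSpace.real_norm_sq_eq]
        exact Finset.sum_congr rfl fun i _ => by ring
      have hcs := Finset.sum_mul_sq_le_sq_mul_sq Finset.univ (fun i => ξ i) (fun i => η i)
      have : ∑ i, ∑ j, (ξ i * ξ j - ‖ξ‖ ^ 2 * (if i = j then 1 else 0)) * η i * η j =
          (∑ i, ξ i * η i) ^ 2 - ‖ξ‖ ^ 2 * ‖η‖ ^ 2 := by
        rw [h2, Finset.mul_sum, sq (∑ i, ξ i * η i), Finset.sum_mul_sum,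
          ← Finset.sum_sub_distrib]
        refine Finset.sum_congr rfl fun i _ => ?_
        have h1 : ∀ j, (ξ i * ξ j - ‖ξ‖ ^ 2 * (if i = j then 1 else 0)) * η i * η j =
            ξ i * η i * (ξ j * η j) - (if i = j then ‖ξ‖ ^ 2 * (η i * η j) else 0) := by
          intro j
          split_ifs <;> ring
        rw [Finset.sum_congr rfl fun j _ => h1 j, Finset.sum_sub_distrib, Finset.sum_ite_eq]
        simp
      rw [this, EuclideanSpace.real_norm_sq_eq, EuclideanSpace.real_norm_sq_eq]
      linarith
  · have hcs := Finset.sum_mul_sq_le_sq_mul_sq Finset.univ (fun i => b x i) (fun i => ξ i)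
    rw [← EuclideanSpace.real_norm_sq_eq] at hcs
    refine abs_le_of_sq_le_sq ?_ (by positivity)
    rw [mul_pow, Real.sq_sqrt hK.le]
    exact hcs.trans (mul_le_mul_of_nonneg_right (hb x) (by positivity))

/-- The singular subsolution. -/
lemma aux_sub {n : ℕ} {a : (E n) → Fin n → Fin n → ℝ} {b : (E n) → Fin n → ℝ}
    {c : (E n) → ℝ} {K lam Lam : ℝ} (hco : CoeffsOK a b c K lam Lam)
    {p : ℝ} (hp : 1 < p) (hp2 : (p - 1) * ((Lam / lam) * (n - 1) - 1) < 2) :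
    ∃ A > 0, ∃ R0 > 0, ∀ R, 0 < R → R ≤ R0 → ∀ z x : E n, 0 < ‖x - z‖ → ‖x - z‖ < R →
      ContDiffAt ℝ 2 (fun y => A * ((‖y - z‖ ^ 2) ^ (-(1 / (p - 1))) -
        (R ^ 2) ^ (-(1 / (p - 1))))) x ∧
      (A * (‖x - z‖ ^ 2) ^ (-(1 / (p - 1)))) ^ p <
        Lop a b c (fun y => A * ((‖y - z‖ ^ 2) ^ (-(1 / (p - 1))) -
        (R ^ 2) ^ (-(1 / (p - 1))))) x := by
  have hp1 : 0 < p - 1 := by linarith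
  obtain ⟨β, hβ⟩ : ∃ β, β = 1 / (p - 1) := ⟨_, rfl⟩
  have hβpos : 0 < β := by rw [hβ]; positivity
  have hβp : β * (p - 1) = 1 := by rw [hβ]; field_simp
  simp only [← hβ]
  have hco' := hco
  obtain ⟨-, -, -, hs, hb, hc, hK, hlam, hle, hell⟩ := hco'
  obtain ⟨κ, hκ⟩ : ∃ κ, κ = (2 * β + 1) * lam - (n - 1) * Lam := ⟨_, rfl⟩
  have hκpos : 0 < κ := by
    have h1 : (Lam / lam) * (n - 1) - 1 < 2 * β := by
      have := mul_lt_mul_of_pos_left hp2 hβpos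
      rw [← mul_assoc, hβp] at this
      linarith
    have h2 : (Lam / lam) * (n - 1) * lam = (n - 1) * Lam := by field_simp
    have h3 := mul_lt_mul_of_pos_right h1 hlam
    rw [hκ]
    linarith
  have hsK : 0 ≤ √K := Real.sqrt_nonneg K
  obtain ⟨G, hG⟩ : ∃ G, G = 2 * β * √K + K := ⟨_, rfl⟩
  have hGpos : 0 < G := by rw [hG]; positivity
  obtain ⟨A, hA⟩ : ∃ A, A = (β * κ / 2) ^ (1 / (p - 1)) := ⟨_, rfl⟩
  have hApos : 0 < A := by rw [hA]; positivity
  have hAp : A ^ (p - 1) = β * κ / 2 := by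
    rw [hA, ← Real.rpow_mul (by positivity)]
    rw [one_div_mul_cancel hp1.ne', Real.rpow_one]
  refine ⟨A, hApos, min 1 (β * κ / G), by positivity, ?_⟩
  intro R hR hRR z x hx0 hxR
  have ht : 0 < ‖x - z‖ ^ 2 := by positivity
  have hder := aux_radial a b c z x (fun t => A * (t ^ (-β) - (R ^ 2) ^ (-β)))
    (fun t => A * (-β * t ^ (-β - 1))) (A * (-β * ((-β - 1) * (‖x - z‖ ^ 2) ^ (-β - 1 - 1))))
    ?_ ?_ ?_
  · refine ⟨hder.1, ?_⟩
    rw [hder.2]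
    clear hder
    obtain ⟨-, -, htr, hbb⟩ := aux_coeff hco x (x - z)
    have hq := (hell x (x - z)).1
    have hcx := hc x
    set r := ‖x - z‖ with hr
    set q := ∑ i, ∑ j, a x i j * (x - z) i * (x - z) j
    set tr := ∑ i, a x i i
    set bx := ∑ i, b x i * (x - z) i
    obtain ⟨T, hT⟩ : ∃ T, T = (r ^ 2) ^ (-β - 2) := ⟨_, rfl⟩
    have hTpos : 0 < T := by rw [hT]; positivity
    have e1 : (r ^ 2) ^ (-β - 1 - 1) = T := by
      rw [hT]; congr 1; ring
    have e2 : (r ^ 2) ^ (-β - 1) = T * r ^ 2 := by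
      rw [hT, ← Real.rpow_add_one ht.ne']; congr 1; ring
    have e3 : (r ^ 2) ^ (-β) = T * r ^ 2 * r ^ 2 := by
      rw [← e2, ← Real.rpow_add_one ht.ne']; congr 1; ring
    have e4 : (A * (r ^ 2) ^ (-β)) ^ p = β * κ / 2 * A * (T * r ^ 2) := by
      rw [Real.mul_rpow hApos.le (by positivity), ← Real.rpow_mul ht.le, ← e2, ← hAp,
        ← Real.rpow_add_one hApos.ne']
      congr 2
      · ring
      · linear_combination -hβp
    rw [e4, e1, e2, e3]
    have hr1 : r < 1 := hxR.trans_le (hRR.trans (min_le_left _ _))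
    have hr2 : G * r < β * κ := by
      have : r < β * κ / G := hxR.trans_le (hRR.trans (min_le_right _ _))
      rw [lt_div_iff₀ hGpos] at this
      linarith
    have hRp : 0 ≤ c x * (A * (R ^ 2) ^ (-β)) :=
      mul_nonneg hcx.1 (by positivity)
    -- main estimate
    have m1 : 2 * β * (κ * r ^ 2) ≤ 2 * β * ((2 * β + 2) * q - r ^ 2 * tr) := by
      refine mul_le_mul_of_nonneg_left ?_ (by positivity)
      have := mul_le_mul_of_nonneg_left hq (by positivity : 0 ≤ 2 * β + 1)
      rw [hκ]
      linarith
    have m2 : 2 * β * bx * r ^ 2 ≤ 2 * β * (√K * r) * r ^ 2 := by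
      have := (abs_le.1 hbb).2
      gcongr
    have m3 : c x * r ^ 2 * r ^ 2 ≤ K * r * r ^ 2 := by
      have : c x * r ^ 2 ≤ K * r := by
        refine mul_le_mul hcx.2 ?_ (by positivity) hK.le
        nlinarith
      gcongr
    have m4 : G * r * r ^ 2 < β * κ * r ^ 2 := mul_lt_mul_of_pos_right hr2 ht
    have m5 : β * κ / 2 * r ^ 2 < 2 * β * ((2 * β + 2) * q - r ^ 2 * tr)
        - 2 * β * bx * r ^ 2 - c x * r ^ 2 * r ^ 2 := by
      rw [hG] at m4
      have : 0 < β * κ * r ^ 2 := by positivity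
      linarith
    have m6 := mul_lt_mul_of_pos_left m5 (mul_pos hApos hTpos)
    have h7 : c x * (A * (T * r ^ 2 * r ^ 2 - (R ^ 2) ^ (-β))) =
      c x * A * T * r ^ 2 * r ^ 2 - c x * (A * (R ^ 2) ^ (-β)) := by ring
    rw [h7]
    linarith
  · exact contDiffAt_const.mul ((Real.contDiffAt_rpow_const_of_ne ht.ne').sub contDiffAt_const)
  · filter_upwards [lt_mem_nhds ht] with t ht
    exact ((Real.hasDerivAt_rpow_const (Or.inl ht.ne')).sub_const _).const_mul A
  · exact ((Real.hasDerivAt_rpow_const (Or.inl ht.ne')).const_mul (-β)).const_mul A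

/-- The Keller-Osserman supersolution in a ball. -/
lemma aux_super {n : ℕ} {a : (E n) → Fin n → Fin n → ℝ} {b : (E n) → Fin n → ℝ}
    {c : (E n) → ℝ} {K lam Lam : ℝ} (hco : CoeffsOK a b c K lam Lam)
    {p : ℝ} (hp : 1 < p) :
    ∃ C > 0, ∀ ρ, 0 < ρ → ρ ≤ 1 → ∀ z x : E n, ‖x - z‖ < ρ →
      ContDiffAt ℝ 2 (fun y => C * ρ ^ (2 / (p - 1)) *
        (ρ ^ 2 - ‖y - z‖ ^ 2) ^ (-(2 / (p - 1)))) x ∧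
      Lop a b c (fun y => C * ρ ^ (2 / (p - 1)) *
        (ρ ^ 2 - ‖y - z‖ ^ 2) ^ (-(2 / (p - 1)))) x <
      (C * ρ ^ (2 / (p - 1)) * (ρ ^ 2 - ‖x - z‖ ^ 2) ^ (-(2 / (p - 1)))) ^ p := by
  have hp1 : 0 < p - 1 := by linarith
  obtain ⟨α, hα⟩ : ∃ α, α = 2 / (p - 1) := ⟨_, rfl⟩
  have hαpos : 0 < α := by rw [hα]; positivity
  have hαp : α * (p - 1) = 2 := by rw [hα]; field_simp
  simp only [← hα]
  have hco' := hco
  obtain ⟨-, -, -, hs, hb, hc, hK, hlam, hle, hell⟩ := hco'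
  have hLam : 0 < Lam := hlam.trans_le hle
  have hsK : 0 ≤ √K := Real.sqrt_nonneg K
  obtain ⟨G, hG⟩ : ∃ G, G = 4 * α * (α + 1) * Lam + 2 * α * (n * Lam) + 2 * α * √K :=
    ⟨_, rfl⟩
  have hGpos : 0 < G := by rw [hG]; positivity
  obtain ⟨C, hC⟩ : ∃ C, C = (G + 1) ^ (1 / (p - 1)) := ⟨_, rfl⟩
  have hCpos : 0 < C := by rw [hC]; positivity
  have hCp : C ^ (p - 1) = G + 1 := by
    rw [hC, ← Real.rpow_mul (by positivity)]
    rw [one_div_mul_cancel hp1.ne', Real.rpow_one]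
  refine ⟨C, hCpos, ?_⟩
  intro ρ hρ hρ1 z x hx
  obtain ⟨M, hM⟩ : ∃ M, M = C * ρ ^ α := ⟨_, rfl⟩
  have hMpos : 0 < M := by rw [hM]; positivity
  have hs0 : 0 < ρ ^ 2 - ‖x - z‖ ^ 2 := by
    have := norm_nonneg (x - z)
    nlinarith
  have hder := aux_radial a b c z x (fun t => C * ρ ^ α * (ρ ^ 2 - t) ^ (-α))
    (fun t => C * ρ ^ α * (-1 * (-α) * (ρ ^ 2 - t) ^ (-α - 1)))
    (C * ρ ^ α * (-1 * (-α) * (-1 * (-α - 1) * (ρ ^ 2 - ‖x - z‖ ^ 2) ^ (-α - 1 - 1))))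
    ?_ ?_ ?_
  · refine ⟨hder.1, ?_⟩
    rw [hder.2]
    clear hder
    obtain ⟨-, htr, -, hbb⟩ := aux_coeff hco x (x - z)
    have hq := (hell x (x - z)).2
    have hcx := hc x
    have hr0 : 0 ≤ ‖x - z‖ := norm_nonneg _
    set r := ‖x - z‖ with hr
    set q := ∑ i, ∑ j, a x i j * (x - z) i * (x - z) j
    set tr := ∑ i, a x i i
    set bx := ∑ i, b x i * (x - z) i
    obtain ⟨s, hs⟩ : ∃ s, s = ρ ^ 2 - r ^ 2 := ⟨_, rfl⟩
    rw [← hs] at hs0 ⊢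
    obtain ⟨S, hS⟩ : ∃ S, S = s ^ (-α - 2) := ⟨_, rfl⟩
    have hSpos : 0 < S := by rw [hS]; positivity
    have e1 : s ^ (-α - 1 - 1) = S := by
      rw [hS]; congr 1; ring
    have e2 : s ^ (-α - 1) = S * s := by
      rw [hS, ← Real.rpow_add_one hs0.ne']; congr 1; ring
    have e4 : (C * ρ ^ α * s ^ (-α)) ^ p = (G + 1) * M * ρ ^ 2 * S := by
      have f1 : (ρ ^ α) ^ p = ρ ^ α * ρ ^ 2 := by
        rw [← Real.rpow_mul hρ.le, ← Real.rpow_natCast ρ 2, ← Real.rpow_add hρ]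
        congr 1
        push_cast
        linear_combination hαp
      have f2 : (s ^ (-α)) ^ p = S := by
        rw [← Real.rpow_mul hs0.le, hS]
        congr 1
        linear_combination -hαp
      have f3 : C ^ p = (G + 1) * C := by
        rw [← hCp, ← Real.rpow_add_one hCpos.ne']
        congr 1
        ring
      rw [Real.mul_rpow (by positivity) (by positivity),
        Real.mul_rpow (by positivity) (by positivity), f1, f2, f3, hM]
      ring
    rw [e4, e1, e2, ← hM]
    have hsρ : s ≤ ρ ^ 2 := by rw [hs]; nlinarith
    have hcp : 0 ≤ c x * (M * s ^ (-α)) := mul_nonneg hcx.1 (by positivity)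
    have m1 : 4 * α * (α + 1) * q ≤ 4 * α * (α + 1) * Lam * ρ ^ 2 := by
      have : q ≤ Lam * ρ ^ 2 := hq.trans (by gcongr)
      calc _ ≤ 4 * α * (α + 1) * (Lam * ρ ^ 2) := by gcongr
        _ = _ := by ring
    have m2 : 2 * α * s * tr ≤ 2 * α * (n * Lam) * ρ ^ 2 := by
      calc _ ≤ 2 * α * s * (n * Lam) := by gcongr
        _ ≤ 2 * α * ρ ^ 2 * (n * Lam) := by gcongr
        _ = _ := by ring
    have m3 : 2 * α * s * bx ≤ 2 * α * √K * ρ ^ 2 := by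
      have : bx ≤ √K := by
        refine (abs_le.1 hbb).2.trans ?_
        nlinarith
      calc _ ≤ 2 * α * s * √K := by gcongr
        _ ≤ 2 * α * ρ ^ 2 * √K := by gcongr
        _ = _ := by ring
    have m4 : 4 * α * (α + 1) * q + 2 * α * s * tr + 2 * α * s * bx < (G + 1) * ρ ^ 2 := by
      rw [hG]
      have : 0 < ρ ^ 2 := by positivity
      linarith
    have m5 := mul_lt_mul_of_pos_left m4 (mul_pos hMpos hSpos)
    linarith
  · refine contDiffAt_const.mul ?_
    exact (contDiffAt_const.sub contDiffAt_id).rpow_const_of_ne hs0.ne'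
  · have : ∀ᶠ t in nhds (‖x - z‖ ^ 2), t < ρ ^ 2 := gt_mem_nhds (by linarith)
    filter_upwards [this] with t ht
    have h := ((hasDerivAt_id t).const_sub (ρ ^ 2)).rpow_const (p := -α)
      (Or.inl (by simp; linarith))
    exact h.const_mul _
  · have h := ((hasDerivAt_id (‖x - z‖ ^ 2)).const_sub (ρ ^ 2)).rpow_const (p := -α - 1)
      (Or.inl hs0.ne')
    exact (h.const_mul (-1 * -α)).const_mul _

lemma aux_lower {n : ℕ} {Ω : Set (E n)}
    (hΩo : IsOpen Ω) (hΩb : IsBounded Ω) (hne : (frontier Ω).Nonempty) (hΩne : Ω.Nonempty)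
    (hfr : frontier Ω = frontier (closure Ω))
    {a : (E n) → Fin n → Fin n → ℝ} {b : (E n) → Fin n → ℝ}
    {c : (E n) → ℝ} {K lam Lam : ℝ} (hco : CoeffsOK a b c K lam Lam)
    {p : ℝ} (hp : 1 < p) (hp2 : (p - 1) * ((Lam / lam) * (n - 1) - 1) < 2)
    {u : (E n) → ℝ} (hu : ContDiffOn ℝ 2 u Ω)
    (hequ : ∀ x ∈ Ω, Lop a b c u x = (max (u x) 0) ^ p) (hbu : BlowsUp Ω u) :
    ∃ A > 0, ∃ δ > 0, ∀ x ∈ Ω, infDist x (frontier Ω) < δ →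
      A * (infDist x (frontier Ω)) ^ (-(2 / (p - 1))) ≤ u x := by
  obtain ⟨A, hA, R0, hR0, hsub⟩ := aux_sub hco hp hp2
  have hp1 : 0 < p - 1 := by linarith
  obtain ⟨β, hβ⟩ : ∃ β, β = 1 / (p - 1) := ⟨_, rfl⟩
  have hβpos : 0 < β := by rw [hβ]; positivity
  have hα : 2 / (p - 1) = 2 * β := by rw [hβ]; ring
  simp only [← hβ] at hsub
  rw [hα]
  obtain ⟨δ0, hδ0, hu0⟩ := hbu 0
  obtain ⟨R, hRdef⟩ : ∃ R, R = min R0 (δ0 / 2) := ⟨_, rfl⟩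
  have hR : 0 < R := by rw [hRdef]; positivity
  have hRR0 : R ≤ R0 := by rw [hRdef]; exact min_le_left _ _
  have hRδ : R < δ0 := by
    have : R ≤ δ0 / 2 := by rw [hRdef]; exact min_le_right _ _
    linarith
  have claim : ∀ z ∉ closure Ω, ∀ x ∈ Ω, ‖x - z‖ < R →
      A * ((‖x - z‖ ^ 2) ^ (-β) - (R ^ 2) ^ (-β)) ≤ u x := by
    intro z hz x hx hxR
    by_contra hlt
    push Not at hlt
    have hz' : z ∉ Ω := fun h => hz (subset_closure h)
    have hη : 0 < infDist z (closure Ω) :=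
      (isClosed_closure.notMem_iff_infDist_pos hΩne.closure).1 hz
    set η := infDist z (closure Ω)
    have hηle : ∀ y ∈ Ω, η ≤ ‖y - z‖ := by
      intro y hy
      rw [← dist_eq_norm, dist_comm]
      exact infDist_le_dist_of_mem (subset_closure hy)
    obtain ⟨δ1, hδ1, hu1⟩ := hbu (A * ((η ^ 2) ^ (-β)))
    set φ : (E n) → ℝ := fun y => A * ((‖y - z‖ ^ 2) ^ (-β) - (R ^ 2) ^ (-β)) with hφ
    have hφle : ∀ y, φ y ≤ A * ((‖y - z‖ ^ 2) ^ (-β)) := by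
      intro y
      refine mul_le_mul_of_nonneg_left ?_ hA.le
      have : 0 < (R ^ 2) ^ (-β) := by positivity
      linarith
    have hcont : ContinuousOn (fun y => φ y - 1 * u y) Ω := by
      refine ContinuousOn.sub ?_ (continuousOn_const.mul hu.continuousOn)
      refine continuousOn_const.mul (ContinuousOn.sub ?_ continuousOn_const)
      refine ContinuousOn.rpow_const (by fun_prop) ?_
      intro y hy
      have := hη.trans_le (hηle y hy)
      left
      positivity
    obtain ⟨x1, hx1, hx1F, hpos, hmax⟩ := aux_exmax hΩo hΩb (isClosed_closedBall (x := z) (ε := R))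
      hcont hδ1 (fun y hy _ hyd => by
        have h1 := hu1 y hy hyd
        have h2 := hφle y
        have h3 : (‖y - z‖ ^ 2) ^ (-β) ≤ (η ^ 2) ^ (-β) := by
          refine Real.rpow_le_rpow_of_nonpos (by positivity) ?_ (by linarith)
          exact pow_le_pow_left₀ hη.le (hηle y hy) 2
        have h4 := mul_le_mul_of_nonneg_left h3 hA.le
        linarith) hx (by rw [mem_closedBall, dist_eq_norm]; exact hxR.le)
        (by simp only [hφ]; linarith)
    rw [mem_closedBall, dist_eq_norm] at hx1F
    have hd1 : infDist x1 (frontier Ω) ≤ ‖x1 - z‖ := by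
      by_contra hcon
      push Not at hcon
      rw [← dist_eq_norm, dist_comm] at hcon
      exact hz' (aux_ball hΩo hx1 hcon)
    have hux1 : 0 ≤ u x1 := hu0 x1 hx1 (by linarith)
    have hlt1 : ‖x1 - z‖ < R := by
      refine lt_of_le_of_ne hx1F fun heq => ?_
      have : φ x1 = 0 := by simp [hφ, heq]
      rw [this] at hpos
      linarith
    have hr1 : 0 < ‖x1 - z‖ := hη.trans_le (hηle x1 hx1)
    obtain ⟨hC, hL⟩ := hsub R hR hRR0 z x1 hr1 hlt1
    have huC : ContDiffAt ℝ 2 u x1 := hu.contDiffAt (hΩo.mem_nhds hx1)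
    have hloc : IsLocalMax (fun y => φ y - 1 * u y) x1 := by
      have hb : ball z R ∈ nhds x1 := isOpen_ball.mem_nhds (by
        rw [mem_ball, dist_eq_norm]; exact hlt1)
      filter_upwards [hΩo.mem_nhds hx1, hb] with y h1 h2
      exact hmax y h1 (ball_subset_closedBall h2)
    have hmp := aux_maxprin hco (hC.sub (contDiffAt_const.mul huC)) hloc hpos.le
    rw [aux_lin hC huC 1, hequ x1 hx1, max_eq_left hux1] at hmp
    have h5 : u x1 ^ p ≤ (A * (‖x1 - z‖ ^ 2) ^ (-β)) ^ p := by
      refine Real.rpow_le_rpow hux1 ?_ (by linarith)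
      have := hφle x1
      linarith
    linarith
  have hcpos : 0 < (4:ℝ) ^ (-β) - 16 ^ (-β) := by
    have := Real.rpow_lt_rpow_of_neg (x := 4) (y := 16) (z := -β) (by norm_num) (by norm_num)
      (by linarith)
    linarith
  refine ⟨A * ((4:ℝ) ^ (-β) - 16 ^ (-β)), by positivity, R / 4, by positivity, ?_⟩
  intro x hx hxd
  have hd := aux_dpos hΩo hne hx
  set d := infDist x (frontier Ω) with hddef
  obtain ⟨y, hy, hyd⟩ := (infDist_lt_iff hne).1 (show infDist x (frontier Ω) < 2 * d by linarith)
  have hy2 : y ∈ closure (closure Ω)ᶜ := by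
    rw [hfr] at hy
    rw [closure_compl]
    exact hy.2
  obtain ⟨z, hz1, hz2⟩ := mem_closure_iff.1 hy2 (ball x (2 * d)) isOpen_ball (by
    rw [mem_ball, dist_comm]; exact hyd)
  rw [mem_ball, dist_comm, dist_eq_norm] at hz1
  refine le_trans ?_ (claim z hz2 x hx (by linarith))
  have hzpos : 0 < ‖x - z‖ := by
    rw [norm_pos_iff, sub_ne_zero]
    rintro rfl
    exact hz2 (subset_closure hx)
  have e : ∀ s : ℝ, 0 ≤ s → (s * d ^ 2) ^ (-β) = s ^ (-β) * d ^ (-(2 * β)) := by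
    intro s hs
    rw [Real.mul_rpow hs (by positivity), ← Real.rpow_natCast d 2, ← Real.rpow_mul hd.le]
    congr 2
    push_cast
    ring
  have h1 : (4 * d ^ 2) ^ (-β) ≤ (‖x - z‖ ^ 2) ^ (-β) := by
    refine Real.rpow_le_rpow_of_nonpos (by positivity) ?_ (by linarith)
    nlinarith
  have h2 : (R ^ 2) ^ (-β) ≤ (16 * d ^ 2) ^ (-β) := by
    refine Real.rpow_le_rpow_of_nonpos (by positivity) ?_ (by linarith)
    nlinarith
  rw [e 4 (by norm_num)] at h1
  rw [e 16 (by norm_num)] at h2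
  rw [mul_assoc]
  refine mul_le_mul_of_nonneg_left ?_ hA.le
  linarith

lemma aux_upper {n : ℕ} {Ω : Set (E n)}
    (hΩo : IsOpen Ω) (hne : (frontier Ω).Nonempty)
    {a : (E n) → Fin n → Fin n → ℝ} {b : (E n) → Fin n → ℝ}
    {c : (E n) → ℝ} {K lam Lam : ℝ} (hco : CoeffsOK a b c K lam Lam)
    {p : ℝ} (hp : 1 < p)
    {u : (E n) → ℝ} (hu : ContDiffOn ℝ 2 u Ω)
    (hequ : ∀ x ∈ Ω, Lop a b c u x = (max (u x) 0) ^ p) :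
    ∃ C > 0, ∀ x ∈ Ω, infDist x (frontier Ω) ≤ 1 →
      u x ≤ C * (infDist x (frontier Ω)) ^ (-(2 / (p - 1))) := by
  obtain ⟨C, hC, hsup⟩ := aux_super hco hp
  have hp1 : 0 < p - 1 := by linarith
  obtain ⟨α, hα⟩ : ∃ α, α = 2 / (p - 1) := ⟨_, rfl⟩
  have hαpos : 0 < α := by rw [hα]; positivity
  simp only [← hα] at hsup ⊢
  refine ⟨C * 2 ^ α, by positivity, ?_⟩
  intro x hx hd1
  have hd := aux_dpos hΩo hne hx
  set d := infDist x (frontier Ω) with hddef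
  obtain ⟨ρ, hρ⟩ : ∃ ρ, ρ = d / 2 := ⟨_, rfl⟩
  have hρpos : 0 < ρ := by rw [hρ]; positivity
  have hρ1 : ρ ≤ 1 := by linarith
  have hval : C * 2 ^ α * d ^ (-α) = C * ρ ^ α * (ρ ^ 2 - ‖x - x‖ ^ 2) ^ (-α) := by
    have hd2 : d = 2 * ρ := by linarith
    have e1 : (ρ ^ 2) ^ (-α) = ρ ^ (-α) * ρ ^ (-α) := by
      rw [sq, Real.mul_rpow hρpos.le hρpos.le]
    have e2 : ρ ^ α * ρ ^ (-α) = 1 := by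
      rw [← Real.rpow_add hρpos]; simp
    have e3 : (2:ℝ) ^ α * 2 ^ (-α) = 1 := by
      rw [← Real.rpow_add (by norm_num)]; simp
    rw [hd2, Real.mul_rpow (by norm_num) hρpos.le]
    simp only [sub_self, norm_zero]
    rw [show ρ ^ 2 - (0:ℝ) ^ 2 = ρ ^ 2 by ring, e1]
    linear_combination C * ρ ^ (-α) * e3 - C * ρ ^ (-α) * e2
  rw [hval]
  by_contra hlt
  push Not at hlt
  have hball : closedBall x ρ ⊆ Ω := by
    intro y hy
    refine aux_ball hΩo hx ?_
    rw [mem_closedBall] at hy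
    linarith
  obtain ⟨N, hN⟩ := (isCompact_closedBall x ρ).bddAbove_image (hu.continuousOn.mono hball)
  have hN' : ∀ y, ‖y - x‖ ≤ ρ → u y ≤ N := fun y hy =>
    hN ⟨y, by rw [mem_closedBall, dist_eq_norm]; exact hy, rfl⟩
  -- choose the inner radius
  obtain ⟨s, hs0, hsρ, hsN⟩ : ∃ s, 0 < s ∧ s < ρ ^ 2 ∧ N ≤ C * ρ ^ α * s ^ (-α) := by
    have hN1 : 0 < |N| + 1 := by positivity
    have hM : 0 < C * ρ ^ α := by positivity
    obtain ⟨s1, hs1⟩ : ∃ s1, s1 = ((|N| + 1) / (C * ρ ^ α)) ^ (-(1 / α)) := ⟨_, rfl⟩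
    have hs1pos : 0 < s1 := by rw [hs1]; positivity
    have hs1α : s1 ^ (-α) = (|N| + 1) / (C * ρ ^ α) := by
      rw [hs1, ← Real.rpow_mul (by positivity)]
      rw [show -(1 / α) * -α = 1 by field_simp, Real.rpow_one]
    refine ⟨min s1 (ρ ^ 2 / 2), by positivity, ?_, ?_⟩
    · have := min_le_right s1 (ρ ^ 2 / 2)
      have : 0 < ρ ^ 2 := by positivity
      linarith
    · have h1 : s1 ^ (-α) ≤ (min s1 (ρ ^ 2 / 2)) ^ (-α) :=
        Real.rpow_le_rpow_of_nonpos (by positivity) (min_le_left _ _) (by linarith)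
      have h2 := mul_le_mul_of_nonneg_left h1 hM.le
      rw [hs1α, mul_div_cancel₀ _ hM.ne'] at h2
      have := le_abs_self N
      linarith
  set ψ : (E n) → ℝ := fun y => C * ρ ^ α * (ρ ^ 2 - ‖y - x‖ ^ 2) ^ (-α) with hψ
  set S : Set (E n) := {y | ‖y - x‖ ^ 2 ≤ ρ ^ 2 - s} with hS
  have hSlt : ∀ y ∈ S, ‖y - x‖ < ρ := by
    intro y hy
    have : ‖y - x‖ ^ 2 ≤ ρ ^ 2 - s := hy
    exact lt_of_pow_lt_pow_left₀ 2 hρpos.le (by linarith)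
  have hSsub : S ⊆ closedBall x ρ := by
    intro y hy
    rw [mem_closedBall, dist_eq_norm]
    exact (hSlt y hy).le
  have hScl : IsClosed S := isClosed_le (by fun_prop) continuous_const
  have hSc : IsCompact S := (isCompact_closedBall x ρ).of_isClosed_subset hScl hSsub
  have hxS : x ∈ S := by
    change ‖x - x‖ ^ 2 ≤ ρ ^ 2 - s
    simp
    linarith
  have hcont : ContinuousOn (fun y => u y - 1 * ψ y) S := by
    refine (hu.continuousOn.mono (hSsub.trans hball)).sub (continuousOn_const.mul ?_)
    intro y hy
    exact (hsup ρ hρpos hρ1 x y (hSlt y hy)).1.continuousAt.continuousWithinAt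
  obtain ⟨x1, hx1, hmax⟩ := hSc.exists_isMaxOn ⟨x, hxS⟩ hcont
  have hpos : 0 < u x1 - 1 * ψ x1 := by
    have h1 : u x - 1 * ψ x ≤ u x1 - 1 * ψ x1 := hmax hxS
    have h2 : ψ x < u x := hlt
    linarith
  have hx1' : ‖x1 - x‖ ^ 2 ≤ ρ ^ 2 - s := hx1
  have hx1lt : ‖x1 - x‖ ^ 2 < ρ ^ 2 - s := by
    refine lt_of_le_of_ne hx1' fun heq => ?_
    have h1 : ψ x1 = C * ρ ^ α * s ^ (-α) := by
      simp only [hψ, heq]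
      congr 2
      ring
    have := hN' x1 (hSlt x1 hx1).le
    linarith
  have hx1Ω : x1 ∈ Ω := hball (hSsub hx1)
  obtain ⟨hCψ, hLψ⟩ := hsup ρ hρpos hρ1 x x1 (hSlt x1 hx1)
  have huC : ContDiffAt ℝ 2 u x1 := hu.contDiffAt (hΩo.mem_nhds hx1Ω)
  have hloc : IsLocalMax (fun y => u y - 1 * ψ y) x1 := by
    have hop : IsOpen {y : E n | ‖y - x‖ ^ 2 < ρ ^ 2 - s} :=
      isOpen_lt (by fun_prop) continuous_const
    filter_upwards [hop.mem_nhds hx1lt] with y hy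
    exact hmax (show ‖y - x‖ ^ 2 ≤ ρ ^ 2 - s from le_of_lt hy)
  have hmp := aux_maxprin hco (huC.sub (contDiffAt_const.mul hCψ)) hloc hpos.le
  rw [aux_lin huC hCψ 1, hequ x1 hx1Ω] at hmp
  have hψpos : 0 ≤ ψ x1 := by
    have : 0 < ρ ^ 2 - ‖x1 - x‖ ^ 2 := by linarith
    simp only [hψ]
    positivity
  have h5 : ψ x1 ^ p ≤ (max (u x1) 0) ^ p := by
    refine Real.rpow_le_rpow hψpos ?_ (by linarith)
    exact le_trans (by linarith) (le_max_left _ _)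
  have h6 : Lop a b c ψ x1 < ψ x1 ^ p := hLψ
  linarith

lemma aux_step {n : ℕ} {Ω : Set (E n)}
    (hΩo : IsOpen Ω) (hne : (frontier Ω).Nonempty)
    {a : (E n) → Fin n → Fin n → ℝ} {b : (E n) → Fin n → ℝ}
    {c : (E n) → ℝ} {K lam Lam : ℝ} (hco : CoeffsOK a b c K lam Lam) (hn : 2 ≤ n)
    {p : ℝ} (hp : 1 < p)
    {u v : (E n) → ℝ} (hu : ContDiffOn ℝ 2 u Ω) (hv : ContDiffOn ℝ 2 v Ω)
    (hequ : ∀ x ∈ Ω, Lop a b c u x = (max (u x) 0) ^ p)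
    (heqv : ∀ x ∈ Ω, Lop a b c v x = (max (v x) 0) ^ p)
    {A : ℝ} (hA : 0 < A) {δ1 : ℝ} (hδ1 : 0 < δ1)
    (hlow : ∀ x ∈ Ω, infDist x (frontier Ω) < δ1 →
      A * (infDist x (frontier Ω)) ^ (-(2 / (p - 1))) ≤ v x)
    {C : ℝ} (hC : 0 < C)
    (hupp : ∀ x ∈ Ω, infDist x (frontier Ω) ≤ 1 →
      v x ≤ C * (infDist x (frontier Ω)) ^ (-(2 / (p - 1))))
    {k0 : ℝ} (hk0 : 1 < k0) :
    ∃ η > 0, ∀ k, k0 ≤ k →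
      (∃ δ > 0, ∀ x ∈ Ω, infDist x (frontier Ω) < δ → u x ≤ (k + η) * v x) →
      ∃ δ > 0, ∀ x ∈ Ω, infDist x (frontier Ω) < δ → u x ≤ k * v x := by
  have hp1 : 0 < p - 1 := by linarith
  obtain ⟨α, hα⟩ : ∃ α, α = 2 / (p - 1) := ⟨_, rfl⟩
  have hαpos : 0 < α := by rw [hα]; positivity
  have hαp : α * (p - 1) = 2 := by rw [hα]; field_simp
  simp only [← hα] at hlow hupp
  have hco' := hco
  obtain ⟨-, -, -, hs, hb, hc, hK, hlam, hle, hell⟩ := hco'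
  have hLam : 0 < Lam := hlam.trans_le hle
  have hn0 : (0:ℝ) < n := by
    have : 0 < n := by omega
    exact_mod_cast this
  obtain ⟨G, hG⟩ : ∃ G, G = 2 * (n * Lam) + 2 * √K := ⟨_, rfl⟩
  have hGpos : 0 < G := by rw [hG]; positivity
  have hk0p : 0 < k0 * (k0 ^ (p - 1) - 1) := by
    have : 1 < k0 ^ (p - 1) := Real.one_lt_rpow hk0 hp1
    have : 0 < k0 ^ (p - 1) - 1 := by linarith
    positivity
  obtain ⟨e0, he0⟩ : ∃ e0, e0 = k0 * (k0 ^ (p - 1) - 1) * (A ^ p * 3 ^ (-(α + 2))) := ⟨_, rfl⟩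
  have he0pos : 0 < e0 := by rw [he0]; positivity
  refine ⟨e0 / (2 * G) / C, by positivity, ?_⟩
  rintro k hk ⟨δ, hδ, hP⟩
  obtain ⟨D, hD⟩ : ∃ D, D = min δ (min δ1 1) := ⟨_, rfl⟩
  have hDpos : 0 < D := by rw [hD]; positivity
  have hDδ : D ≤ δ := by rw [hD]; exact min_le_left _ _
  have hDδ1 : D ≤ δ1 := by rw [hD]; exact (min_le_right _ _).trans (min_le_left _ _)
  have hD1 : D ≤ 1 := by rw [hD]; exact (min_le_right _ _).trans (min_le_right _ _)
  refine ⟨D * (2 / 3), by positivity, ?_⟩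
  intro x hx hxd
  by_contra hlt
  push Not at hlt
  have hd := aux_dpos hΩo hne hx
  obtain ⟨r, hr⟩ : ∃ r, r = infDist x (frontier Ω) / 2 := ⟨_, rfl⟩
  have hrpos : 0 < r := by rw [hr]; positivity
  have hdr : infDist x (frontier Ω) = 2 * r := by linarith
  have hr1 : r ≤ 1 := by linarith
  have hball : closedBall x r ⊆ Ω := by
    intro y hy
    refine aux_ball hΩo hx ?_
    rw [mem_closedBall] at hy
    linarith
  have hdl : ∀ y ∈ closedBall x r, r ≤ infDist y (frontier Ω) := by
    intro y hy
    rw [mem_closedBall, dist_comm] at hy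
    have := infDist_le_infDist_add_dist (x := x) (y := y) (s := frontier Ω)
    linarith
  have hdu : ∀ y ∈ closedBall x r, infDist y (frontier Ω) ≤ 3 * r := by
    intro y hy
    rw [mem_closedBall] at hy
    have := infDist_le_infDist_add_dist (x := y) (y := x) (s := frontier Ω)
    linarith
  have h3r : 3 * r < D := by linarith
  obtain ⟨m, hm⟩ : ∃ m, m = e0 / (2 * G) * r ^ (-(α + 2)) := ⟨_, rfl⟩
  have hmpos : 0 < m := by rw [hm]; positivity
  have hcont : ContinuousOn (fun y => (u y - k * v y) - m * (‖y - x‖ ^ 2)) (closedBall x r) := by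
    refine ContinuousOn.sub ?_ (by fun_prop)
    exact (hu.continuousOn.mono hball).sub (continuousOn_const.mul (hv.continuousOn.mono hball))
  have hxB : x ∈ closedBall x r := mem_closedBall_self hrpos.le
  obtain ⟨x1, hx1, hmax⟩ := (isCompact_closedBall x r).exists_isMaxOn ⟨x, hxB⟩ hcont
  have hx1Ω := hball hx1
  have hpos : 0 < (u x1 - k * v x1) - m * (‖x1 - x‖ ^ 2) := by
    have h1 : (u x - k * v x) - m * (‖x - x‖ ^ 2) ≤ (u x1 - k * v x1) - m * (‖x1 - x‖ ^ 2) :=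
      hmax hxB
    simp at h1
    linarith
  have hdx1 := hdl x1 hx1
  have hdx1' := hdu x1 hx1
  have hd1pos : 0 < infDist x1 (frontier Ω) := by linarith
  have hvlow := hlow x1 hx1Ω (by linarith)
  have hvupp := hupp x1 hx1Ω (by linarith)
  have hx1r : ‖x1 - x‖ ≤ r := by rwa [mem_closedBall, dist_eq_norm] at hx1
  rcases hx1r.lt_or_eq with hin | hbd
  · -- interior maximum
    have huC : ContDiffAt ℝ 2 u x1 := hu.contDiffAt (hΩo.mem_nhds hx1Ω)
    have hvC : ContDiffAt ℝ 2 v x1 := hv.contDiffAt (hΩo.mem_nhds hx1Ω)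
    have hloc : IsLocalMax (fun y => (u y - k * v y) - m * (‖y - x‖ ^ 2)) x1 := by
      have hb : ball x r ∈ nhds x1 := isOpen_ball.mem_nhds (by
        rw [mem_ball, dist_eq_norm]; exact hin)
      filter_upwards [hb] with y h2
      exact hmax (ball_subset_closedBall h2)
    obtain ⟨hqC, hqL⟩ := aux_radial a b c x x1 (fun t => t) (fun _ => 1) 0 contDiffAt_id
      (Filter.Eventually.of_forall fun t => hasDerivAt_id t) (hasDerivAt_const _ _)
    have huvC : ContDiffAt ℝ 2 (fun y => u y - k * v y) x1 := huC.sub (contDiffAt_const.mul hvC)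
    have hmp := aux_maxprin hco (huvC.sub (contDiffAt_const.mul hqC)) hloc hpos.le
    rw [aux_lin huvC hqC m, aux_lin huC hvC k, hequ x1 hx1Ω, heqv x1 hx1Ω, hqL] at hmp
    obtain ⟨-, htr, -, hbb⟩ := aux_coeff hco x1 (x1 - x)
    have hqle : 4 * 0 * (∑ i, ∑ j, a x1 i j * (x1 - x) i * (x1 - x) j)
        + 2 * 1 * (∑ i, a x1 i i) + 2 * 1 * (∑ i, b x1 i * (x1 - x) i)
        - c x1 * ‖x1 - x‖ ^ 2 ≤ G := by
      have h1 := (abs_le.1 hbb).2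
      have h2 : 0 ≤ c x1 * ‖x1 - x‖ ^ 2 := mul_nonneg (hc x1).1 (by positivity)
      have h3 : √K * ‖x1 - x‖ ≤ √K * 1 :=
        mul_le_mul_of_nonneg_left (by linarith) (Real.sqrt_nonneg K)
      rw [hG]
      linarith
    have hvpos : 0 < v x1 := lt_of_lt_of_le (by positivity) hvlow
    have hkpos : 0 < k := by linarith
    have hukv : k * v x1 < u x1 := by
      have : 0 ≤ m * ‖x1 - x‖ ^ 2 := by positivity
      linarith
    have hupos : 0 < u x1 := lt_trans (by positivity) hukv
    rw [max_eq_left hupos.le, max_eq_left hvpos.le] at hmp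
    have h1 : (k * v x1) ^ p ≤ u x1 ^ p := Real.rpow_le_rpow (by positivity) hukv.le (by linarith)
    have h2 : (k * v x1) ^ p = k * k ^ (p - 1) * v x1 ^ p := by
      rw [Real.mul_rpow hkpos.le hvpos.le, mul_comm k, ← Real.rpow_add_one hkpos.ne']
      congr 2
      ring
    have h3 : k0 * (k0 ^ (p - 1) - 1) ≤ k * (k ^ (p - 1) - 1) := by
      have : k0 ^ (p - 1) ≤ k ^ (p - 1) := Real.rpow_le_rpow (by linarith) hk hp1.le
      have h1 : 1 < k0 ^ (p - 1) := Real.one_lt_rpow hk0 hp1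
      exact mul_le_mul hk (by linarith) (by linarith) (by linarith)
    have h4 : A ^ p * 3 ^ (-(α + 2)) * r ^ (-(α + 2)) ≤ v x1 ^ p := by
      calc A ^ p * 3 ^ (-(α + 2)) * r ^ (-(α + 2)) = A ^ p * (3 * r) ^ (-(α + 2)) := by
            rw [Real.mul_rpow (by norm_num) hrpos.le]; ring
        _ ≤ A ^ p * (infDist x1 (frontier Ω)) ^ (-(α + 2)) := by
            refine mul_le_mul_of_nonneg_left ?_ (by positivity)
            exact Real.rpow_le_rpow_of_nonpos hd1pos hdx1' (by linarith)
        _ = (A * (infDist x1 (frontier Ω)) ^ (-α)) ^ p := by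
            rw [Real.mul_rpow hA.le (by positivity), ← Real.rpow_mul hd1pos.le]
            congr 2
            linear_combination hαp
        _ ≤ _ := Real.rpow_le_rpow (by positivity) hvlow (by linarith)
    have h5 : e0 * r ^ (-(α + 2)) ≤ k * (k ^ (p - 1) - 1) * v x1 ^ p := by
      rw [he0, mul_assoc]
      exact mul_le_mul h3 h4 (by positivity) (by linarith)
    have h6 := mul_le_mul_of_nonneg_left hqle hmpos.le
    have h7 : m * G = e0 * r ^ (-(α + 2)) / 2 := by
      rw [hm]
      field_simp
    have h8 : 0 < e0 * r ^ (-(α + 2)) := by positivity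
    rw [h2] at h1
    linarith
  · -- boundary maximum
    have h1 := hP x1 hx1Ω (by linarith)
    rw [hbd] at hpos
    have h2 : m * r ^ 2 = e0 / (2 * G) * r ^ (-α) := by
      rw [hm, mul_assoc, ← Real.rpow_natCast r 2, ← Real.rpow_add hrpos]
      congr 2
      push_cast
      ring
    have h3 : v x1 ≤ C * r ^ (-α) := by
      refine hvupp.trans (mul_le_mul_of_nonneg_left ?_ hC.le)
      exact Real.rpow_le_rpow_of_nonpos hrpos hdx1 (by linarith)
    have h4 : e0 / (2 * G) / C * v x1 ≤ e0 / (2 * G) * r ^ (-α) := by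
      calc _ ≤ e0 / (2 * G) / C * (C * r ^ (-α)) :=
            mul_le_mul_of_nonneg_left h3 (by positivity)
        _ = _ := by field_simp
    rw [h2] at hpos
    linarith

lemma aux_final {n : ℕ} {Ω : Set (E n)}
    (hΩo : IsOpen Ω) (hΩb : IsBounded Ω)
    {a : (E n) → Fin n → Fin n → ℝ} {b : (E n) → Fin n → ℝ}
    {c : (E n) → ℝ} {K lam Lam : ℝ} (hco : CoeffsOK a b c K lam Lam) (hn : 2 ≤ n)
    {p : ℝ} (hp : 1 < p)
    {u v : (E n) → ℝ} (hu : ContDiffOn ℝ 2 u Ω) (hv : ContDiffOn ℝ 2 v Ω)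
    (hequ : ∀ x ∈ Ω, Lop a b c u x = (max (u x) 0) ^ p)
    (heqv : ∀ x ∈ Ω, Lop a b c v x = (max (v x) 0) ^ p)
    {k : ℝ} (hk : 1 < k) {δ : ℝ} (hδ : 0 < δ)
    (hP : ∀ x ∈ Ω, infDist x (frontier Ω) < δ → u x ≤ k * v x) :
    ∀ x ∈ Ω, u x ≤ k * v x := by
  intro x hx
  by_contra hlt
  push Not at hlt
  have hco' := hco
  obtain ⟨-, -, -, hs, hb, hc, hK, hlam, hle, hell⟩ := hco'
  obtain ⟨B, hB⟩ := hΩb.exists_norm_le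
  obtain ⟨γ, hγ⟩ : ∃ γ, γ = K / lam ^ 2 := ⟨_, rfl⟩
  have hγpos : 0 < γ := by rw [hγ]; positivity
  obtain ⟨M, hM⟩ : ∃ M, M = Real.exp (γ * B ^ 2) := ⟨_, rfl⟩
  have hMpos : 0 < M := by rw [hM]; positivity
  set g : (E n) → ℝ := fun y => Real.exp (γ * ‖y - 0‖ ^ 2) - M with hg
  have hgle : ∀ y ∈ Ω, g y ≤ 0 := by
    intro y hy
    simp only [hg, hM, sub_nonpos, sub_zero]
    refine Real.exp_le_exp.2 (mul_le_mul_of_nonneg_left ?_ hγpos.le)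
    exact pow_le_pow_left₀ (norm_nonneg _) (hB y hy) 2
  obtain ⟨η, hη⟩ : ∃ η, η = (u x - k * v x) / (2 * M) := ⟨_, rfl⟩
  have hηpos : 0 < η := by
    rw [hη]
    exact div_pos (by linarith) (by positivity)
  have hηM : η * M = (u x - k * v x) / 2 := by
    rw [hη]; field_simp
  have hcont : ContinuousOn (fun y => (u y - k * v y) - (-η) * g y) Ω := by
    refine (hu.continuousOn.sub (continuousOn_const.mul hv.continuousOn)).sub ?_
    exact Continuous.continuousOn (by fun_prop)
  obtain ⟨x1, hx1, -, hpos, hmax⟩ := aux_exmax hΩo hΩb isClosed_univ hcont hδ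
    (fun y hy _ hyd => by
      have h1 := hP y hy hyd
      have h2 := mul_nonneg hηpos.le (neg_nonneg.2 (hgle y hy))
      linarith) hx (mem_univ x) (by
      have h1 : 0 < η * Real.exp (γ * ‖x - 0‖ ^ 2) := by positivity
      have h2 : η * g x = η * Real.exp (γ * ‖x - 0‖ ^ 2) - η * M := by
        simp only [hg]; ring
      linarith)
  have huC : ContDiffAt ℝ 2 u x1 := hu.contDiffAt (hΩo.mem_nhds hx1)
  have hvC : ContDiffAt ℝ 2 v x1 := hv.contDiffAt (hΩo.mem_nhds hx1)
  have hloc : IsLocalMax (fun y => (u y - k * v y) - (-η) * g y) x1 := by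
    filter_upwards [hΩo.mem_nhds hx1] with y hy
    exact hmax y hy (mem_univ y)
  have hexp : ∀ t, HasDerivAt (fun t => Real.exp (γ * t)) (γ * Real.exp (γ * t)) t := by
    intro t
    have h := ((hasDerivAt_id t).const_mul γ).exp
    simp only [id, mul_one] at h
    rwa [mul_comm] at h
  obtain ⟨hqC, hqL⟩ := aux_radial a b c 0 x1 (fun t => Real.exp (γ * t) - M)
    (fun t => γ * Real.exp (γ * t)) (γ * (γ * Real.exp (γ * ‖x1 - 0‖ ^ 2)))
    (by fun_prop)
    (Filter.Eventually.of_forall fun t => (hexp t).sub_const M)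
    ((hexp _).const_mul γ)
  have huvC : ContDiffAt ℝ 2 (fun y => u y - k * v y) x1 := huC.sub (contDiffAt_const.mul hvC)
  have hgpos : 0 < Lop a b c g x1 := by
    rw [show Lop a b c g x1 = _ from hqL]
    obtain ⟨htr, -, -, hbb⟩ := aux_coeff hco x1 (x1 - 0)
    have hq := (hell x1 (x1 - 0)).1
    have hcg : 0 ≤ c x1 * (-g x1) := mul_nonneg (hc x1).1 (by linarith [hgle x1 hx1])
    have hcg' : c x1 * (Real.exp (γ * ‖x1 - 0‖ ^ 2) - M) = - (c x1 * (-g x1)) := by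
      simp only [hg]; ring
    rw [hcg']
    have h1 := (abs_le.1 hbb).1
    have hr0 := norm_nonneg (x1 - 0)
    set r := ‖x1 - 0‖
    set q := ∑ i, ∑ j, a x1 i j * (x1 - 0) i * (x1 - 0) j
    set tr := ∑ i, a x1 i i
    set bx := ∑ i, b x1 i * (x1 - 0) i
    have hn1 : (2:ℝ) ≤ n := by exact_mod_cast hn
    have htr2 : 2 * lam ≤ tr := le_trans (by gcongr) htr
    have hsK := Real.sq_sqrt hK.le
    have h2 : √K * r < 2 * γ * (lam * r ^ 2) + 2 * lam := by
      have e1 : γ * (lam * r ^ 2) * lam = (√K * r) ^ 2 := by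
        rw [mul_pow, hsK, hγ]
        field_simp
      have e2 : (√K * r) * lam < (2 * γ * (lam * r ^ 2) + 2 * lam) * lam := by
        nlinarith [sq_nonneg (√K * r - lam), sq_nonneg (√K * r), mul_pos hlam hlam]
      exact lt_of_mul_lt_mul_right e2 hlam.le
    have h3 : 0 < 2 * γ * q + tr + bx := by
      have : 2 * γ * (lam * r ^ 2) ≤ 2 * γ * q := by gcongr
      linarith
    have h4 : 0 < 2 * γ * Real.exp (γ * r ^ 2) * (2 * γ * q + tr + bx) := by positivity
    linarith
  have hmp := aux_maxprin hco (huvC.sub (contDiffAt_const.mul hqC)) hloc hpos.le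
  have hlin : Lop a b c (fun y => (u y - k * v y) - (-η) * g y) x1 = _ := aux_lin huvC hqC (-η)
  have hmp' : Lop a b c (fun y => (u y - k * v y) - (-η) * g y) x1 ≤ 0 := hmp
  rw [hlin, aux_lin huC hvC k, hequ x1 hx1, heqv x1 hx1] at hmp'
  have hηg : 0 < η * Lop a b c g x1 := by positivity
  have hmp2 : (max (u x1) 0) ^ p - k * (max (v x1) 0) ^ p + η * Lop a b c g x1 ≤ 0 := by
    have e : (max (u x1) 0) ^ p - k * (max (v x1) 0) ^ p - (-η) * Lop a b c g x1 ≤ 0 := hmp'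
    linarith
  have hukv : k * v x1 < u x1 := by
    have h2 := mul_nonneg hηpos.le (neg_nonneg.2 (hgle x1 hx1))
    linarith
  have hLW : k * (max (v x1) 0) ^ p ≤ (max (u x1) 0) ^ p := by
    rcases le_total (v x1) 0 with h | h
    · rw [max_eq_right h, Real.zero_rpow (by linarith), mul_zero]
      positivity
    · rw [max_eq_left h]
      calc k * v x1 ^ p ≤ k ^ p * v x1 ^ p := by
            refine mul_le_mul_of_nonneg_right ?_ (by positivity)
            exact Real.self_le_rpow_of_one_le hk.le hp.le
        _ = (k * v x1) ^ p := (Real.mul_rpow (by linarith) h).symm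
        _ ≤ _ := Real.rpow_le_rpow (mul_nonneg (by linarith) h)
            (hukv.le.trans (le_max_left _ _)) (by linarith)
  linarith

lemma aux_le {n : ℕ} (hn : 2 ≤ n) {Ω : Set (E n)}
    (hΩo : IsOpen Ω) (hΩne : Ω.Nonempty) (hΩb : IsBounded Ω)
    (hfr : frontier Ω = frontier (closure Ω))
    {a : (E n) → Fin n → Fin n → ℝ} {b : (E n) → Fin n → ℝ}
    {c : (E n) → ℝ} {K lam Lam : ℝ} (hco : CoeffsOK a b c K lam Lam)
    {p : ℝ} (hp : 1 < p) (hp2 : (p - 1) * ((Lam / lam) * (n - 1) - 1) < 2)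
    {u v : (E n) → ℝ} (hu : ContDiffOn ℝ 2 u Ω) (hv : ContDiffOn ℝ 2 v Ω)
    (hequ : ∀ x ∈ Ω, Lop a b c u x = (max (u x) 0) ^ p)
    (heqv : ∀ x ∈ Ω, Lop a b c v x = (max (v x) 0) ^ p)
    (hbv : BlowsUp Ω v) : ∀ x ∈ Ω, u x ≤ v x := by
  haveI : Nonempty (Fin n) := ⟨⟨0, by omega⟩⟩
  haveI : Nontrivial (E n) := inferInstance
  have hne : (frontier Ω).Nonempty := by
    refine nonempty_frontier_iff.2 ⟨hΩne, ?_⟩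
    rintro rfl
    exact NormedSpace.unbounded_univ ℝ (E n) hΩb
  obtain ⟨A, hA, δ1, hδ1, hlow⟩ := aux_lower hΩo hΩb hne hΩne hfr hco hp hp2 hv heqv hbv
  obtain ⟨C, hC, hupp⟩ := aux_upper hΩo hne hco hp hv heqv
  obtain ⟨C', hC', hupp'⟩ := aux_upper hΩo hne hco hp hu hequ
  have key : ∀ k0, 1 < k0 → ∀ x ∈ Ω, u x ≤ k0 * v x := by
    intro k0 hk0
    obtain ⟨η, hη, hstep⟩ := aux_step hΩo hne hco hn hp hu hv hequ heqv hA hδ1 hlow hC hupp hk0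
    obtain ⟨N, hN⟩ := exists_nat_ge ((C' / A) / η)
    have hN' : C' / A ≤ N * η := by rwa [div_le_iff₀ hη] at hN
    have hstart : ∃ δ > 0, ∀ x ∈ Ω, infDist x (frontier Ω) < δ →
        u x ≤ (k0 + N * η) * v x := by
      refine ⟨min δ1 1, by positivity, fun x hx hxd => ?_⟩
      have h1 := hlow x hx (hxd.trans_le (min_le_left _ _))
      have h2 := hupp' x hx (hxd.trans_le (min_le_right _ _)).le
      have hd := aux_dpos hΩo hne hx
      have hvpos : 0 < v x := lt_of_lt_of_le (by positivity) h1
      calc u x ≤ C' * (infDist x (frontier Ω)) ^ (-(2 / (p - 1))) := h2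
        _ = C' / A * (A * (infDist x (frontier Ω)) ^ (-(2 / (p - 1)))) := by field_simp
        _ ≤ C' / A * v x := by gcongr
        _ ≤ (k0 + N * η) * v x := by
          refine mul_le_mul_of_nonneg_right ?_ hvpos.le
          linarith
    have hdown : ∀ j : ℕ, (∃ δ > 0, ∀ x ∈ Ω, infDist x (frontier Ω) < δ →
        u x ≤ (k0 + j * η) * v x) → ∃ δ > 0, ∀ x ∈ Ω, infDist x (frontier Ω) < δ →
        u x ≤ k0 * v x := by
      intro j
      induction j with
      | zero => intro h; simpa using h
      | succ j ih =>
        intro h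
        refine ih (hstep _ ?_ ?_)
        · have : 0 ≤ (j:ℝ) * η := by positivity
          linarith
        · have e : k0 + (j:ℝ) * η + η = k0 + ((j + 1 : ℕ) : ℝ) * η := by push_cast; ring
          rw [e]
          exact h
    obtain ⟨δ, hδ, hP⟩ := hdown N hstart
    exact aux_final hΩo hΩb hco hn hp hu hv hequ heqv hk0 hδ hP
  intro x hx
  have hT : Tendsto (fun k : ℝ => k * v x) (nhdsWithin 1 (Ioi 1)) (nhds (1 * v x)) :=
    ((continuous_id.mul continuous_const).tendsto 1).mono_left nhdsWithin_le_nhds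
  rw [one_mul] at hT
  refine ge_of_tendsto hT ?_
  filter_upwards [self_mem_nhdsWithin] with k hk using key k hk x hx

end helpers

/-- Theorem 3.4 of the paper. If `μ = Λ/λ`,
`p ∈ (1, 1 + 2/(μ(n-1) - 1))` (i.e. `(p-1)(μ(n-1)-1) < 2`), and
`∂Ω = ∂(closure Ω)`, then the problem `Lu = u₊^p`, `u → +∞` at `∂Ω`, has at most
one `C²(Ω)` solution. -/
theorem uniqueness_frontier_condition {n : ℕ} (hn : 2 ≤ n)
    (Ω : Set (EuclideanSpace ℝ (Fin n)))
    (hΩo : IsOpen Ω) (hΩc : IsConnected Ω) (hΩb : IsBounded Ω)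
    (hfr : frontier Ω = frontier (closure Ω))
    (a : EuclideanSpace ℝ (Fin n) → Fin n → Fin n → ℝ)
    (b : EuclideanSpace ℝ (Fin n) → Fin n → ℝ)
    (c : EuclideanSpace ℝ (Fin n) → ℝ)
    (K lam Lam : ℝ) (hco : CoeffsOK a b c K lam Lam)
    (p : ℝ) (hp : 1 < p)
    (hp2 : (p - 1) * ((Lam / lam) * (n - 1) - 1) < 2)
    (u v : EuclideanSpace ℝ (Fin n) → ℝ)
    (hu : ContDiffOn ℝ 2 u Ω) (hv : ContDiffOn ℝ 2 v Ω)
    (hequ : ∀ x ∈ Ω, Lop a b c u x = (max (u x) 0) ^ p)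
    (heqv : ∀ x ∈ Ω, Lop a b c v x = (max (v x) 0) ^ p)
    (hbu : BlowsUp Ω u) (hbv : BlowsUp Ω v) :
    EqOn u v Ω := by
  intro x hx
  exact le_antisymm
    (aux_le hn hΩo hΩc.nonempty hΩb hfr hco hp hp2 hu hv hequ heqv hbv x hx)
    (aux_le hn hΩo hΩc.nonempty hΩb hfr hco hp hp2 hv hu heqv hequ hbu x hx)
end
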